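/- Let k = 𝔽₂(T) and M = T⁴+T+1. Up to isomorphism, there exists exactly one field K with k ⊆ K ⊆ k(Λ_M)·𝔽₂⁵ such that K has genus 4 and class number 1. -/

import Mathlib

set_option synthInstance.maxHeartbeats 1000000
set_option maxHeartbeats 1000000

open scoped Classical

noncomputable section

namespace CFF

variable (F : Type*) [Field F]

/-- `K` is a (congruence) function field in one variable over `F`: a finitely
generated field extension of transcendence degree one. -/
def IsFunctionField (K : Type*) [Field K] [Algebra F K] : Prop :=
  ∃ x : K, Transcendental F x ∧
    FiniteDimensional (IntermediateField.adjoin F {x}) K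

/-- The exact field of constants of `K` is `F`: every element of `K` algebraic
over `F` already lies in `F`. -/
def HasExactConstants (K : Type*) [Field K] [Algebra F K] : Prop :=
  ∀ a : K, IsAlgebraic F a → a ∈ (algebraMap F K).range

variable (K : Type*) [Field K] [Algebra F K]

/-- A place of the function field `K/F`: a proper valuation subring of `K`
containing the constants. -/
def IsPlace (O : ValuationSubring K) : Prop :=
  O ≠ ⊤ ∧ ∀ c : F, algebraMap F K c ∈ O

/-- The type of places (prime divisors) of `K/F`. -/
def Place := {O : ValuationSubring K // IsPlace F K O}

variable {K}

/-- `𝔪`-adic order of an element of a valuation subring. -/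
def ordAux (O : ValuationSubring K) (x : O) : ℕ :=
  sSup {n : ℕ | x ∈ IsLocalRing.maximalIdeal O ^ n}

/-- The order (normalized valuation) of `f ∈ K` at a valuation subring `O`. -/
def ordAt (O : ValuationSubring K) (f : K) : ℤ :=
  if h : f ∈ O then (ordAux O ⟨f, h⟩ : ℤ)
  else -(ordAux O ⟨f⁻¹, (O.mem_or_inv_mem f).resolve_left h⟩ : ℤ)

/-- The constants embed into (the valuation ring of) any place. -/
def constHom (p : Place F K) : F →+* p.1 :=
  (algebraMap F K).codRestrict p.1.toSubring fun c => p.2.2 c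

/-- The map from the constants to the residue field of a place. -/
def residueHom (p : Place F K) : F →+* IsLocalRing.ResidueField p.1 :=
  (IsLocalRing.residue (p.1 : ValuationSubring K)).comp (constHom F p)

/-- The degree of a place: the dimension of its residue field over the
constants. -/
def placeDegree (p : Place F K) : ℕ :=
  letI := (residueHom F p).toAlgebra
  Module.finrank F (IsLocalRing.ResidueField p.1)

variable (K)

/-- The group of divisors of `K/F`. -/
abbrev Divisor := Place F K →₀ ℤ

/-- The degree homomorphism on divisors. -/
def degHom : Divisor F K →+ ℤ :=
  Finsupp.liftAddHom fun p => AddMonoidHom.mulRight (placeDegree F p : ℤ)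

variable {K}

/-- The Riemann-Roch space `L(D)` of a divisor `D` (the span coincides with the
set of `f` with `div f ≥ -D`, which is an `F`-subspace). -/
def RRspace (D : Divisor F K) : Submodule F K :=
  Submodule.span F {f : K | ∀ p : Place F K, 0 ≤ D p + ordAt p.1 f}

/-- `ℓ(D)`, the dimension of the Riemann-Roch space of `D`. -/
def ell (D : Divisor F K) : ℕ := Module.finrank F (RRspace F D)

variable (K)

/-- The genus of `K/F`, via Riemann's theorem: `g = max_D (deg D + 1 - ℓ(D))`. -/
def genus : ℕ :=
  sSup {g : ℕ | ∃ D : Divisor F K, (g : ℤ) = degHom F K D + 1 - ell F D}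

/-- The subgroup of divisors of degree zero. -/
def zeroDivisors : AddSubgroup (Divisor F K) := (degHom F K).ker

/-- The subgroup of principal divisors. -/
def principalDivisors : AddSubgroup (Divisor F K) :=
  AddSubgroup.closure
    {D : Divisor F K | ∃ f : K, f ≠ 0 ∧ ∀ p : Place F K, D p = ordAt p.1 f}

/-- The group of divisor classes of degree zero of `K/F`. -/
def ClassGroup0 :=
  zeroDivisors F K ⧸ (principalDivisors F K).addSubgroupOf (zeroDivisors F K)

instance : AddGroup (ClassGroup0 F K) := by
  unfold ClassGroup0; infer_instance

/-- The class number of `K/F`: the order of the group of divisor classes of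
degree zero. -/
def classNumber : ℕ := Nat.card (ClassGroup0 F K)

section Extension

variable {k L : Type*} [Field k] [Field L] [Algebra F k] [Algebra F L] [Algebra k L]

/-- A place `P` of `L` lies over the place `p` of `k`. -/
def LiesOver (P : Place F L) (p : Place F k) : Prop :=
  P.1.comap (algebraMap k L) = p.1

variable (L)

/-- `p` is inert in `L/k`: there is a unique place of `L` above `p`, and its
degree is `[L:k] · deg p` (i.e. the residue degree is `[L:k]`, so `e = 1`). -/
def IsInert (p : Place F k) : Prop :=
  ∃ P : Place F L, LiesOver F P p ∧
    placeDegree F P = Module.finrank k L * placeDegree F p ∧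
    ∀ P' : Place F L, LiesOver F P' p → P' = P

/-- `p` splits completely in `L/k`: there are `[L:k]` places above `p`, each of
the same degree as `p`. -/
def SplitsCompletely (p : Place F k) : Prop :=
  Nat.card {P : Place F L // LiesOver F P p} = Module.finrank k L ∧
    ∀ P : Place F L, LiesOver F P p → placeDegree F P = placeDegree F p

/-- `p` is totally ramified in `L/k`: there is a unique place above `p`, of the
same degree (so `f = 1` and `e = [L:k]`). -/
def IsTotallyRamified (p : Place F k) : Prop :=
  ∃ P : Place F L, LiesOver F P p ∧ placeDegree F P = placeDegree F p ∧
    ∀ P' : Place F L, LiesOver F P' p → P' = P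

/-- `p` is unramified in `L/k`: at every place above `p` the orders of elements
of `k` are preserved (`e = 1`). -/
def IsUnramifiedAt (p : Place F k) : Prop :=
  ∀ P : Place F L, LiesOver F P p →
    ∀ x : k, ordAt P.1 (algebraMap k L x) = ordAt p.1 x

end Extension

section Rational

/-- The valuation ring of the finite place of `𝔽₂(T)` corresponding to an
irreducible polynomial `P`: it contains all polynomials and `P` lies in its
maximal ideal. -/
def IsFinitePlaceOf (O : ValuationSubring (RatFunc (ZMod 2)))
    (P : Polynomial (ZMod 2)) : Prop :=
  (∀ g : Polynomial (ZMod 2), algebraMap (Polynomial (ZMod 2)) (RatFunc (ZMod 2)) g ∈ O) ∧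
    (algebraMap (Polynomial (ZMod 2)) (RatFunc (ZMod 2)) P)⁻¹ ∉ O

/-- The infinite place `𝔭_∞` of `𝔽₂(T)`: the place where `T` has a pole. -/
def IsInfinitePlace (O : ValuationSubring (RatFunc (ZMod 2))) : Prop :=
  RatFunc.X ∉ O

end Rational

end CFF

namespace CFF

/-- The rational function field `𝔽₂(T)`. -/
abbrev k2 : Type := RatFunc (ZMod 2)

/-- A fixed algebraic closure of `𝔽₂(T)`. -/
abbrev Omega2 : Type := AlgebraicClosure k2

/-- The Carlitz action of `T`: the polynomial `X² + T·X` over `𝔽₂(T)`. -/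
def carlitzT : Polynomial k2 :=
  Polynomial.X ^ 2 + Polynomial.C RatFunc.X * Polynomial.X

/-- Iterates of the Carlitz action of `T`. -/
def carlitzIter : ℕ → Polynomial k2
  | 0 => Polynomial.X
  | n + 1 => carlitzT.comp (carlitzIter n)

/-- The Carlitz polynomial of `M ∈ 𝔽₂[T]` (the Carlitz module is `𝔽₂`-linear in
`M`), whose roots are the `M`-torsion `Λ_M` of the Carlitz module. -/
def carlitz (M : Polynomial (ZMod 2)) : Polynomial k2 :=
  M.sum fun i a => Polynomial.C (algebraMap (ZMod 2) k2 a) * carlitzIter i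

/-- The cyclotomic function field `k(Λ_M)` inside the fixed algebraic closure. -/
def cycloField (M : Polynomial (ZMod 2)) : IntermediateField k2 Omega2 :=
  IntermediateField.adjoin k2 ((carlitz M).rootSet Omega2)

/-- The constant field extension `k·𝔽₃₂` inside the fixed algebraic closure. -/
def constExt32 : IntermediateField k2 Omega2 :=
  IntermediateField.adjoin k2 {x : Omega2 | x ^ 32 = x}

/-- The polynomial `M = T⁴+T+1 ∈ 𝔽₂[T]`. -/
def M0 : Polynomial (ZMod 2) := Polynomial.X ^ 4 + Polynomial.X + 1

end CFF

set_option linter.unusedSectionVars false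

namespace CFF

section DVR

variable {K : Type*} [Field K] (O : ValuationSubring K) [IsDiscreteValuationRing O]

theorem ordAux_irreducible_pow_mul {π : O} (hπ : Irreducible π) (n : ℕ) (u : Oˣ) :
    ordAux O (u * π ^ n) = n := by
  have hset : {m : ℕ | (u : O) * π ^ n ∈ IsLocalRing.maximalIdeal O ^ m} = Set.Iic n := by
    ext m
    rw [Set.mem_ofPred_eq, hπ.maximalIdeal_eq, Ideal.span_singleton_pow,
      Ideal.mem_span_singleton, Units.dvd_mul_left, Set.mem_Iic,
      pow_dvd_pow_iff hπ.ne_zero hπ.not_isUnit]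
  rw [ordAux, hset, csSup_Iic]

theorem exists_valuation_eq_zpow_ordAt :
    ∃ π : K, π ≠ 0 ∧ O.valuation π < 1 ∧
      ∀ f : K, f ≠ 0 → O.valuation f = O.valuation π ^ ordAt O f := by
  obtain ⟨π, hπ⟩ := IsDiscreteValuationRing.exists_irreducible O
  have key : ∀ x : O, x ≠ 0 → O.valuation (x : K) = O.valuation (π : K) ^ ordAux O x := by
    intro x hx
    obtain ⟨n, u, rfl⟩ := IsDiscreteValuationRing.eq_unit_mul_pow_irreducible hx hπ
    rw [ordAux_irreducible_pow_mul O hπ]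
    simp [O.valuation_unit u]
  refine ⟨π, by simpa using hπ.ne_zero, (O.valuation_lt_one_iff π).1 ?_, fun f hf => ?_⟩
  · rw [hπ.maximalIdeal_eq]
    exact Ideal.mem_span_singleton_self π
  · unfold ordAt
    split_ifs with h
    · simpa using key ⟨f, h⟩ (fun h0 => hf (congrArg Subtype.val h0))
    · have h' := (O.mem_or_inv_mem f).resolve_left h
      have := key ⟨f⁻¹, h'⟩ (fun h0 => hf (inv_eq_zero.1 (congrArg Subtype.val h0)))
      rw [zpow_neg, zpow_natCast, ← this, map_inv₀, inv_inv]

omit [IsDiscreteValuationRing O] in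
theorem ordAt_zero : ordAt O (0 : K) = 0 := by
  have h : (0 : K) ∈ O := O.zero_mem
  have h2 : {n : ℕ | (⟨0, h⟩ : O) ∈ IsLocalRing.maximalIdeal O ^ n} = Set.univ := by
    ext n
    simp [show (⟨0, h⟩ : O) = 0 from rfl]
  rw [ordAt, dif_pos h, ordAux, h2, Nat.sSup_of_not_bddAbove not_bddAbove_univ]
  rfl

variable {O}

theorem valuation_le_iff_ordAt {f g : K} (hf : f ≠ 0) (hg : g ≠ 0) :
    O.valuation f ≤ O.valuation g ↔ ordAt O g ≤ ordAt O f := by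
  obtain ⟨π, h0, h1, h⟩ := exists_valuation_eq_zpow_ordAt O
  rw [h f hf, h g hg]
  exact zpow_le_zpow_iff_right_of_lt_one₀ (by simpa [zero_lt_iff] using h0) h1

theorem ordAt_mul {f g : K} (hf : f ≠ 0) (hg : g ≠ 0) :
    ordAt O (f * g) = ordAt O f + ordAt O g := by
  obtain ⟨π, h0, h1, h⟩ := exists_valuation_eq_zpow_ordAt O
  have hp : 0 < O.valuation π := by simpa [zero_lt_iff] using h0
  apply zpow_right_injective₀ hp h1.ne
  simp only
  rw [zpow_add₀ hp.ne', ← h _ (mul_ne_zero hf hg), ← h _ hf, ← h _ hg, map_mul]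

theorem ordAt_one : ordAt O (1 : K) = 0 := by
  have := ordAt_mul (O := O) (one_ne_zero (α := K)) one_ne_zero
  simpa using this

theorem ordAt_inv {f : K} : ordAt O f⁻¹ = -ordAt O f := by
  by_cases hf : f = 0
  · simp [hf, ordAt_zero]
  · have := ordAt_mul (O := O) hf (inv_ne_zero hf)
    rw [mul_inv_cancel₀ hf, ordAt_one] at this
    omega

theorem ordAt_div {f g : K} (hf : f ≠ 0) (hg : g ≠ 0) :
    ordAt O (f / g) = ordAt O f - ordAt O g := by
  rw [div_eq_mul_inv, ordAt_mul hf (inv_ne_zero hg), ordAt_inv, sub_eq_add_neg]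

theorem ordAt_pow {f : K} (hf : f ≠ 0) (n : ℕ) : ordAt O (f ^ n) = n * ordAt O f := by
  induction n with
  | zero => simp [ordAt_one]
  | succ n ih => rw [pow_succ, ordAt_mul (pow_ne_zero _ hf) hf, ih]; push_cast; ring

theorem mem_iff_ordAt_nonneg {f : K} : f ∈ O ↔ 0 ≤ ordAt O f := by
  by_cases hf : f = 0
  · simp [hf, ordAt_zero]
  · rw [← O.valuation_le_one_iff, ← map_one O.valuation,
      valuation_le_iff_ordAt hf one_ne_zero, ordAt_one]

theorem valuation_lt_one_iff_ordAt {f : K} (hf : f ≠ 0) :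
    O.valuation f < 1 ↔ 0 < ordAt O f := by
  rw [← map_one O.valuation, ← not_le, valuation_le_iff_ordAt one_ne_zero hf, ordAt_one, not_le]

theorem valuation_eq_one_iff_ordAt {f : K} (hf : f ≠ 0) :
    O.valuation f = 1 ↔ ordAt O f = 0 := by
  rw [le_antisymm_iff, ← map_one O.valuation, valuation_le_iff_ordAt one_ne_zero hf,
    valuation_le_iff_ordAt hf one_ne_zero, ordAt_one]
  omega

theorem min_ordAt_le_ordAt_add {f g : K} (hf : f ≠ 0) (hg : g ≠ 0) (hfg : f + g ≠ 0) :
    min (ordAt O f) (ordAt O g) ≤ ordAt O (f + g) := by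
  rcases le_max_iff.1 (O.valuation.map_add f g) with h | h
  · exact (min_le_left _ _).trans ((valuation_le_iff_ordAt hfg hf).1 h)
  · exact (min_le_right _ _).trans ((valuation_le_iff_ordAt hfg hg).1 h)

variable (O) in
theorem exists_ordAt_eq_one : ∃ π : K, π ≠ 0 ∧ ordAt O π = 1 := by
  obtain ⟨π, h0, h1, h⟩ := exists_valuation_eq_zpow_ordAt O
  have hp : 0 < O.valuation π := by simpa [zero_lt_iff] using h0
  refine ⟨π, h0, zpow_right_injective₀ hp h1.ne ?_⟩
  simp only
  rw [← h _ h0, zpow_one]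

end DVR

end CFF

namespace CFF

section Dedekind

open IsDedekindDomain WithZero

variable {S K : Type*} [CommRing S] [IsDedekindDomain S] [Field K] [Algebra S K]
  [IsFractionRing S K]

/-- The centre of a valuation ring on a subring. -/
def centre (S : Type*) {K : Type*} [CommRing S] [Field K] [Algebra S K]
    (P : ValuationSubring K) (h : ∀ s : S, algebraMap S K s ∈ P) : Ideal S :=
  (IsLocalRing.maximalIdeal P).comap ((algebraMap S K).codRestrict P.toSubring h)

instance (P : ValuationSubring K) (h : ∀ s : S, algebraMap S K s ∈ P) :
    (centre S P h).IsPrime := by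
  unfold centre; infer_instance

theorem mem_maximalIdeal_iff {P : ValuationSubring K} (x : P) :
    x ∈ IsLocalRing.maximalIdeal P ↔ P.valuation (x : K) < 1 :=
  (P.valuation_lt_one_iff x)

theorem mem_centre {S : Type*} [CommRing S] [Algebra S K] {P : ValuationSubring K}
    {h : ∀ s : S, algebraMap S K s ∈ P} {s : S} :
    s ∈ centre S P h ↔ P.valuation (algebraMap S K s) < 1 := by
  rw [centre, Ideal.mem_comap, mem_maximalIdeal_iff]
  rfl

theorem centre_ne_bot {P : ValuationSubring K} (h : ∀ s : S, algebraMap S K s ∈ P) (hP : P ≠ ⊤) :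
    centre S P h ≠ ⊥ := by
  contrapose! hP
  rw [eq_top_iff]
  intro x _
  obtain ⟨a, b, hb, rfl⟩ := IsFractionRing.div_surjective (A := S) x
  have hb' : P.valuation (algebraMap S K b) = 1 := by
    refine le_antisymm ((P.valuation_le_one_iff _).2 (h b)) (not_lt.1 fun hlt => ?_)
    have : b ∈ centre S P h := mem_centre.2 hlt
    rw [hP, Ideal.mem_bot] at this
    exact nonZeroDivisors.ne_zero hb this
  rw [← P.valuation_le_one_iff, map_div₀, hb', div_one]
  exact (P.valuation_le_one_iff _).2 (h a)

/-- The centre of a nontrivial valuation ring as a nonzero prime. -/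
def centreSpectrum (S : Type*) [CommRing S] [IsDedekindDomain S] [Algebra S K] [IsFractionRing S K]
    (P : ValuationSubring K) (h : ∀ s : S, algebraMap S K s ∈ P) (hP : P ≠ ⊤) :
    HeightOneSpectrum S :=
  ⟨centre S P h, inferInstance, centre_ne_bot h hP⟩

theorem valuationSubringAtPrime_centre {P : ValuationSubring K}
    (h : ∀ s : S, algebraMap S K s ∈ P) (hP : P ≠ ⊤) :
    HeightOneSpectrum.valuationSubringAtPrime K (centreSpectrum S P h hP) = P := by
  refine ValuationSubring.eq_of_le_of_ne_top _ ?_ hP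
  rintro x ⟨a, s, hs, rfl⟩
  have hs' : P.valuation (algebraMap S K s) = 1 :=
    le_antisymm ((P.valuation_le_one_iff _).2 (h s)) (not_lt.1 fun hlt => hs (mem_centre.2 hlt))
  refine (P.valuation_le_one_iff _).1 ?_
  rw [map_mul, map_inv₀, hs', inv_one, mul_one]
  exact (P.valuation_le_one_iff _).2 (h a)

theorem isDiscreteValuationRing_of_dedekind {P : ValuationSubring K}
    (h : ∀ s : S, algebraMap S K s ∈ P) (hP : P ≠ ⊤) : IsDiscreteValuationRing P := by
  have e := valuationSubringAtPrime_centre h hP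
  rw [← e]
  have : IsLocalization.AtPrime (HeightOneSpectrum.valuationSubringAtPrime K
      (centreSpectrum S P h hP)) (centreSpectrum S P h hP).asIdeal :=
    inferInstanceAs (IsLocalization _ _)
  exact IsLocalization.AtPrime.isDiscreteValuationRing_of_dedekind_domain S
    (centreSpectrum S P h hP).ne_bot _

theorem centre_injective {P Q : ValuationSubring K}
    (h : ∀ s : S, algebraMap S K s ∈ P) (hP : P ≠ ⊤)
    (h' : ∀ s : S, algebraMap S K s ∈ Q) (hQ : Q ≠ ⊤) (e : centre S P h = centre S Q h') :
    P = Q := by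
  rw [← valuationSubringAtPrime_centre h hP, ← valuationSubringAtPrime_centre h' hQ]
  congr 1
  exact HeightOneSpectrum.ext e

theorem residue_centre_surjective {P : ValuationSubring K}
    (h : ∀ s : S, algebraMap S K s ∈ P) (hP : P ≠ ⊤) {x : K} (hx : x ∈ P) :
    ∃ s : S, P.valuation (x - algebraMap S K s) < 1 := by
  rw [← valuationSubringAtPrime_centre h hP] at hx
  obtain ⟨a, s, hs, rfl⟩ := hx
  have : (centre S P h).IsMaximal := (centreSpectrum S P h hP).isMaximal
  obtain ⟨t, ht⟩ := Ideal.IsMaximal.exists_inv this hs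
  obtain ⟨i, hi, hts⟩ := ht
  have hs' : P.valuation (algebraMap S K s) = 1 :=
    le_antisymm ((P.valuation_le_one_iff _).2 (h s)) (not_lt.1 fun hlt => hs (mem_centre.2 hlt))
  have hs0 : algebraMap S K s ≠ 0 := by
    rintro h0; simp [h0] at hs'
  refine ⟨a * t, ?_⟩
  have : algebraMap S K a * (algebraMap S K s)⁻¹ - algebraMap S K (a * t) =
      algebraMap S K (a * i) * (algebraMap S K s)⁻¹ := by
    have : i = 1 - t * s := by rw [← hts]; ring
    rw [this]
    simp only [map_mul, map_sub, map_one]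
    field_simp
  rw [this, map_mul, map_inv₀, hs', inv_one, mul_one]
  exact mem_centre (h := h).1 (Ideal.mul_mem_left _ _ hi)

theorem valuation_centre_eq {P : ValuationSubring K}
    (h : ∀ s : S, algebraMap S K s ∈ P) (hP : P ≠ ⊤) {f : K} (hf : f ≠ 0) :
    (centreSpectrum S P h hP).valuation K f = exp (-ordAt P f) := by
  have := isDiscreteValuationRing_of_dedekind h hP
  have he : ((centreSpectrum S P h hP).valuation K).IsEquiv P.valuation := by
    rw [Valuation.isEquiv_iff_valuationSubring,
      ← HeightOneSpectrum.valuationSubringAtPrime_eq_valuationSubring,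
      valuationSubringAtPrime_centre, ValuationSubring.valuationSubring_valuation]
  set v := (centreSpectrum S P h hP).valuation K
  obtain ⟨π, h0, h1, hπ⟩ := exists_valuation_eq_zpow_ordAt P
  have key : ∀ g : K, g ≠ 0 → v g = v π ^ ordAt P g := by
    intro g hg
    have : P.valuation (g / π ^ ordAt P g) = 1 := by
      rw [map_div₀, map_zpow₀, hπ g hg, div_self]
      exact zpow_ne_zero _ (by simpa using h0)
    rw [← he.eq_one_iff_eq_one, map_div₀, map_zpow₀] at this
    exact (div_eq_one_iff_eq (zpow_ne_zero _ (by simpa using h0))).1 this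
  have hvπ : v π < 1 := he.lt_one_iff_lt_one.2 h1
  obtain ⟨u, hu⟩ := (centreSpectrum S P h hP).valuation_exists_uniformizer K
  have hu0 : u ≠ 0 := by rintro rfl; rw [map_zero] at hu; exact exp_ne_zero hu.symm
  have hu2 := key u hu0
  change v u = _ at hu
  have hvπ0 : v π ≠ 0 := by simpa using h0
  obtain ⟨a, ha⟩ : ∃ a : ℤ, v π = exp a := ⟨log (v π), (exp_log hvπ0).symm⟩
  rw [hu, ha, ← exp_zsmul, exp_inj] at hu2
  rw [ha, ← exp_zero, exp_lt_exp] at hvπ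
  have : a = -1 := by
    simp only [smul_eq_mul] at hu2
    have := Int.isUnit_iff.1 (IsUnit.of_mul_eq_one (-ordAt P u) (by linarith : a * -ordAt P u = 1))
    omega
  rw [key f hf, ha, ← exp_zsmul, this]; simp

theorem pow_mem_centre_iff {P : ValuationSubring K}
    (h : ∀ s : S, algebraMap S K s ∈ P) (hP : P ≠ ⊤) {s : S} (hs : s ≠ 0) (n : ℕ) :
    s ∈ centre S P h ^ n ↔ (n : ℤ) ≤ ordAt P (algebraMap S K s) := by
  have := (centreSpectrum S P h hP).intValuation_le_pow_iff_mem s n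
  change _ ↔ s ∈ centre S P h ^ n at this
  rw [← this, ← HeightOneSpectrum.valuation_of_algebraMap (K := K),
    valuation_centre_eq h hP (by simpa using hs), exp_le_exp,
    neg_le_neg_iff]

end Dedekind

end CFF

namespace CFF

section Residue

open IsDedekindDomain

variable {K : Type*} [Field K]

theorem residue_eq_zero_iff' {P : ValuationSubring K} (x : P) :
    IsLocalRing.residue P x = 0 ↔ P.valuation (x : K) < 1 := by
  rw [IsLocalRing.residue_eq_zero_iff, mem_maximalIdeal_iff]

theorem residue_eq_iff {P : ValuationSubring K} (x y : P) :
    IsLocalRing.residue P x = IsLocalRing.residue P y ↔ P.valuation ((x : K) - y) < 1 := by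
  rw [← sub_eq_zero, ← map_sub, residue_eq_zero_iff']
  rfl

theorem natCard_residueField_eq {S : Type*} [CommRing S] [IsDedekindDomain S] [Algebra S K]
    [IsFractionRing S K] {P : ValuationSubring K}
    (h : ∀ s : S, algebraMap S K s ∈ P) (hP : P ≠ ⊤) :
    Nonempty ((S ⧸ centre S P h) ≃ IsLocalRing.ResidueField P) := by
  set φ : S →+* IsLocalRing.ResidueField P :=
    (IsLocalRing.residue P).comp ((algebraMap S K).codRestrict P.toSubring h) with hφ
  have hker : RingHom.ker φ = centre S P h := by
    ext s
    rw [RingHom.mem_ker, mem_centre, hφ, RingHom.comp_apply, residue_eq_zero_iff']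
    rfl
  have hsurj : Function.Surjective φ := by
    intro y
    obtain ⟨x, rfl⟩ := IsLocalRing.residue_surjective y
    obtain ⟨s, hs⟩ := residue_centre_surjective h hP x.2
    refine ⟨s, ?_⟩
    rw [hφ, RingHom.comp_apply, eq_comm, residue_eq_iff]
    exact hs
  rw [← hker]
  exact ⟨(RingHom.quotientKerEquivOfSurjective hsurj).toEquiv⟩

theorem natCard_residueField [Algebra (ZMod 2) K] (p : Place (ZMod 2) K)
    [Finite (IsLocalRing.ResidueField p.1)] :
    Nat.card (IsLocalRing.ResidueField p.1) = 2 ^ placeDegree (ZMod 2) p := by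
  let := (residueHom (ZMod 2) p).toAlgebra
  rw [Module.natCard_eq_pow_finrank (K := ZMod 2) (V := IsLocalRing.ResidueField p.1),
    Nat.card_eq_fintype_card, ZMod.card]
  rfl

theorem placeDegree_pos [Algebra (ZMod 2) K] (p : Place (ZMod 2) K)
    [Finite (IsLocalRing.ResidueField p.1)] : 0 < placeDegree (ZMod 2) p := by
  let := (residueHom (ZMod 2) p).toAlgebra
  exact Module.finrank_pos (R := ZMod 2) (M := IsLocalRing.ResidueField p.1)

end Residue

section Conorm

variable {R k K : Type*} [CommRing R] [IsDedekindDomain R] [Field k] [Algebra R k]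
  [IsFractionRing R k] [Field K] [Algebra k K] [Algebra R K] [IsScalarTower R k K]
  [FiniteDimensional k K] [Algebra.IsSeparable k K]

omit [IsDedekindDomain R] in
theorem mem_of_isIntegral {P : ValuationSubring K} (h : ∀ r : R, algebraMap R K r ∈ P)
    {s : K} (hs : IsIntegral R s) : s ∈ P := by
  let : Algebra R P := ((algebraMap R K).codRestrict P.toSubring h).toAlgebra
  have : IsScalarTower R P K := IsScalarTower.of_algebraMap_eq fun r => rfl
  obtain ⟨y, rfl⟩ := IsIntegrallyClosed.isIntegral_iff.1 (hs.tower_top (A := P))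
  exact y.2

variable (R k K) in
include k in
theorem isDedekindDomain_integralClosure : IsDedekindDomain (integralClosure R K) :=
  IsIntegralClosure.isDedekindDomain R k K _

variable (R k K) in
include k in
omit [Algebra.IsSeparable k K] [IsDedekindDomain R] in
theorem isFractionRing_integralClosure [IsDomain R] : IsFractionRing (integralClosure R K) K :=
  IsIntegralClosure.isFractionRing_of_finite_extension R k K _

variable (R k K) in
include k in
theorem finite_integralClosure : Module.Finite R (integralClosure R K) :=
  IsIntegralClosure.finite R k K _

include k in
theorem isDiscreteValuationRing_of_finite {P : ValuationSubring K}
    (h : ∀ r : R, algebraMap R K r ∈ P) (hP : P ≠ ⊤) : IsDiscreteValuationRing P := by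
  have := isDedekindDomain_integralClosure R k K
  have := isFractionRing_integralClosure R k K
  exact isDiscreteValuationRing_of_dedekind (S := integralClosure R K)
    (fun s => mem_of_isIntegral h s.2) hP

omit [IsDedekindDomain R] in
theorem centre_under {P : ValuationSubring K} (h : ∀ r : R, algebraMap R K r ∈ P) :
    (centre (integralClosure R K) P (fun s => mem_of_isIntegral h s.2)).under R =
      centre R P h := by
  ext r
  rw [Ideal.mem_comap, mem_centre, mem_centre]
  rfl

include k in
theorem centre_ne_bot_of_finite {P : ValuationSubring K} (h : ∀ r : R, algebraMap R K r ∈ P)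
    (hP : P ≠ ⊤) : centre R P h ≠ ⊥ := by
  have := isDedekindDomain_integralClosure R k K
  have := isFractionRing_integralClosure R k K
  rw [← centre_under h]
  have := centre_ne_bot (S := integralClosure R K) (fun s => mem_of_isIntegral h s.2) hP
  exact mt Ideal.eq_bot_of_comap_eq_bot this

include k in
theorem finite_and_natCard_residueField {P : ValuationSubring K}
    (h : ∀ r : R, algebraMap R K r ∈ P) (hP : P ≠ ⊤) [Finite (R ⧸ centre R P h)] :
    Finite (IsLocalRing.ResidueField P) ∧ Nat.card (IsLocalRing.ResidueField P) =
      Nat.card (R ⧸ centre R P h) ^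
        ((centre (integralClosure R K) P (fun s => mem_of_isIntegral h s.2)).inertiaDeg R) := by
  have := isDedekindDomain_integralClosure R k K
  have := isFractionRing_integralClosure R k K
  have := finite_integralClosure R k K
  obtain ⟨e⟩ := natCard_residueField_eq (S := integralClosure R K)
    (fun s => mem_of_isIntegral h s.2) hP
  have hlo : (centre (integralClosure R K) P (fun s => mem_of_isIntegral h s.2)).LiesOver
    (centre R P h) := ⟨(centre_under h).symm⟩
  have : (centre R P h).IsMaximal :=
    Ideal.IsPrime.isMaximal inferInstance (centre_ne_bot_of_finite (k := k) h hP)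
  have : (centre (integralClosure R K) P (fun s => mem_of_isIntegral h s.2)).IsMaximal :=
    Ideal.IsPrime.isMaximal inferInstance (centre_ne_bot _ hP)
  let := Ideal.Quotient.field (centre R P h)
  have : Module.Finite (R ⧸ centre R P h) (integralClosure R K ⧸
    (centre (integralClosure R K) P (fun s => mem_of_isIntegral h s.2))) :=
    Module.Finite.of_restrictScalars_finite R _ _
  have : Finite (integralClosure R K ⧸
    (centre (integralClosure R K) P (fun s => mem_of_isIntegral h s.2))) :=
    Module.finite_of_finite (R ⧸ centre R P h)
  refine ⟨Finite.of_equiv _ e, ?_⟩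
  rw [← Nat.card_congr e, Ideal.inertiaDeg_eq_of_isMaximal (centre R P h),
    Module.natCard_eq_pow_finrank (K := R ⧸ centre R P h)]

include k in
theorem ramificationIdx_centre {P : ValuationSubring K}
    (h : ∀ r : R, algebraMap R K r ∈ P) (hP : P ≠ ⊤) {π : R} (hπ : π ≠ 0)
    (hq : Ideal.span {π} = centre R P h) :
    ((centre (integralClosure R K) P (fun s => mem_of_isIntegral h s.2)).ramificationIdx R : ℤ) =
      ordAt P (algebraMap R K π) := by
  have := isDedekindDomain_integralClosure R k K
  have := isFractionRing_integralClosure R k K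
  have hDVR := isDiscreteValuationRing_of_finite (k := k) h hP
  set 𝔓 := centre (integralClosure R K) P (fun s => mem_of_isIntegral h s.2) with h𝔓
  have h𝔓0 : 𝔓 ≠ ⊥ := centre_ne_bot _ hP
  have hlo : 𝔓.LiesOver (centre R P h) := ⟨(centre_under h).symm⟩
  have hπ' : algebraMap R (integralClosure R K) π ≠ 0 := by
    intro h0
    have : algebraMap k K (algebraMap R k π) = 0 := by
      rw [← IsScalarTower.algebraMap_apply,
        IsScalarTower.algebraMap_apply R (integralClosure R K) K, h0, map_zero]
    exact hπ (by simpa using this)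
  have hmap : (centre R P h).map (algebraMap R (integralClosure R K)) =
      Ideal.span {algebraMap R (integralClosure R K) π} := by
    rw [← hq, Ideal.map_span, Set.image_singleton]
  have hmap0 : (centre R P h).map (algebraMap R (integralClosure R K)) ≠ ⊥ := by
    rw [hmap, Ne, Ideal.span_singleton_eq_bot]; exact hπ'
  rw [Ideal.IsDedekindDomain.ramificationIdx_eq_multiplicity (centre R P h) 𝔓 hmap0, hmap]
  have hfin : FiniteMultiplicity 𝔓 (Ideal.span {algebraMap R (integralClosure R K) π}) := by
    refine FiniteMultiplicity.of_prime_left (Ideal.prime_of_isPrime h𝔓0 inferInstance) ?_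
    rw [← hmap]; exact hmap0
  have key : ∀ n : ℕ, 𝔓 ^ n ∣ Ideal.span {algebraMap R (integralClosure R K) π} ↔
      (n : ℤ) ≤ ordAt P (algebraMap R K π) := by
    intro n
    rw [Ideal.dvd_span_singleton, pow_mem_centre_iff _ hP hπ']
    rfl
  have h0 : 0 ≤ ordAt P (algebraMap R K π) := mem_iff_ordAt_nonneg.1 (h π)
  lift ordAt P (algebraMap R K π) to ℕ using h0 with m
  refine le_antisymm ((key _).1 (pow_multiplicity_dvd _ _)) ?_
  exact_mod_cast hfin.le_multiplicity_of_pow_dvd ((key m).2 le_rfl)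

/-- One half of the fundamental identity, for valuation rings over a fixed prime. -/
theorem sum_ordAt_mul_le {ι : Type*} (s : Finset ι) (P : ι → ValuationSubring K)
    (hinj : Set.InjOn P s) (h : ∀ i, ∀ r : R, algebraMap R K r ∈ P i) (hP : ∀ i, P i ≠ ⊤) {π : R}
    (hπ : Prime π) (hπP : ∀ i, (P i).valuation (algebraMap R K π) < 1) :
    ∑ i ∈ s, ordAt (P i) (algebraMap R K π) *
      ((centre (integralClosure R K) (P i) (fun s => mem_of_isIntegral (h i) s.2)).inertiaDeg R) ≤
      Module.finrank k K := by
  have := isDedekindDomain_integralClosure R k K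
  have := isFractionRing_integralClosure R k K
  have := finite_integralClosure R k K
  rcases s.eq_empty_or_nonempty with rfl | ⟨i₀, -⟩
  · simp
  have hq : ∀ i, Ideal.span {π} = centre R (P i) (h i) := by
    intro i
    have hmax : (Ideal.span {π}).IsMaximal :=
      Ideal.IsPrime.isMaximal ((Ideal.span_singleton_prime hπ.ne_zero).2 hπ)
        (by simpa using hπ.ne_zero)
    refine hmax.eq_of_le (Ideal.IsPrime.ne_top inferInstance) ?_
    rw [Ideal.span_singleton_le_iff_mem, mem_centre]
    exact hπP i
  have hpr : (Ideal.span {π}).IsPrime := (Ideal.span_singleton_prime hπ.ne_zero).2 hπ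
  have hmax : (Ideal.span {π}).IsMaximal :=
    Ideal.IsPrime.isMaximal hpr (by simpa using hπ.ne_zero)
  have : IsDomain (integralClosure R K) := inferInstance
  have hinj' : Function.Injective (algebraMap R K) := by
    rw [IsScalarTower.algebraMap_eq R k K]
    exact (algebraMap k K).injective.comp (IsFractionRing.injective R k)
  have : FaithfulSMul R K := (faithfulSMul_iff_algebraMap_injective R K).2 hinj'
  have : Module.IsTorsionFree R (integralClosure R K) := inferInstance
  have : Module.Flat R (integralClosure R K) := inferInstance
  let c : ι → (Ideal.span {π}).primesOver (integralClosure R K) := fun i =>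
    ⟨centre (integralClosure R K) (P i) (fun s => mem_of_isIntegral (h i) s.2), inferInstance,
      ⟨(hq i).trans (centre_under (h i)).symm⟩⟩
  have hfin : Finite ((Ideal.span {π}).primesOver (integralClosure R K)) :=
    (Algebra.QuasiFinite.finite_primesOver (Ideal.span {π})).to_subtype
  let := Fintype.ofFinite ((Ideal.span {π}).primesOver (integralClosure R K))
  have hc : Set.InjOn c s := by
    intro i hi j hj e
    exact hinj hi hj (centre_injective (S := integralClosure R K)
      (fun s => mem_of_isIntegral (h i) s.2) (hP i)
      (fun s => mem_of_isIntegral (h j) s.2) (hP j) (congrArg Subtype.val e))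
  have hsum := Ideal.sum_ramification_inertia_eq_finrank (Ideal.span {π}) (integralClosure R K)
  have hrank : Module.finrank R (integralClosure R K) = Module.finrank k K :=
    (IsFractionRing.finrank_eq R k (integralClosure R K) K).symm
  rw [← hrank, ← hsum]
  push_cast
  calc _ = ∑ i ∈ s, (((c i).1.ramificationIdx R : ℤ) * ((c i).1.inertiaDeg R : ℤ)) := by
        refine Finset.sum_congr rfl fun i _ => ?_
        rw [← ramificationIdx_centre (k := k) (h i) (hP i) hπ.ne_zero (hq i)]
    _ = ∑ q ∈ s.image c, ((q.1.ramificationIdx R : ℤ) * (q.1.inertiaDeg R : ℤ)) := by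
        rw [Finset.sum_image hc]
    _ ≤ _ := Finset.sum_le_univ_sum_of_nonneg fun q => by positivity

end Conorm

end CFF

namespace CFF

theorem valuation_lt_one_iff_inv_notMem {C : Type*} [Field C] (O : ValuationSubring C) {x : C}
    (hx : x ≠ 0) : O.valuation x < 1 ↔ x⁻¹ ∉ O := by
  rw [← ValuationSubring.valuation_le_one_iff, map_inv₀, not_le,
    one_lt_inv₀ (by simpa [zero_lt_iff] using hx)]

theorem valuation_comap_lt_one {C C' : Type*} [Field C] [Field C'] (O : ValuationSubring C')
    (f : C →+* C') (x : C) : (O.comap f).valuation x < 1 ↔ O.valuation (f x) < 1 := by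
  by_cases hx : x = 0
  · simp [hx]
  rw [valuation_lt_one_iff_inv_notMem _ hx, valuation_lt_one_iff_inv_notMem _ (by simpa using hx),
    ValuationSubring.mem_comap, map_inv₀]

section Galois

variable {R k C : Type*} [CommRing R] [IsDedekindDomain R] [Field k] [Algebra R k]
  [IsFractionRing R k] [Field C] [Algebra k C] [Algebra R C] [IsScalarTower R k C]
  [FiniteDimensional k C] [IsGalois k C]

theorem comap_smul_eq_of_centre {P Q : ValuationSubring C}
    (h : ∀ r : R, algebraMap R C r ∈ P) (hP : P ≠ ⊤)
    (h' : ∀ r : R, algebraMap R C r ∈ Q) (σ : C ≃ₐ[k] C)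
    (hσ : ∀ s : integralClosure R C, P.valuation (s : C) < 1 ↔ Q.valuation (σ s) < 1) (x : C) :
    x ∈ P ↔ σ x ∈ Q := by
  have := isDedekindDomain_integralClosure R k C
  have := isFractionRing_integralClosure R k C
  have hh : ∀ s : integralClosure R C, algebraMap (integralClosure R C) C s ∈ P :=
    fun s => mem_of_isIntegral h s.2
  have hQ' : ∀ s : integralClosure R C,
      algebraMap (integralClosure R C) C s ∈ Q.comap (σ : C →+* C) := by
    intro s
    rw [ValuationSubring.mem_comap]
    exact mem_of_isIntegral h' (s.2.map (σ.toAlgHom.restrictScalars R))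
  have hcen : centre (integralClosure R C) P hh =
      centre (integralClosure R C) (Q.comap (σ : C →+* C)) hQ' := by
    ext s
    rw [mem_centre, mem_centre, valuation_comap_lt_one]
    exact hσ s
  have hQt : Q.comap (σ : C →+* C) ≠ ⊤ := by
    intro ht
    apply centre_ne_bot hh hP
    rw [hcen, eq_bot_iff]
    intro s hs
    rw [mem_centre, ht] at hs
    by_contra h0
    rw [valuation_lt_one_iff_inv_notMem _ (by simpa using h0)] at hs
    exact hs (ValuationSubring.mem_top _)
  have hPe : P = Q.comap (σ : C →+* C) := centre_injective hh hP hQ' hQt hcen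
  conv_lhs => rw [hPe]
  rfl

include k in
theorem exists_conj {P Q : ValuationSubring C}
    (h : ∀ r : R, algebraMap R C r ∈ P) (hP : P ≠ ⊤)
    (h' : ∀ r : R, algebraMap R C r ∈ Q) (hc : centre R P h = centre R Q h') :
    ∃ σ : C ≃ₐ[k] C, ∀ x, x ∈ P ↔ σ x ∈ Q := by
  have := isDedekindDomain_integralClosure R k C
  have := isFractionRing_integralClosure R k C
  have := Algebra.isInvariant_of_isGalois' R k C (integralClosure R C)
  have : Finite (integralClosure R C ≃ₐ[R] integralClosure R C) :=
    Finite.of_equiv _ (galRestrict R k C (integralClosure R C)).toEquiv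
  have hh : ∀ s : integralClosure R C, algebraMap (integralClosure R C) C s ∈ P :=
    fun s => mem_of_isIntegral h s.2
  have hh' : ∀ s : integralClosure R C, algebraMap (integralClosure R C) C s ∈ Q :=
    fun s => mem_of_isIntegral h' s.2
  obtain ⟨g, hg⟩ := Algebra.IsInvariant.exists_smul_of_under_eq R (integralClosure R C)
    (integralClosure R C ≃ₐ[R] integralClosure R C)
    (centre (integralClosure R C) P hh)
    (centre (integralClosure R C) Q hh')
    ((centre_under h).trans (hc.trans (centre_under h').symm))
  obtain ⟨σ, rfl⟩ := (galRestrict R k C (integralClosure R C)).surjective g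
  refine ⟨σ, comap_smul_eq_of_centre h hP h' σ fun s => ?_⟩
  have e : σ (s : C) = (galRestrict R k C (integralClosure R C) σ s : C) :=
    (algebraMap_galRestrict_apply R σ s).symm
  rw [e]
  have h1 := mem_centre (h := hh) (s := s)
  have h2 := mem_centre (h := hh')
    (s := galRestrict R k C (integralClosure R C) σ s)
  refine h1.symm.trans (Iff.trans ?_ h2)
  rw [hg]
  exact (Ideal.smul_mem_pointwise_smul_iff (a := galRestrict R k C (integralClosure R C) σ)).symm

include k in
theorem exists_frobenius {P : ValuationSubring C}
    (h : ∀ r : R, algebraMap R C r ∈ P) (hP : P ≠ ⊤) [Finite (R ⧸ centre R P h)] :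
    ∃ σ : C ≃ₐ[k] C, ∀ x ∈ P, P.valuation (σ x - x ^ Nat.card (R ⧸ centre R P h)) < 1 := by
  have := isDedekindDomain_integralClosure R k C
  have := isFractionRing_integralClosure R k C
  have := Algebra.isInvariant_of_isGalois' R k C (integralClosure R C)
  have : Finite (integralClosure R C ≃ₐ[R] integralClosure R C) :=
    Finite.of_equiv _ (galRestrict R k C (integralClosure R C)).toEquiv
  have hh : ∀ s : integralClosure R C, algebraMap (integralClosure R C) C s ∈ P :=
    fun s => mem_of_isIntegral h s.2
  have : Finite (integralClosure R C ⧸ centre (integralClosure R C) P hh) := by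
    have := (finite_and_natCard_residueField (k := k) h hP).1
    obtain ⟨e⟩ := natCard_residueField_eq (S := integralClosure R C) hh hP
    exact Finite.of_equiv _ e.symm
  obtain ⟨g, hg⟩ := IsArithFrobAt.exists_of_isInvariant R
    (integralClosure R C ≃ₐ[R] integralClosure R C)
    (centre (integralClosure R C) P hh)
  obtain ⟨σ, rfl⟩ := (galRestrict R k C (integralClosure R C)).surjective g
  have e : ∀ s : integralClosure R C,
      σ (s : C) = (galRestrict R k C (integralClosure R C) σ s : C) := fun s =>
    (algebraMap_galRestrict_apply R σ s).symm
  have hfr : ∀ s : integralClosure R C,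
      P.valuation (σ s - (s : C) ^ Nat.card (R ⧸ centre R P h)) < 1 := by
    intro s
    have h1 := hg s
    have h2 : (centre (integralClosure R C) P hh).under R = centre R P h := centre_under h
    rw [h2, mem_centre] at h1
    rw [e]
    simpa using h1
  set q := Nat.card (R ⧸ centre R P h) with hq
  have hq0 : q ≠ 0 := Nat.card_ne_zero.2 ⟨inferInstance, inferInstance⟩
  have hst := comap_smul_eq_of_centre h hP h σ fun s => by
    have h1 := hfr s
    constructor
    · intro hs
      have : P.valuation ((s : C) ^ q) < 1 := by
        rw [map_pow]; exact pow_lt_one' hs hq0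
      simpa using Valuation.map_add_lt _ h1 this
    · intro hs
      have := Valuation.map_sub_lt _ hs h1
      rw [sub_sub_cancel, map_pow] at this
      contrapose! this
      exact one_le_pow₀ this
  refine ⟨σ, fun x hx => ?_⟩
  obtain ⟨s, hs⟩ := residue_centre_surjective hh hP hx
  have hsub : σ x - x ^ q = σ (x - s) + (σ s - (s : C) ^ q) - (x ^ q - (s : C) ^ q) := by
    rw [map_sub]; ring
  have hσs : P.valuation (σ (x - s)) < 1 := by
    by_cases h0 : x - (s : C) = 0
    · simp [h0]
    rw [valuation_lt_one_iff_inv_notMem _ ((map_ne_zero σ).2 h0), ← map_inv₀, ← hst,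
      ← valuation_lt_one_iff_inv_notMem _ h0]
    exact hs
  have hpow : P.valuation (x ^ q - (s : C) ^ q) < 1 := by
    obtain ⟨y, hy⟩ := sub_dvd_pow_sub_pow (⟨x, hx⟩ : P) ⟨s, hh s⟩ q
    have hy' := congrArg (fun z : P => (z : C)) hy
    change x ^ q - (s : C) ^ q = (x - s) * y at hy'
    rw [hy', map_mul]
    exact mul_lt_one_of_lt_of_le hs (P.valuation_le_one y)
  rw [hsub]
  exact Valuation.map_sub_lt _ (Valuation.map_add_lt _ hσs (hfr s)) hpow

end Galois

end CFF

namespace CFF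

open Polynomial

/-- The two affine coordinates `T` and `T⁻¹` on the projective line. -/
def coord (b : Bool) : k2 := if b then RatFunc.X else RatFunc.X⁻¹

/-- The polynomial ring `𝔽₂[T]` or `𝔽₂[T⁻¹]`, acting on `k2` through `coord b`. -/
def CoordRing (_ : Bool) : Type := (ZMod 2)[X]

namespace CoordRing

variable (b : Bool)

instance : CommRing (CoordRing b) := inferInstanceAs (CommRing (ZMod 2)[X])

instance : IsDomain (CoordRing b) := inferInstanceAs (IsDomain (ZMod 2)[X])

instance : IsPrincipalIdealRing (CoordRing b) :=
  inferInstanceAs (IsPrincipalIdealRing (ZMod 2)[X])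

instance : Algebra (CoordRing b) k2 := (aeval (R := ZMod 2) (coord b)).toRingHom.toAlgebra

end CoordRing

theorem coord_ne_zero (b : Bool) : coord b ≠ 0 := by
  cases b <;> simp [coord, RatFunc.X_ne_zero]

theorem transcendental_coord (b : Bool) : Transcendental (ZMod 2) (coord b) := by
  cases b
  · intro h
    exact RatFunc.transcendental_X (K := ZMod 2) (by simpa [coord] using h.inv)
  · exact RatFunc.transcendental_X

theorem aeval_coord_injective (b : Bool) :
    Function.Injective (aeval (R := ZMod 2) (coord b)) :=
  transcendental_iff_injective.1 (transcendental_coord b)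

theorem aeval_X_eq (g : (ZMod 2)[X]) :
    aeval (RatFunc.X : k2) g = algebraMap (ZMod 2)[X] k2 g := by
  conv_rhs => rw [← Polynomial.aeval_X_left_apply g]
  rw [← RatFunc.algebraMap_X, Polynomial.aeval_algebraMap_apply]

instance (b : Bool) : IsFractionRing (CoordRing b) k2 := by
  have : FaithfulSMul (CoordRing b) k2 :=
    (faithfulSMul_iff_algebraMap_injective _ _).2 (aeval_coord_injective b)
  have hT : ∀ z : k2, ∃ p q : (ZMod 2)[X],
      z = aeval (RatFunc.X : k2) p / aeval (RatFunc.X : k2) q := by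
    intro z
    refine ⟨z.num, z.denom, ?_⟩
    rw [aeval_X_eq, aeval_X_eq, RatFunc.num_div_denom]
  refine IsFractionRing.of_field _ _ fun z => ?_
  obtain ⟨p, q, rfl⟩ := hT z
  cases b
  · have key : ∀ p : (ZMod 2)[X], aeval (RatFunc.X : k2) p =
        aeval (RatFunc.X⁻¹ : k2) p.reverse / (RatFunc.X⁻¹ : k2) ^ p.natDegree := by
      intro p
      have : Invertible (RatFunc.X : k2) := invertibleOfNonzero RatFunc.X_ne_zero
      have h := eval₂_reverse_mul_pow (algebraMap (ZMod 2) k2) RatFunc.X p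
      rw [invOf_eq_inv] at h
      rw [inv_pow, div_inv_eq_mul]
      exact h.symm
    refine ⟨(p.reverse * X ^ q.natDegree : (ZMod 2)[X]),
      (q.reverse * X ^ p.natDegree : (ZMod 2)[X]), ?_⟩
    have hX : (RatFunc.X⁻¹ : k2) ≠ 0 := inv_ne_zero RatFunc.X_ne_zero
    change _ = aeval (RatFunc.X⁻¹ : k2) (p.reverse * X ^ q.natDegree) /
      aeval (RatFunc.X⁻¹ : k2) (q.reverse * X ^ p.natDegree)
    rw [key p, key q, map_mul, map_mul,
      map_pow, map_pow, aeval_X, div_div_div_eq]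
    congr 1
    ring
  · exact ⟨p, q, rfl⟩

section Places

variable {K : Type*} [Field K] [Algebra k2 K]

/-- The value of a polynomial at one of the two coordinates, in an extension of `k2`. -/
def evc (K : Type*) [Field K] [Algebra k2 K] (b : Bool) : (ZMod 2)[X] →+* K :=
  (algebraMap k2 K).comp (aeval (R := ZMod 2) (coord b)).toRingHom

theorem evc_apply (b : Bool) (g : (ZMod 2)[X]) :
    evc K b g = algebraMap k2 K (aeval (coord b) g) := rfl

theorem evc_X (b : Bool) : evc K b X = algebraMap k2 K (coord b) := by simp [evc_apply]

theorem evc_injective (b : Bool) : Function.Injective (evc K b) :=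
  (algebraMap k2 K).injective.comp (aeval_coord_injective b)

instance (b : Bool) : Algebra (CoordRing b) K :=
  ((algebraMap k2 K).comp (algebraMap (CoordRing b) k2)).toAlgebra

instance (b : Bool) : IsScalarTower (CoordRing b) k2 K :=
  IsScalarTower.of_algebraMap_eq fun _ => rfl

theorem exists_coord_mem (P : ValuationSubring K) : ∃ b, algebraMap k2 K (coord b) ∈ P := by
  rcases P.mem_or_inv_mem (algebraMap k2 K RatFunc.X) with h | h
  · exact ⟨true, h⟩
  · exact ⟨false, by simpa [coord] using h⟩

theorem evc_mem {P : ValuationSubring K} {b : Bool} (h : algebraMap k2 K (coord b) ∈ P)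
    (g : (ZMod 2)[X]) : evc K b g ∈ P := by
  induction g using Polynomial.induction_on with
  | C a =>
    rcases (show ∀ a : ZMod 2, a = 0 ∨ a = 1 by decide) a with rfl | rfl
    · simp
    · simp
  | add p q hp hq => rw [map_add]; exact P.add_mem _ _ hp hq
  | monomial n a ih =>
    rw [pow_succ, ← mul_assoc, map_mul, evc_X]
    exact P.mul_mem _ _ ih h

theorem algebraMap_coordRing_mem {P : ValuationSubring K} {b : Bool}
    (h : algebraMap k2 K (coord b) ∈ P) (g : CoordRing b) :
    algebraMap (CoordRing b) K g ∈ P := evc_mem h g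

omit [Algebra k2 K] in
theorem isPlace_of_ne_top [Algebra (ZMod 2) K] {P : ValuationSubring K} (h : P ≠ ⊤) :
    IsPlace (ZMod 2) K P := by
  refine ⟨h, fun c => ?_⟩
  rcases (show ∀ a : ZMod 2, a = 0 ∨ a = 1 by decide) c with rfl | rfl
  · simp
  · simp

end Places

end CFF

namespace CFF

open Polynomial

section Places

variable {K : Type*} [Field K] [Algebra k2 K] [FiniteDimensional k2 K]
  [Algebra.IsSeparable k2 K] [Algebra (ZMod 2) K]

instance isDiscreteValuationRing_place (p : Place (ZMod 2) K) : IsDiscreteValuationRing p.1 := by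
  obtain ⟨b, hb⟩ := exists_coord_mem p.1
  exact isDiscreteValuationRing_of_finite (R := CoordRing b) (k := k2)
    (algebraMap_coordRing_mem hb) p.2.1

theorem finite_and_natCard_quotient {g : (ZMod 2)[X]} (hg : g ≠ 0) :
    Finite ((ZMod 2)[X] ⧸ Ideal.span {g}) ∧
      Nat.card ((ZMod 2)[X] ⧸ Ideal.span {g}) = 2 ^ g.natDegree := by
  have := (AdjoinRoot.powerBasis hg).finite
  have hfin : Module.Finite (ZMod 2) ((ZMod 2)[X] ⧸ Ideal.span {g}) := this
  refine ⟨Module.finite_of_finite (ZMod 2), ?_⟩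
  rw [Module.natCard_eq_pow_finrank (K := ZMod 2), finrank_quotient_span_eq_natDegree,
    Nat.card_zmod]

theorem span_eq_centre {p : ValuationSubring K} {b : Bool} (hb : algebraMap k2 K (coord b) ∈ p)
    {g : CoordRing b} (hg : Prime g) (hv : p.valuation (algebraMap (CoordRing b) K g) < 1) :
    Ideal.span {g} = centre (CoordRing b) p (algebraMap_coordRing_mem hb) := by
  have hmax : (Ideal.span {g}).IsMaximal :=
    Ideal.IsPrime.isMaximal ((Ideal.span_singleton_prime hg.ne_zero).2 hg)
      (by rw [Ne, Ideal.span_singleton_eq_bot]; exact hg.ne_zero)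
  refine hmax.eq_of_le (Ideal.IsPrime.ne_top inferInstance) ?_
  rw [Ideal.span_singleton_le_iff_mem, mem_centre]
  exact hv

theorem exists_irreducible_evc (p : Place (ZMod 2) K) {b : Bool}
    (hb : algebraMap k2 K (coord b) ∈ p.1) :
    ∃ g : (ZMod 2)[X], Irreducible g ∧ p.1.valuation (evc K b g) < 1 := by
  have hne := centre_ne_bot_of_finite (k := k2) (algebraMap_coordRing_mem hb) p.2.1
  have hpr : (centre (CoordRing b) p.1 (algebraMap_coordRing_mem hb)).IsPrime := inferInstance
  obtain ⟨g, hg⟩ := (IsPrincipalIdealRing.principal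
    (centre (CoordRing b) p.1 (algebraMap_coordRing_mem hb))).principal
  have hg' : centre (CoordRing b) p.1 (algebraMap_coordRing_mem hb) = Ideal.span {g} := hg
  have hg0 : g ≠ 0 := by rintro rfl; exact hne (by simpa using hg')
  rw [hg', Ideal.span_singleton_prime hg0] at hpr
  refine ⟨g, hpr.irreducible, ?_⟩
  have hmem : g ∈ centre (CoordRing b) p.1 (algebraMap_coordRing_mem hb) := by
    rw [hg']; exact Ideal.mem_span_singleton_self g
  exact (mem_centre (S := CoordRing b)).1 hmem

theorem finite_residueField_and_placeDegree_eq (p : Place (ZMod 2) K) {b : Bool}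
    (hb : algebraMap k2 K (coord b) ∈ p.1) {g : (ZMod 2)[X]} (hg : Irreducible g)
    (hv : p.1.valuation (evc K b g) < 1) :
    Finite (IsLocalRing.ResidueField p.1) ∧ placeDegree (ZMod 2) p = g.natDegree *
      ((centre (integralClosure (CoordRing b) K) p.1
        (fun s => mem_of_isIntegral (algebraMap_coordRing_mem hb) s.2)).inertiaDeg
          (CoordRing b)) := by
  have hspan := span_eq_centre (g := (g : CoordRing b)) hb hg.prime hv
  have h2 := finite_and_natCard_quotient hg.ne_zero
  have h3 : Finite (CoordRing b ⧸ centre (CoordRing b) p.1 (algebraMap_coordRing_mem hb)) ∧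
      Nat.card (CoordRing b ⧸ centre (CoordRing b) p.1 (algebraMap_coordRing_mem hb)) =
        2 ^ g.natDegree := by
    rw [← hspan]; exact h2
  have := h3.1
  obtain ⟨hf, hc⟩ := finite_and_natCard_residueField (R := CoordRing b) (k := k2)
    (algebraMap_coordRing_mem hb) p.2.1
  refine ⟨hf, ?_⟩
  rw [natCard_residueField p, h3.2, ← pow_mul] at hc
  exact Nat.pow_right_injective le_rfl hc

instance finite_residueField_place (p : Place (ZMod 2) K) :
    Finite (IsLocalRing.ResidueField p.1) := by
  obtain ⟨b, hb⟩ := exists_coord_mem p.1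
  obtain ⟨g, hg, hv⟩ := exists_irreducible_evc p hb
  exact (finite_residueField_and_placeDegree_eq p hb hg hv).1

theorem natDegree_dvd_placeDegree (p : Place (ZMod 2) K) {b : Bool}
    (hb : algebraMap k2 K (coord b) ∈ p.1) {g : (ZMod 2)[X]} (hg : Irreducible g)
    (hv : p.1.valuation (evc K b g) < 1) : g.natDegree ∣ placeDegree (ZMod 2) p :=
  ⟨_, (finite_residueField_and_placeDegree_eq p hb hg hv).2⟩

theorem sum_ordAt_mul_placeDegree_le {b : Bool} {g : (ZMod 2)[X]} (hg : Irreducible g)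
    (s : Finset (Place (ZMod 2) K))
    (hs : ∀ p ∈ s, algebraMap k2 K (coord b) ∈ p.1 ∧ p.1.valuation (evc K b g) < 1) :
    ∑ p ∈ s, ordAt p.1 (evc K b g) * (placeDegree (ZMod 2) p : ℤ) ≤
      Module.finrank k2 K * g.natDegree := by
  rw [← Finset.sum_coe_sort]
  have key := sum_ordAt_mul_le (R := CoordRing b) (k := k2) (K := K) (π := (g : CoordRing b))
    Finset.univ
    (fun i : s => i.1.1) (fun i _ j _ e => Subtype.ext (Subtype.ext e))
    (fun i => algebraMap_coordRing_mem (hs i.1 i.2).1) (fun i => i.1.2.1) hg.prime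
    (fun i => (hs i.1 i.2).2)
  calc _ = (∑ i : s, ordAt i.1.1 (algebraMap (CoordRing b) K g) *
      ((centre (integralClosure (CoordRing b) K) i.1.1 (fun t => mem_of_isIntegral
        (algebraMap_coordRing_mem (hs i.1 i.2).1) t.2)).inertiaDeg (CoordRing b) : ℤ)) *
          g.natDegree := by
        rw [Finset.sum_mul]
        refine Finset.sum_congr rfl fun i _ => ?_
        rw [(finite_residueField_and_placeDegree_eq i.1 (hs i.1 i.2).1 hg (hs i.1 i.2).2).2]
        push_cast
        change _ = ordAt i.1.1 (evc K b g) * _ * _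
        ring
    _ ≤ _ := mul_le_mul_of_nonneg_right key (by positivity)

theorem finite_setOf_valuation_lt_one {f : K} (hf : f ≠ 0) (b : Bool) :
    {p : Place (ZMod 2) K | algebraMap k2 K (coord b) ∈ p.1 ∧ p.1.valuation f < 1}.Finite := by
  have := isDedekindDomain_integralClosure (CoordRing b) k2 K
  have := isFractionRing_integralClosure (CoordRing b) k2 K
  obtain ⟨x, y, hy, hxy⟩ := IsFractionRing.div_surjective (A := integralClosure (CoordRing b) K) f
  have hx0 : x ≠ 0 := by
    rintro rfl
    exact hf (by rw [← hxy]; simp)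
  have hfin := Ideal.finite_factors (I := Ideal.span {x})
    (by rw [Ne, Submodule.zero_eq_bot, Ideal.span_singleton_eq_bot]; exact hx0)
  have hall : ∀ p : Place (ZMod 2) K, algebraMap k2 K (coord b) ∈ p.1 →
      ∀ s : integralClosure (CoordRing b) K,
        algebraMap (integralClosure (CoordRing b) K) K s ∈ p.1 := fun p hp s =>
    mem_of_isIntegral (algebraMap_coordRing_mem hp) s.2
  refine Set.Finite.of_injOn (f := fun p => if h : algebraMap k2 K (coord b) ∈ p.1 then
    some (centreSpectrum _ p.1 (hall p h) p.2.1) else none) (t := some '' {v :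
      IsDedekindDomain.HeightOneSpectrum (integralClosure (CoordRing b) K) |
        v.asIdeal ∣ Ideal.span {x}}) ?_ ?_ (hfin.image _)
  · rintro p ⟨hp, hpf⟩
    refine ⟨centreSpectrum _ p.1 (hall p hp) p.2.1, ?_, by simp only [dif_pos hp]⟩
    refine Ideal.dvd_span_singleton.2 ((mem_centre (h := hall p hp)).2 ?_)
    have h2 : p.1.valuation (algebraMap _ K y) ≤ 1 :=
      (ValuationSubring.valuation_le_one_iff _ _).2 (hall p hp y)
    have hy0 : algebraMap (integralClosure (CoordRing b) K) K y ≠ 0 := by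
      simpa using nonZeroDivisors.ne_zero hy
    have hxy' : algebraMap (integralClosure (CoordRing b) K) K x =
        f * algebraMap (integralClosure (CoordRing b) K) K y := by
      rw [← hxy, div_mul_cancel₀ _ hy0]
    rw [hxy', map_mul]
    exact mul_lt_one_of_lt_of_le hpf h2
  · rintro p ⟨hp, -⟩ q ⟨hq, -⟩ e
    simp only [dif_pos hp, dif_pos hq, Option.some.injEq] at e
    exact Subtype.ext (centre_injective (hall p hp) p.2.1 (hall q hq) q.2.1
      (congrArg IsDedekindDomain.HeightOneSpectrum.asIdeal e))

/-- A nonzero function has a nonzero order at only finitely many places. -/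
theorem finite_setOf_ordAt_ne_zero {f : K} (hf : f ≠ 0) :
    {p : Place (ZMod 2) K | ordAt p.1 f ≠ 0}.Finite := by
  refine (((finite_setOf_valuation_lt_one hf true).union
    (finite_setOf_valuation_lt_one hf false)).union
    ((finite_setOf_valuation_lt_one (inv_ne_zero hf) true).union
    (finite_setOf_valuation_lt_one (inv_ne_zero hf) false))).subset fun p hp => ?_
  obtain ⟨b, hb⟩ := exists_coord_mem p.1
  have : p.1.valuation f < 1 ∨ p.1.valuation f⁻¹ < 1 := by
    rw [valuation_lt_one_iff_ordAt hf, valuation_lt_one_iff_ordAt (inv_ne_zero hf), ordAt_inv]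
    have := lt_or_gt_of_ne (show ordAt p.1 f ≠ 0 from hp)
    omega
  cases b <;> rcases this with h | h
  · exact Or.inl (Or.inr ⟨hb, h⟩)
  · exact Or.inr (Or.inr ⟨hb, h⟩)
  · exact Or.inl (Or.inl ⟨hb, h⟩)
  · exact Or.inr (Or.inl ⟨hb, h⟩)

/-- The principal divisor of a nonzero function. -/
def divOf (f : K) (hf : f ≠ 0) : Divisor (ZMod 2) K :=
  Finsupp.onFinset (finite_setOf_ordAt_ne_zero hf).toFinset (fun p => ordAt p.1 f)
    fun p hp => by simpa using hp

@[simp]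
theorem divOf_apply (f : K) (hf : f ≠ 0) (p : Place (ZMod 2) K) :
    divOf f hf p = ordAt p.1 f := rfl

theorem isIntegral_of_forall_place {f : K} (h : ∀ p : Place (ZMod 2) K, f ∈ p.1) :
    IsIntegral (ZMod 2) f := by
  have hmem : f ∈ (⨅ V : {V : ValuationSubring K // (∅ : Set K) ⊆ V.toSubring},
      V.1.toSubring) := by
    rw [Subring.mem_iInf]
    intro V
    by_cases hV : V.1 = ⊤
    · rw [hV]; exact ValuationSubring.mem_top _
    · exact h ⟨V.1, isPlace_of_ne_top hV⟩
  rw [iInf_valuationSubring_superset] at hmem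
  have h_int : IsIntegral (Subring.closure (∅ : Set K)) f := hmem
  obtain ⟨q, hq, hq0⟩ := h_int
  have hle : Subring.closure (∅ : Set K) ≤ (algebraMap (ZMod 2) K).range := by
    rw [Subring.closure_empty]; exact bot_le
  have hl : q.map (Subring.closure (∅ : Set K)).subtype ∈ lifts (algebraMap (ZMod 2) K) := by
    rw [lifts_iff_coeff_lifts]
    intro n
    rw [coeff_map]
    exact hle (q.coeff n).2
  obtain ⟨q', hq', -, hq'm⟩ := lifts_and_natDegree_eq_and_monic hl (hq.map _)
  refine ⟨q', hq'm, ?_⟩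
  rw [← eval_map, hq', eval_map]
  exact hq0

end Places

end CFF

namespace CFF

open Polynomial

section RiemannRoch

variable {K : Type*} [Field K] [Algebra k2 K] [FiniteDimensional k2 K]
  [Algebra.IsSeparable k2 K] [Algebra (ZMod 2) K]

theorem ordAt_of_isIntegral {a : K} (ha : IsIntegral (ZMod 2) a) (p : Place (ZMod 2) K) :
    ordAt p.1 a = 0 := by
  by_cases h0 : a = 0
  · rw [h0, ordAt_zero]
  have h1 := mem_iff_ordAt_nonneg.1 (mem_of_isIntegral p.2.2 ha)
  have h2 := mem_iff_ordAt_nonneg.1 (mem_of_isIntegral p.2.2 (ha.inv))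
  rw [ordAt_inv] at h2
  omega

theorem exists_valuation_lt_one {f : K} (hf : ¬ IsIntegral (ZMod 2) f) :
    ∃ p : Place (ZMod 2) K, p.1.valuation f < 1 := by
  by_contra! h
  refine hf ?_
  have h0 : f ≠ 0 := by rintro rfl; exact hf isIntegral_zero
  have := isIntegral_of_forall_place (f := f⁻¹) fun p => by
    rw [← ValuationSubring.valuation_le_one_iff, map_inv₀]
    exact inv_le_one_of_one_le₀ (h p)
  simpa using this.inv

theorem mem_RRspace {D : Divisor (ZMod 2) K} {f : K} :
    f ∈ RRspace (ZMod 2) D ↔ (f ≠ 0 → ∀ p, 0 ≤ D p + ordAt p.1 f) := by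
  constructor
  · intro h
    induction h using Submodule.span_induction with
    | mem x hx => exact fun _ => hx
    | zero => exact fun h => (h rfl).elim
    | add x y _ _ hx hy =>
      intro hxy p
      by_cases hx0 : x = 0
      · subst hx0; rw [zero_add] at hxy ⊢; exact hy hxy p
      by_cases hy0 : y = 0
      · subst hy0; rw [add_zero] at hxy ⊢; exact hx hxy p
      have := min_ordAt_le_ordAt_add (O := p.1) hx0 hy0 hxy
      have h1 := hx hx0 p
      have h2 := hy hy0 p
      omega
    | smul a x _ hx =>
      rcases (show ∀ a : ZMod 2, a = 0 ∨ a = 1 by decide) a with rfl | rfl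
      · simp
      · simpa using hx
  · intro h
    by_cases hf : f = 0
    · rw [hf]; exact zero_mem _
    · exact Submodule.subset_span (h hf)

theorem mem_RRspace_of_ne {D : Divisor (ZMod 2) K} {f : K} (hf : f ≠ 0) :
    f ∈ RRspace (ZMod 2) D ↔ ∀ p, 0 ≤ D p + ordAt p.1 f := by
  rw [mem_RRspace]; exact ⟨fun h => h hf, fun h _ => h⟩

theorem mem_RRspace_zero {f : K} : f ∈ RRspace (ZMod 2) (0 : Divisor (ZMod 2) K) ↔
    IsIntegral (ZMod 2) f := by
  constructor
  · intro h
    by_cases hf : f = 0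
    · rw [hf]; exact isIntegral_zero
    refine isIntegral_of_forall_place fun p => mem_iff_ordAt_nonneg.2 ?_
    simpa using (mem_RRspace_of_ne hf).1 h p
  · intro h
    rw [mem_RRspace]
    intro _ p
    simp [ordAt_of_isIntegral h p]

theorem RRspace_mono {D E : Divisor (ZMod 2) K} (h : D ≤ E) :
    RRspace (ZMod 2) D ≤ RRspace (ZMod 2) E := by
  intro f hf
  rw [mem_RRspace] at hf ⊢
  intro h0 p
  have h1 := hf h0 p
  have h2 := h p
  omega

theorem degHom_single (p : Place (ZMod 2) K) (n : ℤ) :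
    degHom (ZMod 2) K (Finsupp.single p n) = n * placeDegree (ZMod 2) p := by
  simp [degHom]

theorem degHom_apply (D : Divisor (ZMod 2) K) :
    degHom (ZMod 2) K D = D.sum fun p n => n * (placeDegree (ZMod 2) p : ℤ) := by
  simp [degHom]

theorem degHom_nonneg {D : Divisor (ZMod 2) K} (h : 0 ≤ D) : 0 ≤ degHom (ZMod 2) K D := by
  rw [degHom_apply]
  exact Finset.sum_nonneg fun p _ => mul_nonneg (h p) (by positivity)

theorem degHom_mono {D E : Divisor (ZMod 2) K} (h : D ≤ E) :
    degHom (ZMod 2) K D ≤ degHom (ZMod 2) K E := by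
  have := degHom_nonneg (sub_nonneg.2 h)
  rw [map_sub] at this
  omega

theorem finite_and_finrank_le {V W : Type*} [AddCommGroup V] [Module (ZMod 2) V] [AddCommGroup W]
    [Module (ZMod 2) W] [Module.Finite (ZMod 2) W] (φ : V →ₗ[ZMod 2] W)
    [Module.Finite (ZMod 2) (LinearMap.ker φ)] : Module.Finite (ZMod 2) V ∧
      Module.finrank (ZMod 2) V ≤
        Module.finrank (ZMod 2) (LinearMap.ker φ) + Module.finrank (ZMod 2) W := by
  have h1 : Module.Finite (ZMod 2) (V ⧸ LinearMap.ker φ) :=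
    Module.Finite.equiv φ.quotKerEquivRange.symm
  have h2 : Module.Finite (ZMod 2) V := .of_submodule_quotient (LinearMap.ker φ)
  refine ⟨h2, ?_⟩
  rw [← φ.finrank_range_add_finrank_ker, add_comm]
  exact Nat.add_le_add_left (Submodule.finrank_le _) _

/-- The leading coefficient map at a place `p`. -/
theorem finite_and_ell_add_single_le (D : Divisor (ZMod 2) K) (p : Place (ZMod 2) K)
    [Module.Finite (ZMod 2) (RRspace (ZMod 2) D)] :
    Module.Finite (ZMod 2) (RRspace (ZMod 2) (D + Finsupp.single p 1)) ∧
      ell (ZMod 2) (D + Finsupp.single p 1) ≤ ell (ZMod 2) D + placeDegree (ZMod 2) p := by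
  let := (residueHom (ZMod 2) p).toAlgebra
  have : Module.Finite (ZMod 2) (IsLocalRing.ResidueField p.1) := Module.Finite.of_finite
  obtain ⟨t, ht0, ht⟩ := exists_ordAt_eq_one p.1
  have hord : ∀ f : K, f ≠ 0 → ordAt p.1 (f * t ^ (D p + 1)) = ordAt p.1 f + (D p + 1) := by
    intro f hf
    have hz : ∀ n : ℤ, ordAt p.1 (t ^ n) = n := by
      intro n
      obtain ⟨m, rfl | rfl⟩ := n.eq_nat_or_neg
      · rw [zpow_natCast, ordAt_pow ht0, ht, mul_one]
      · rw [zpow_neg, ordAt_inv, zpow_natCast, ordAt_pow ht0, ht, mul_one]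
    rw [ordAt_mul hf (zpow_ne_zero _ ht0), hz]
  have hmem : ∀ f : RRspace (ZMod 2) (D + Finsupp.single p 1), (f : K) * t ^ (D p + 1) ∈ p.1 := by
    intro f
    by_cases hf : (f : K) = 0
    · rw [hf, zero_mul]; exact p.1.zero_mem
    rw [mem_iff_ordAt_nonneg, hord _ hf]
    have := (mem_RRspace_of_ne hf).1 f.2 p
    simp only [Finsupp.add_apply, Finsupp.single_eq_same] at this
    omega
  let φ₀ : RRspace (ZMod 2) (D + Finsupp.single p 1) →+ p.1 :=
    { toFun := fun f => ⟨(f : K) * t ^ (D p + 1), hmem f⟩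
      map_zero' := by ext; simp
      map_add' := fun f g => by ext; simp [add_mul] }
  let φ := (((IsLocalRing.residue p.1).toAddMonoidHom.comp φ₀).toZModLinearMap 2)
  have hker : LinearMap.ker φ ≤ (RRspace (ZMod 2) D).comap
      (RRspace (ZMod 2) (D + Finsupp.single p 1)).subtype := by
    intro f hf
    change IsLocalRing.residue p.1 (φ₀ f) = 0 at hf
    rw [residue_eq_zero_iff'] at hf
    rw [Submodule.mem_comap, mem_RRspace]
    intro hf0 q
    have h1 := (mem_RRspace_of_ne hf0).1 f.2 q
    by_cases hq : q = p
    · subst hq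
      change q.1.valuation ((f : K) * t ^ (D q + 1)) < 1 at hf
      have h0 : (f : K) ≠ 0 := hf0
      rw [valuation_lt_one_iff_ordAt (mul_ne_zero h0 (zpow_ne_zero _ ht0)), hord _ h0] at hf
      change 0 ≤ D q + ordAt q.1 (f : K)
      omega
    · rwa [Finsupp.add_apply, Finsupp.single_eq_of_ne hq, add_zero] at h1
  let ι : LinearMap.ker φ →ₗ[ZMod 2] RRspace (ZMod 2) D :=
    ((RRspace (ZMod 2) (D + Finsupp.single p 1)).subtype.comp
      (LinearMap.ker φ).subtype).codRestrict _ fun f => hker f.2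
  have hι : Function.Injective ι := by
    intro f g h
    have : ((f : RRspace (ZMod 2) (D + Finsupp.single p 1)) : K) = g :=
      congrArg (fun z : RRspace (ZMod 2) D => (z : K)) h
    exact Subtype.ext (Subtype.ext this)
  have : Module.Finite (ZMod 2) (LinearMap.ker φ) := Module.Finite.of_injective ι hι
  obtain ⟨h1, h2⟩ := finite_and_finrank_le φ
  exact ⟨h1, h2.trans (Nat.add_le_add_right (LinearMap.finrank_le_finrank_of_injective hι) _)⟩

theorem finite_RRspace_zero :
    Module.Finite (ZMod 2) (RRspace (ZMod 2) (0 : Divisor (ZMod 2) K)) := by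
  have hT : ¬ IsIntegral (ZMod 2) (algebraMap k2 K (coord true)) := by
    intro h
    have h' := h.isAlgebraic
    have : IsScalarTower (ZMod 2) k2 K := IsScalarTower.of_algebraMap_eq' (Subsingleton.elim _ _)
    exact transcendental_coord true ((isAlgebraic_algebraMap_iff (algebraMap k2 K).injective).1 h')
  obtain ⟨p, -⟩ := exists_valuation_lt_one hT
  let φ : RRspace (ZMod 2) (0 : Divisor (ZMod 2) K) → IsLocalRing.ResidueField p.1 := fun f =>
    IsLocalRing.residue p.1 ⟨f, mem_of_isIntegral p.2.2 (mem_RRspace_zero.1 f.2)⟩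
  have hφ : Function.Injective φ := by
    intro f g h
    have h' := (residue_eq_iff _ _).1 h
    by_contra hne
    have h0 : (f : K) - g ≠ 0 := sub_ne_zero.2 fun e => hne (Subtype.ext e)
    have h1 := (valuation_lt_one_iff_ordAt h0).1 h'
    rw [ordAt_of_isIntegral
      ((mem_RRspace_zero.1 f.2).sub (mem_RRspace_zero.1 g.2)) p] at h1
    exact lt_irrefl _ h1
  have := Finite.of_injective φ hφ
  exact Module.Finite.of_finite

theorem ell_add_natDivisor (E : Place (ZMod 2) K →₀ ℕ) (D : Divisor (ZMod 2) K)
    (hD : Module.Finite (ZMod 2) (RRspace (ZMod 2) D)) :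
    Module.Finite (ZMod 2)
        (RRspace (ZMod 2) (D + E.mapRange (Nat.cast : ℕ → ℤ) Nat.cast_zero)) ∧
      (ell (ZMod 2) (D + E.mapRange (Nat.cast : ℕ → ℤ) Nat.cast_zero) : ℤ) ≤
        ell (ZMod 2) D + degHom (ZMod 2) K (E.mapRange (Nat.cast : ℕ → ℤ) Nat.cast_zero) := by
  induction E using Finsupp.induction_linear generalizing D with
  | zero =>
    have e : (0 : Place (ZMod 2) K →₀ ℕ).mapRange (Nat.cast : ℕ → ℤ) Nat.cast_zero = 0 :=
      Finsupp.mapRange_zero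
    rw [e, add_zero]
    exact ⟨hD, by simp⟩
  | add E E' h h' =>
    obtain ⟨h1, h2⟩ := h D hD
    obtain ⟨h3, h4⟩ := h' _ h1
    have e : (E + E').mapRange (Nat.cast : ℕ → ℤ) Nat.cast_zero =
        E.mapRange (Nat.cast : ℕ → ℤ) Nat.cast_zero +
        E'.mapRange (Nat.cast : ℕ → ℤ) Nat.cast_zero :=
      Finsupp.mapRange_add (fun _ _ => Nat.cast_add _ _) _ _
    rw [e, ← add_assoc, map_add]
    exact ⟨h3, by omega⟩
  | single p n =>
    rw [Finsupp.mapRange_single]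
    induction n with
    | zero =>
      rw [Nat.cast_zero, Finsupp.single_zero, add_zero]
      exact ⟨hD, by simp⟩
    | succ n ih =>
      obtain ⟨h1, h2⟩ := ih
      obtain ⟨h3, h4⟩ := finite_and_ell_add_single_le (D + Finsupp.single p (n : ℤ)) p
      have e : D + Finsupp.single p ((n + 1 : ℕ) : ℤ) =
          D + Finsupp.single p (n : ℤ) + Finsupp.single p 1 := by
        rw [add_assoc, ← Finsupp.single_add]; push_cast; rfl
      rw [e]
      refine ⟨h3, ?_⟩
      rw [degHom_single] at h2 ⊢
      push_cast
      have h4' : (ell (ZMod 2) (D + Finsupp.single p (n : ℤ) + Finsupp.single p 1) : ℤ) ≤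
        ell (ZMod 2) (D + Finsupp.single p (n : ℤ)) + placeDegree (ZMod 2) p := by
          exact_mod_cast h4
      linarith

theorem exists_natDivisor {D : Divisor (ZMod 2) K} (h : 0 ≤ D) : ∃ E : Place (ZMod 2) K →₀ ℕ,
    D = E.mapRange (Nat.cast : ℕ → ℤ) Nat.cast_zero := by
  refine ⟨D.mapRange Int.toNat rfl, ?_⟩
  ext p
  simpa using (h p)

instance finite_RRspace (D : Divisor (ZMod 2) K) : Module.Finite (ZMod 2) (RRspace (ZMod 2) D) := by
  have h0 : (0 : Divisor (ZMod 2) K) ≤ D ⊔ 0 := le_sup_right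
  obtain ⟨E, hE⟩ := exists_natDivisor h0
  have := (ell_add_natDivisor E 0 finite_RRspace_zero).1
  rw [zero_add, ← hE] at this
  exact Module.Finite.of_injective (Submodule.inclusion (RRspace_mono (le_sup_left : D ≤ D ⊔ 0)))
    (Submodule.inclusion_injective _)

theorem ell_add_degHom_le {D E : Divisor (ZMod 2) K} (h : D ≤ E) :
    ell (ZMod 2) E + degHom (ZMod 2) K D ≤ ell (ZMod 2) D + degHom (ZMod 2) K E := by
  obtain ⟨N, hN⟩ := exists_natDivisor (sub_nonneg.2 h)
  have := (ell_add_natDivisor N D inferInstance).2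
  rw [← hN, add_sub_cancel, map_sub] at this
  omega

/-- Multiplication by `f` maps `L(D)` into `L(E)` if `D + div f⁻¹ ≤ E`. -/
theorem ell_le_of_mul {D E : Divisor (ZMod 2) K} {f : K} (hf : f ≠ 0)
    (h : ∀ p, D p ≤ E p + ordAt p.1 f) : ell (ZMod 2) D ≤ ell (ZMod 2) E := by
  let m : RRspace (ZMod 2) D →ₗ[ZMod 2] RRspace (ZMod 2) E :=
    ((LinearMap.mulLeft (ZMod 2) f).comp (RRspace (ZMod 2) D).subtype).codRestrict _ fun g => by
      rw [mem_RRspace]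
      intro h0 p
      have hg : (g : K) ≠ 0 := right_ne_zero_of_mul h0
      have h1 := (mem_RRspace_of_ne hg).1 g.2 p
      change 0 ≤ E p + ordAt p.1 (f * (g : K))
      rw [ordAt_mul hf hg]
      have := h p
      omega
  refine LinearMap.finrank_le_finrank_of_injective (f := m) fun g g' e => ?_
  have e' : f * (g : K) = f * g' := congrArg Subtype.val e
  exact Subtype.ext (mul_left_cancel₀ hf e')

theorem ell_add_divOf (D : Divisor (ZMod 2) K) {f : K} (hf : f ≠ 0) :
    ell (ZMod 2) (D + divOf f hf) = ell (ZMod 2) D := by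
  refine le_antisymm (ell_le_of_mul hf fun p => by simp)
    (ell_le_of_mul (inv_ne_zero hf) fun p => ?_)
  simp [ordAt_inv]

theorem exists_ne_zero_of_ell_pos {D : Divisor (ZMod 2) K} (h : 0 < ell (ZMod 2) D) :
    ∃ f : K, f ≠ 0 ∧ f ∈ RRspace (ZMod 2) D := by
  obtain ⟨⟨f, hf⟩, hne⟩ := (Module.finrank_pos_iff_exists_ne_zero).1 h
  exact ⟨f, fun h0 => hne (Subtype.ext h0), hf⟩

theorem ell_pos {D : Divisor (ZMod 2) K} {f : K} (hf : f ≠ 0) (h : f ∈ RRspace (ZMod 2) D) :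
    0 < ell (ZMod 2) D :=
  Module.finrank_pos_iff_exists_ne_zero.2 ⟨⟨f, h⟩, fun h0 => hf (congrArg Subtype.val h0)⟩

end RiemannRoch

end CFF

namespace CFF

open Polynomial

section RiemannBound

/-- Riemann's inequality for genus at most four. -/
def RiemannBound (K : Type*) [Field K] [Algebra (ZMod 2) K] : Prop :=
  ∀ D : Divisor (ZMod 2) K, degHom (ZMod 2) K D + 1 - ell (ZMod 2) D ≤ 4

theorem genus_eq_four_iff {K : Type*} [Field K] [Algebra (ZMod 2) K] :
    genus (ZMod 2) K = 4 ↔ RiemannBound K ∧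
      ∃ D : Divisor (ZMod 2) K, degHom (ZMod 2) K D + 1 - ell (ZMod 2) D = 4 := by
  unfold genus
  set S := {g : ℕ | ∃ D : Divisor (ZMod 2) K, (g : ℤ) = degHom (ZMod 2) K D + 1 - ell (ZMod 2) D}
  constructor
  · intro h
    have hne : S.Nonempty := by
      by_contra hS
      rw [Set.not_nonempty_iff_eq_empty.1 hS] at h
      simp at h
    have hb : BddAbove S := by
      by_contra hS
      rw [Nat.sSup_of_not_bddAbove hS] at h
      simp at h
    refine ⟨fun D => ?_, ?_⟩
    · by_contra! hD
      obtain ⟨n, hn⟩ := Int.eq_ofNat_of_zero_le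
        (show 0 ≤ degHom (ZMod 2) K D + 1 - ell (ZMod 2) D by omega)
      have := le_csSup hb (show n ∈ S from ⟨D, hn.symm⟩)
      omega
    · obtain ⟨D, hD⟩ := h ▸ Nat.sSup_mem hne hb
      exact ⟨D, by rw [← hD]; rfl⟩
  · rintro ⟨hR, D, hD⟩
    have hub : ∀ g ∈ S, g ≤ 4 := by
      rintro g ⟨E, hE⟩
      have := hR E
      omega
    have hmem : 4 ∈ S := ⟨D, by rw [hD]; rfl⟩
    exact le_antisymm (csSup_le ⟨4, hmem⟩ hub) (le_csSup ⟨4, hub⟩ hmem)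

variable {K : Type*} [Field K] [Algebra k2 K] [FiniteDimensional k2 K]
  [Algebra.IsSeparable k2 K] [Algebra (ZMod 2) K]

theorem RiemannBound.ell_eq_zero (hR : RiemannBound K) {D : Divisor (ZMod 2) K}
    (hD : degHom (ZMod 2) K D < 0) : ell (ZMod 2) D = 0 := by
  by_contra hne
  obtain ⟨f, hf, hfD⟩ := exists_ne_zero_of_ell_pos (Nat.pos_of_ne_zero hne)
  set n : ℕ := ell (ZMod 2) (0 : Divisor (ZMod 2) K) + 4
  have h1 : ell (ZMod 2) (-(n • D)) ≤ ell (ZMod 2) (0 : Divisor (ZMod 2) K) := by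
    refine ell_le_of_mul (pow_ne_zero n hf) fun p => ?_
    rw [ordAt_pow hf]
    have := (mem_RRspace_of_ne hf).1 hfD p
    have h2 : (-(n • D)) p = -(n * D p) := by simp
    rw [h2, Finsupp.zero_apply]
    nlinarith
  have h2 := hR (-(n • D))
  rw [map_neg, map_nsmul, nsmul_eq_mul] at h2
  have h3 : (n : ℤ) ≤ -((n : ℤ) * degHom (ZMod 2) K D) := by nlinarith
  have h4 : (n : ℤ) = ell (ZMod 2) (0 : Divisor (ZMod 2) K) + 4 := by simp [n]
  omega

theorem one_mem_RRspace_zero : (1 : K) ∈ RRspace (ZMod 2) (0 : Divisor (ZMod 2) K) :=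
  mem_RRspace_zero.2 isIntegral_one

theorem RiemannBound.degHom_divOf (hR : RiemannBound K) {f : K} (hf : f ≠ 0) :
    degHom (ZMod 2) K (divOf f hf) = 0 := by
  have key : ∀ (g : K) (hg : g ≠ 0), 0 ≤ degHom (ZMod 2) K (divOf g hg) := by
    intro g hg
    by_contra! h
    have h1 := hR.ell_eq_zero h
    have h2 := ell_add_divOf 0 hg
    rw [zero_add, h1] at h2
    exact (ell_pos one_ne_zero (one_mem_RRspace_zero (K := K))).ne h2
  have h1 := key f hf
  have h2 := key f⁻¹ (inv_ne_zero hf)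
  have e : divOf f⁻¹ (inv_ne_zero hf) = -divOf f hf := by ext p; simp [ordAt_inv]
  rw [e, map_neg] at h2
  omega

theorem divOf_mul {f g : K} (hf : f ≠ 0) (hg : g ≠ 0) :
    divOf (f * g) (mul_ne_zero hf hg) = divOf f hf + divOf g hg := by
  ext p; simp [ordAt_mul hf hg]

theorem mem_principalDivisors {D : Divisor (ZMod 2) K} :
    D ∈ principalDivisors (ZMod 2) K ↔ ∃ (f : K) (hf : f ≠ 0), D = divOf f hf := by
  constructor
  · intro h
    induction h using AddSubgroup.closure_induction with
    | mem D hD => obtain ⟨f, hf, h⟩ := hD; exact ⟨f, hf, Finsupp.ext h⟩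
    | zero => exact ⟨1, one_ne_zero, by ext p; simp [ordAt_one]⟩
    | add D E _ _ hD hE =>
      obtain ⟨f, hf, rfl⟩ := hD
      obtain ⟨g, hg, rfl⟩ := hE
      exact ⟨f * g, mul_ne_zero hf hg, (divOf_mul hf hg).symm⟩
    | neg D _ hD =>
      obtain ⟨f, hf, rfl⟩ := hD
      exact ⟨f⁻¹, inv_ne_zero hf, by ext p; simp [ordAt_inv]⟩
  · rintro ⟨f, hf, rfl⟩
    exact AddSubgroup.subset_closure ⟨f, hf, fun _ => rfl⟩

theorem classNumber_eq_one_iff : classNumber (ZMod 2) K = 1 ↔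
    ∀ D : Divisor (ZMod 2) K, degHom (ZMod 2) K D = 0 → ∃ (f : K) (hf : f ≠ 0), D = divOf f hf := by
  unfold classNumber ClassGroup0
  rw [Nat.card_eq_one_iff_unique]
  constructor
  · rintro ⟨hs, -⟩ D hD
    rw [← mem_principalDivisors]
    have h : ((⟨D, hD⟩ : zeroDivisors (ZMod 2) K) : zeroDivisors (ZMod 2) K ⧸
      (principalDivisors (ZMod 2) K).addSubgroupOf (zeroDivisors (ZMod 2) K)) = 0 :=
        Subsingleton.elim _ _
    rw [QuotientAddGroup.eq_zero_iff] at h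
    exact h
  · intro h
    refine ⟨⟨fun a b => ?_⟩, ⟨0⟩⟩
    have key : ∀ a : zeroDivisors (ZMod 2) K ⧸
        (principalDivisors (ZMod 2) K).addSubgroupOf (zeroDivisors (ZMod 2) K), a = 0 := by
      intro a
      obtain ⟨⟨D, hD⟩, rfl⟩ := QuotientAddGroup.mk_surjective a
      rw [QuotientAddGroup.eq_zero_iff]
      exact mem_principalDivisors.2 (h D hD)
    rw [key a, key b]

end RiemannBound

end CFF

namespace CFF

open Polynomial

section RiemannInequality

variable {K : Type*} [Field K] [Algebra k2 K] [FiniteDimensional k2 K]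
  [Algebra.IsSeparable k2 K] [Algebra (ZMod 2) K]

theorem ordAt_mul_placeDegree_le {b : Bool} {g : (ZMod 2)[X]} (hg : Irreducible g)
    {p : Place (ZMod 2) K} (hb : algebraMap k2 K (coord b) ∈ p.1)
    (hv : p.1.valuation (evc K b g) < 1) :
    ordAt p.1 (evc K b g) * (placeDegree (ZMod 2) p : ℤ) ≤ Module.finrank k2 K * g.natDegree := by
  simpa using sum_ordAt_mul_placeDegree_le hg {p} (by simpa using ⟨hb, hv⟩)

theorem placeDegree_pos' (p : Place (ZMod 2) K) : 0 < placeDegree (ZMod 2) p := placeDegree_pos p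

theorem evc_ne_zero {b : Bool} {g : (ZMod 2)[X]} (hg : g ≠ 0) : evc K b g ≠ 0 :=
  (map_ne_zero_iff _ (evc_injective b)).2 hg

theorem one_le_ordAt_of_valuation_lt_one {p : Place (ZMod 2) K} {f : K} (hf : f ≠ 0)
    (h : p.1.valuation f < 1) : 1 ≤ ordAt p.1 f :=
  (valuation_lt_one_iff_ordAt hf).1 h

theorem eq_of_le_ordAt_mul_placeDegree {b : Bool} {g : (ZMod 2)[X]} (hg : Irreducible g)
    {p q : Place (ZMod 2) K} (hb : algebraMap k2 K (coord b) ∈ p.1)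
    (hv : p.1.valuation (evc K b g) < 1) (hb' : algebraMap k2 K (coord b) ∈ q.1)
    (hv' : q.1.valuation (evc K b g) < 1)
    (hp : (Module.finrank k2 K * g.natDegree : ℤ) ≤
      ordAt p.1 (evc K b g) * (placeDegree (ZMod 2) p : ℤ)) : q = p := by
  by_contra hne
  have h := sum_ordAt_mul_placeDegree_le hg {q, p} (by
    simp only [Finset.mem_insert, Finset.mem_singleton]
    rintro r (rfl | rfl)
    exacts [⟨hb', hv'⟩, ⟨hb, hv⟩])
  rw [Finset.sum_pair hne] at h
  have h1 := one_le_ordAt_of_valuation_lt_one (evc_ne_zero hg.ne_zero) hv'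
  have h2 := placeDegree_pos' q
  nlinarith

theorem coord_not_mem_iff {p : Place (ZMod 2) K} :
    algebraMap k2 K (coord true) ∉ p.1 ↔ p.1.valuation (algebraMap k2 K (coord false)) < 1 := by
  rw [valuation_lt_one_iff_inv_notMem _ (by simpa using coord_ne_zero false), ← map_inv₀]
  simp [coord]

theorem coord_false_mem {p : Place (ZMod 2) K} (h : algebraMap k2 K (coord true) ∉ p.1) :
    algebraMap k2 K (coord false) ∈ p.1 :=
  (ValuationSubring.valuation_le_one_iff _ _).1 (coord_not_mem_iff.1 h).le

theorem ordAt_coord_false (p : Place (ZMod 2) K) : ordAt p.1 (algebraMap k2 K (coord false)) =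
    -ordAt p.1 (algebraMap k2 K (coord true)) := by
  rw [← ordAt_inv, ← map_inv₀]
  simp [coord]

theorem ordAt_evc_of_not_mem {p : Place (ZMod 2) K} (h : algebraMap k2 K (coord true) ∉ p.1)
    {g : (ZMod 2)[X]} (hg : g ≠ 0) : ordAt p.1 (evc K true g) =
      g.natDegree * ordAt p.1 (algebraMap k2 K (coord true)) := by
  have hT : algebraMap k2 K (coord true) ≠ 0 := by simpa using coord_ne_zero true
  have e : evc K true g = evc K false g.reverse * algebraMap k2 K (coord true) ^ g.natDegree := by
    rw [evc_apply, evc_apply, ← map_pow, ← map_mul]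
    congr 1
    have : Invertible (RatFunc.X : k2) := invertibleOfNonzero RatFunc.X_ne_zero
    have h := eval₂_reverse_mul_pow (algebraMap (ZMod 2) k2) RatFunc.X g
    rw [invOf_eq_inv] at h
    exact h.symm
  have hr0 : g.reverse ≠ 0 := by simpa using hg
  have hr : ordAt p.1 (evc K false g.reverse) = 0 := by
    have h1 := mem_iff_ordAt_nonneg.1 (evc_mem (coord_false_mem h) g.reverse)
    by_contra hne
    have h2 : p.1.valuation (evc K false g.reverse) < 1 :=
      (valuation_lt_one_iff_ordAt (evc_ne_zero hr0)).2 (by omega)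
    have hc : g.reverse.coeff 0 = 1 := by
      rw [coeff_zero_reverse]
      exact (show ∀ a : ZMod 2, a ≠ 0 → a = 1 by decide) _ (leadingCoeff_ne_zero.2 hg)
    have h3 := congrArg (evc K false) (divX_mul_X_add g.reverse)
    rw [hc, map_add, map_mul, C_1, map_one, evc_X] at h3
    have h4 : p.1.valuation (evc K false g.reverse.divX * algebraMap k2 K (coord false)) < 1 := by
      rw [map_mul, mul_comm]
      exact mul_lt_one_of_lt_of_le (coord_not_mem_iff.1 h)
        ((ValuationSubring.valuation_le_one_iff _ _).2 (evc_mem (coord_false_mem h) _))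
    have h5 := Valuation.map_sub_lt _ h2 h4
    rw [← h3, add_sub_cancel_left, map_one] at h5
    exact lt_irrefl _ h5
  rw [e, ordAt_mul (evc_ne_zero hr0) (pow_ne_zero _ hT), ordAt_pow hT, hr, zero_add]

variable {P : Place (ZMod 2) K} (hP : algebraMap k2 K (coord true) ∉ P.1)
  (hu : ∀ q : Place (ZMod 2) K, algebraMap k2 K (coord true) ∉ q.1 → q = P)
  (hdeg : placeDegree (ZMod 2) P = Module.finrank k2 K)
  (hord : ordAt P.1 (algebraMap k2 K (coord true)) = -1)

include hP hu hdeg hord in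
theorem degHom_divOf_evc_le {g : (ZMod 2)[X]} (hg : g ≠ 0) :
    degHom (ZMod 2) K (divOf (evc K true g) (evc_ne_zero hg)) ≤ 0 := by
  induction g using WfDvdMonoid.induction_on_irreducible with
  | zero => exact (hg rfl).elim
  | unit u hu' =>
    obtain ⟨c, hc, rfl⟩ := Polynomial.isUnit_iff.1 hu'
    have : c = 1 := (show ∀ a : ZMod 2, a ≠ 0 → a = 1 by decide) _ hc.ne_zero
    subst this
    have e : divOf (evc K true (C 1)) (evc_ne_zero hg) = 0 := by ext p; simp [ordAt_one]
    rw [e, map_zero]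
  | mul a i ha hi ih =>
    have e : divOf (evc K true (i * a)) (evc_ne_zero hg) =
        divOf (evc K true i) (evc_ne_zero hi.ne_zero) + divOf (evc K true a) (evc_ne_zero ha) := by
      rw [← divOf_mul]; congr 1; exact map_mul _ _ _
    rw [e, map_add]
    refine add_nonpos ?_ (ih ha)
    set D := divOf (evc K true i) (evc_ne_zero hi.ne_zero) with hD
    have hs : degHom (ZMod 2) K D = D P * (placeDegree (ZMod 2) P : ℤ) +
        ∑ q ∈ D.support.erase P, D q * (placeDegree (ZMod 2) q : ℤ) := by
      rw [degHom_apply, Finsupp.sum_of_support_subset D (s := insert P (D.support.erase P))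
        (by intro q; simp only [Finset.mem_insert, Finset.mem_erase]; tauto) _ (by simp),
        Finset.sum_insert (Finset.notMem_erase _ _)]
    have hb := sum_ordAt_mul_placeDegree_le (K := K) (b := true) hi (D.support.erase P) (by
      intro q hq
      obtain ⟨hqP, hq⟩ := Finset.mem_erase.1 hq
      have hT : algebraMap k2 K (coord true) ∈ q.1 := by
        by_contra h
        exact hqP (hu q h)
      refine ⟨hT, (valuation_lt_one_iff_ordAt (evc_ne_zero hi.ne_zero)).2 ?_⟩
      have h1 := mem_iff_ordAt_nonneg.1 (evc_mem hT i)
      rw [Finsupp.mem_support_iff, hD, divOf_apply] at hq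
      omega)
    have hDP : D P = -(i.natDegree : ℤ) := by
      rw [hD, divOf_apply, ordAt_evc_of_not_mem hP hi.ne_zero, hord]; ring
    rw [hs, hDP, hdeg]
    simp only [hD, divOf_apply] at hb ⊢
    linarith

theorem exists_evc_le (D : Divisor (ZMod 2) K) : ∃ h : (ZMod 2)[X], h ≠ 0 ∧
    ∀ p : Place (ZMod 2) K, algebraMap k2 K (coord true) ∈ p.1 →
      D p ≤ ordAt p.1 (evc K true h) := by
  have key : ∀ s : Finset (Place (ZMod 2) K), ∃ h : (ZMod 2)[X], h ≠ 0 ∧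
      ∀ p ∈ s, algebraMap k2 K (coord true) ∈ p.1 → D p ≤ ordAt p.1 (evc K true h) := by
    intro s
    induction s using Finset.induction_on with
    | empty => exact ⟨1, one_ne_zero, by simp⟩
    | insert p s hp ih =>
      obtain ⟨h, hh, H⟩ := ih
      by_cases hT : algebraMap k2 K (coord true) ∈ p.1
      · obtain ⟨g, hg, hv⟩ := exists_irreducible_evc p hT
        refine ⟨g ^ (D p).toNat * h, mul_ne_zero (pow_ne_zero _ hg.ne_zero) hh, ?_⟩
        intro q hq hTq
        have hg0 := evc_ne_zero (K := K) (b := true) hg.ne_zero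
        have hh0 := evc_ne_zero (K := K) (b := true) hh
        rw [map_mul, map_pow, ordAt_mul (pow_ne_zero _ hg0) hh0, ordAt_pow hg0]
        have h1 := mem_iff_ordAt_nonneg.1 (evc_mem hTq g)
        have h2 := mem_iff_ordAt_nonneg.1 (evc_mem hTq h)
        rcases Finset.mem_insert.1 hq with rfl | hq
        · have h3 := one_le_ordAt_of_valuation_lt_one hg0 hv
          have h4 := Int.self_le_toNat (D q)
          nlinarith
        · have := H q hq hTq
          nlinarith [mul_nonneg (Int.natCast_nonneg (D p).toNat) h1]
      · refine ⟨h, hh, fun q hq hTq ↦ ?_⟩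
        rcases Finset.mem_insert.1 hq with rfl | hq
        exacts [(hT hTq).elim, H q hq hTq]
  obtain ⟨h, hh, H⟩ := key D.support
  refine ⟨h, hh, fun p hT ↦ ?_⟩
  by_cases hp : p ∈ D.support
  · exact H p hp hT
  · rw [Finsupp.notMem_support_iff.1 hp]
    exact mem_iff_ordAt_nonneg.1 (evc_mem hT h)

include hP hu hdeg hord in
theorem riemannBound_of (h5 : Module.finrank k2 K = 5)
    (hell : ∀ m : ℕ, 1 ≤ m → 5 * m ≤ ell (ZMod 2) (Finsupp.single P (m : ℤ)) + 3) :
    RiemannBound K := by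
  intro D
  obtain ⟨h, hh, H⟩ := exists_evc_le D
  set V := divOf (evc K true h) (evc_ne_zero hh) with hV
  set m : ℕ := ((D - V) P).toNat + 1 with hm
  have hle : D - V ≤ Finsupp.single P (m : ℤ) := by
    intro p
    by_cases hp : p = P
    · subst hp
      rw [Finsupp.single_eq_same]
      have := Int.self_le_toNat ((D - V) p)
      omega
    · rw [Finsupp.single_eq_of_ne hp, Finsupp.sub_apply, hV, divOf_apply]
      have := H p (by by_contra h; exact hp (hu p h))
      omega
  have h1 := ell_add_degHom_le hle
  have h2 := ell_add_divOf (D - V) (evc_ne_zero (K := K) (b := true) hh)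
  rw [← hV, sub_add_cancel] at h2
  have h3 : degHom (ZMod 2) K V ≤ 0 := degHom_divOf_evc_le hP hu hdeg hord hh
  have h4 := hell m (by omega)
  rw [map_sub, degHom_single, hdeg, h5] at h1
  push_cast at h1
  omega

end RiemannInequality

end CFF

namespace CFF

open Polynomial

section CarlitzAction

variable {R S : Type*} [CommRing R] [CharP R 2] [CommRing S] [CharP S 2]

/-- The Carlitz action `x ↦ x² + t x` of a parameter `t` on a ring of characteristic two. -/
def carlitzAct (t : R) : R →+ R where
  toFun x := x ^ 2 + t * x
  map_zero' := by ring
  map_add' x y := by rw [CharTwo.add_sq]; ring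

theorem carlitzAct_apply (t x : R) : carlitzAct t x = x ^ 2 + t * x := rfl

theorem map_carlitzAct_iterate (f : R →+* S) (t x : R) (n : ℕ) :
    f ((carlitzAct t)^[n] x) = (carlitzAct (f t))^[n] (f x) := by
  induction n with
  | zero => rfl
  | succ n ih =>
    rw [Function.iterate_succ_apply', Function.iterate_succ_apply', ← ih, carlitzAct_apply,
      carlitzAct_apply]
    simp

/-- `x` is a torsion point of the Carlitz module for `T⁴ + T + 1`. -/
def IsTorsion (t x : R) : Prop := (carlitzAct t)^[4] x = carlitzAct t x + x

variable {t x : R}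

theorem IsTorsion.map (f : R →+* S) (h : IsTorsion t x) : IsTorsion (f t) (f x) := by
  have := congrArg f h
  rw [map_carlitzAct_iterate, map_add] at this
  exact this.trans (by simp [carlitzAct_apply])

theorem IsTorsion.iterate (h : IsTorsion t x) (n : ℕ) : IsTorsion t ((carlitzAct t)^[n] x) := by
  rw [IsTorsion, ← Function.iterate_add_apply, add_comm, Function.iterate_add_apply, h,
    iterate_map_add, ← Function.iterate_succ_apply, Function.iterate_succ_apply']

theorem IsTorsion.iterate_add_four (h : IsTorsion t x) (n : ℕ) :
    (carlitzAct t)^[n + 4] x = (carlitzAct t)^[n + 1] x + (carlitzAct t)^[n] x := by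
  rw [Function.iterate_add_apply, h, iterate_map_add, ← Function.iterate_succ_apply]

theorem IsTorsion.iterate_fifteen (h : IsTorsion t x) : (carlitzAct t)^[15] x = x := by
  have r := h.iterate_add_four
  have h0 := r 0
  have h3 := r 3
  have h4 := r 4
  have h5 := r 5
  have h7 := r 7
  have h8 := r 8
  have h11 := r 11
  have h1 := r 1
  have h2 := r 2
  have h6 := r 6
  norm_num at *
  generalize (carlitzAct t)^[15] x = a15 at *
  generalize (carlitzAct t)^[12] x = a12 at *
  generalize (carlitzAct t)^[11] x = a11 at *
  generalize (carlitzAct t)^[10] x = a10 at *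
  generalize (carlitzAct t)^[9] x = a9 at *
  generalize (carlitzAct t)^[8] x = a8 at *
  generalize (carlitzAct t)^[7] x = a7 at *
  generalize (carlitzAct t)^[6] x = a6 at *
  generalize (carlitzAct t)^[5] x = a5 at *
  generalize (carlitzAct t)^[4] x = a4 at *
  generalize (carlitzAct t)^[3] x = a3 at *
  generalize (carlitzAct t)^[2] x = a2 at *
  have two : (2 : R) = 0 := CharTwo.two_eq_zero
  grind

theorem carlitzAct_iterate_two (t x : R) : (carlitzAct t)^[2] x =
    x ^ 4 + (t ^ 2 + t) * x ^ 2 + t ^ 2 * x := by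
  simp only [Function.iterate_succ_apply, Function.iterate_zero, id, carlitzAct_apply]
  simp only [CharTwo.add_sq, mul_pow, ← pow_mul]
  ring

theorem carlitzAct_iterate_three (t x : R) : (carlitzAct t)^[3] x =
    x ^ 8 + (t ^ 4 + t ^ 2 + t) * x ^ 4 + (t ^ 4 + t ^ 3 + t ^ 2) * x ^ 2 + t ^ 3 * x := by
  rw [Function.iterate_succ_apply', carlitzAct_iterate_two, carlitzAct_apply]
  simp only [CharTwo.add_sq, mul_pow, ← pow_mul]
  ring

theorem carlitzAct_iterate_four (t x : R) : (carlitzAct t)^[4] x =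
    x ^ 16 + (t ^ 8 + t ^ 4 + t ^ 2 + t) * x ^ 8 +
      (t ^ 8 + t ^ 6 + t ^ 5 + t ^ 4 + t ^ 3 + t ^ 2) * x ^ 4 +
      (t ^ 6 + t ^ 5 + t ^ 4 + t ^ 3) * x ^ 2 + t ^ 4 * x := by
  rw [Function.iterate_succ_apply', carlitzAct_iterate_three, carlitzAct_apply]
  simp only [CharTwo.add_sq, mul_pow, ← pow_mul]
  ring

theorem isTorsion_iff : IsTorsion t x ↔ x ^ 16 + (t ^ 4 + t + 1) *
    ((t ^ 4 + t) * x ^ 8 + (t ^ 4 + t ^ 2) * x ^ 4 + (t ^ 2 + t + 1) * x ^ 2 + x) = 0 := by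
  have two : (2 : R) = 0 := CharTwo.two_eq_zero
  rw [IsTorsion, carlitzAct_iterate_four, carlitzAct_apply]
  constructor <;> intro h <;> grind

end CarlitzAction

section Field

variable {R : Type*} [Field R] [CharP R 2] {t x y : R}

theorem IsTorsion.pow_fifteen (h : IsTorsion t x) (hx : x ≠ 0) :
    x ^ 15 = (t ^ 4 + t + 1) *
    (1 + x * ((t ^ 4 + t) * x ^ 6 + (t ^ 4 + t ^ 2) * x ^ 2 + (t ^ 2 + t + 1))) := by
  have two : (2 : R) = 0 := CharTwo.two_eq_zero
  rw [isTorsion_iff] at h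
  refine mul_left_cancel₀ hx ?_
  rw [← sub_eq_zero, ← h]
  linear_combination (-(t ^ 4 + t + 1) *
    ((t ^ 4 + t) * x ^ 8 + (t ^ 4 + t ^ 2) * x ^ 4 + (t ^ 2 + t + 1) * x ^ 2 + x)) * two

theorem IsTorsion.eq_of_iterate_three (h : IsTorsion t x) (h3 : (carlitzAct t)^[3] x = x) :
    x = 0 := by
  have := h.iterate_add_four 0
  rw [Function.iterate_succ_apply', h3] at this
  simpa using this

theorem IsTorsion.eq_of_iterate_five (h : IsTorsion t x) (h5 : (carlitzAct t)^[5] x = x) :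
    x = 0 := by
  have two : (2 : R) = 0 := CharTwo.two_eq_zero
  have h1 := h.iterate_add_four 0
  have h2 := h.iterate_add_four 1
  have h3 := h.iterate_add_four 2
  have h4 : (carlitzAct t)^[6] x = (carlitzAct t)^[1] x := by
    rw [Function.iterate_succ_apply', h5]; rfl
  norm_num at h1 h2 h3
  norm_num at h4
  grind

theorem IsTorsion.minimalPeriod (h : IsTorsion t x) (hx : x ≠ 0) :
    Function.minimalPeriod (carlitzAct t) x = 15 := by
  have hd := Function.IsPeriodicPt.minimalPeriod_dvd
    (show Function.IsPeriodicPt (carlitzAct t) 15 x from h.iterate_fifteen)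
  have h3 : ¬ Function.minimalPeriod (carlitzAct t) x ∣ 3 := fun H ↦ hx <|
    h.eq_of_iterate_three (Function.isPeriodicPt_iff_minimalPeriod_dvd.2 H)
  have h5 : ¬ Function.minimalPeriod (carlitzAct t) x ∣ 5 := fun H ↦ hx <|
    h.eq_of_iterate_five (Function.isPeriodicPt_iff_minimalPeriod_dvd.2 H)
  generalize Function.minimalPeriod (carlitzAct t) x = n at *
  have := Nat.le_of_dvd (by norm_num) hd
  interval_cases n <;> revert hd h3 h5 <;> decide

theorem IsTorsion.iterate_eq_iff (h : IsTorsion t x) (hx : x ≠ 0) {m n : ℕ} :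
    (carlitzAct t)^[m] x = (carlitzAct t)^[n] x ↔ m ≡ n [MOD 15] := by
  rw [← h.minimalPeriod hx, ← Function.iterate_mod_minimalPeriod_eq (n := m),
    ← Function.iterate_mod_minimalPeriod_eq (n := n), Nat.ModEq]
  have hp : 0 < Function.minimalPeriod (carlitzAct t) x := by rw [h.minimalPeriod hx]; norm_num
  exact ⟨fun H ↦ Function.iterate_injOn_Iio_minimalPeriod (Nat.mod_lt _ hp) (Nat.mod_lt _ hp) H,
    fun H ↦ by rw [H]⟩

theorem IsTorsion.iterate_ne_zero (h : IsTorsion t x) (hx : x ≠ 0) (n : ℕ) :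
    (carlitzAct t)^[n] x ≠ 0 := by
  intro H
  have h1 := (h.iterate_eq_iff hx (m := n) (n := n + 1)).1 (by
    rw [Function.iterate_succ_apply', H, map_zero])
  rw [Nat.ModEq] at h1
  omega

theorem IsTorsion.exists_iterate (h : IsTorsion t x) (hx : x ≠ 0) (hy : IsTorsion t y)
    (hy0 : y ≠ 0) : ∃ n < 15, y = (carlitzAct t)^[n] x := by
  set p : R[X] := X ^ 16 + (C (t ^ 4 + t + 1) * (C (t ^ 4 + t) * X ^ 8 +
    C (t ^ 4 + t ^ 2) * X ^ 4 + C (t ^ 2 + t + 1) * X ^ 2 + X)) with hp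
  have hdeg : p.natDegree = 16 := by rw [hp]; compute_degree!
  have hp0 : p ≠ 0 := fun H ↦ by simp [H] at hdeg
  have hroot : ∀ z, z ∈ p.roots.toFinset ↔ IsTorsion t z := fun z ↦ by
    rw [Multiset.mem_toFinset, mem_roots hp0, isTorsion_iff, IsRoot.def, hp]; simp
  set s := insert 0 ((Finset.range 15).image fun n ↦ (carlitzAct t)^[n] x) with hs
  have hcard : s.card = 16 := by
    rw [hs, Finset.card_insert_of_notMem, Finset.card_image_of_injOn, Finset.card_range]
    · intro m hm n hn H
      have := (h.iterate_eq_iff hx).1 H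
      simp only [Finset.coe_range, Set.mem_Iio] at hm hn
      rwa [Nat.ModEq, Nat.mod_eq_of_lt hm, Nat.mod_eq_of_lt hn] at this
    · simp only [Finset.mem_image, not_exists, not_and]
      exact fun n _ ↦ h.iterate_ne_zero hx n
  have hsub : s ⊆ p.roots.toFinset := by
    intro z hz
    rw [hroot]
    rcases Finset.mem_insert.1 hz with rfl | hz
    · rw [isTorsion_iff]; simp
    · obtain ⟨n, -, rfl⟩ := Finset.mem_image.1 hz
      exact h.iterate n
  have heq := Finset.eq_of_subset_of_card_le hsub (by
    rw [hcard, ← hdeg]; exact (Multiset.toFinset_card_le _).trans (card_roots' p))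
  have hys : y ∈ s := by rw [heq, hroot]; exact hy
  rcases Finset.mem_insert.1 hys with rfl | hys
  · exact (hy0 rfl).elim
  · obtain ⟨n, hn, rfl⟩ := Finset.mem_image.1 hys
    exact ⟨n, Finset.mem_range.1 hn, rfl⟩

theorem sq_eq_carlitzAct_of_eq_zero (ht : t = 0) :
    x ^ 2 = (carlitzAct t)^[1] x := by
  rw [ht]; simp [carlitzAct_apply]

theorem IsTorsion.sq_eq_of_eq_one (h : IsTorsion t x) (ht : t = 1) :
    x ^ 2 = (carlitzAct t)^[4] x := by
  rw [h, ht, carlitzAct_apply, one_mul, add_assoc, CharTwo.add_self_eq_zero, add_zero]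

theorem carlitzAct_iterate_pow {m e : ℕ} (ht : t ^ 2 ^ m = t)
    (hx : x ^ 2 ^ m = (carlitzAct t)^[e] x) (j : ℕ) :
    x ^ 2 ^ (m * j) = (carlitzAct t)^[e * j] x := by
  induction j with
  | zero => simp
  | succ j ih =>
    rw [Nat.mul_succ, pow_add, pow_mul, ih]
    have := map_carlitzAct_iterate (iterateFrobenius R 2 m) t x (e * j)
    simp only [iterateFrobenius_def, ht, hx] at this
    rw [this, ← Function.iterate_add_apply, Nat.mul_succ]

theorem IsTorsion.iterate_seven (h : IsTorsion t x) :
    (carlitzAct t)^[7] x = (carlitzAct t)^[3] x + carlitzAct t x + x := by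
  rw [h.iterate_add_four 3, h]; ring

theorem IsTorsion.iterate_ten (h : IsTorsion t x) :
    (carlitzAct t)^[10] x = (carlitzAct t)^[2] x + carlitzAct t x + x := by
  have two : (2 : R) = 0 := CharTwo.two_eq_zero
  rw [h.iterate_add_four 6, h.iterate_seven, h.iterate_add_four 2]
  norm_num
  grind

theorem IsTorsion.iterate_nine (h : IsTorsion t x) :
    (carlitzAct t)^[9] x = (carlitzAct t)^[3] x + carlitzAct t x := by
  have two : (2 : R) = 0 := CharTwo.two_eq_zero
  rw [h.iterate_add_four 5, h.iterate_add_four 2, h.iterate_add_four 1]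
  norm_num
  grind

theorem IsTorsion.iterate_thirteen (h : IsTorsion t x) :
    (carlitzAct t)^[13] x = (carlitzAct t)^[3] x + (carlitzAct t)^[2] x + x := by
  have two : (2 : R) = 0 := CharTwo.two_eq_zero
  rw [h.iterate_add_four 9, h.iterate_nine, h.iterate_ten]
  grind

theorem IsTorsion.iterate_six (h : IsTorsion t x) :
    (carlitzAct t)^[6] x = (carlitzAct t)^[3] x + (carlitzAct t)^[2] x := h.iterate_add_four 2

/-- The Frobenius of a residue field of degree at most four acts on the torsion as an element
outside the subgroup cutting out the quintic field. -/
theorem IsTorsion.exists_pow_eq (h : IsTorsion t x) {d : ℕ} (hd : 1 ≤ d) (hd' : d ≤ 4)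
    (ht : t ^ 2 ^ d = t) (hM : t ^ 4 + t + 1 ≠ 0) :
    ∃ e, x ^ 2 ^ d = (carlitzAct t)^[e] x ∧ ¬ d ≡ 2 * e [MOD 5] := by
  have two : (2 : R) = 0 := CharTwo.two_eq_zero
  by_cases h0 : t = 0
  · have := carlitzAct_iterate_pow (t := t) (x := x) (m := 1) (e := 1)
      (by rw [h0]; norm_num) (by rw [pow_one, sq_eq_carlitzAct_of_eq_zero h0]) d
    rw [one_mul] at this
    exact ⟨d, this, by interval_cases d <;> decide⟩
  by_cases h1 : t = 1
  · have := carlitzAct_iterate_pow (t := t) (x := x) (m := 1) (e := 4)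
      (by rw [h1]; norm_num) (by rw [pow_one, h.sq_eq_of_eq_one h1]) d
    rw [one_mul] at this
    exact ⟨4 * d, this, by interval_cases d <;> decide⟩
  have h1' : t + 1 ≠ 0 := fun H ↦ h1 (by linear_combination H - two)
  by_cases h2 : t ^ 2 + t + 1 = 0
  · have ht2 : t ^ 2 ^ 2 = t := by norm_num; linear_combination (t ^ 2 - t) * h2
    have hx2 : x ^ 2 ^ 2 = (carlitzAct t)^[10] x := by
      rw [h.iterate_ten, carlitzAct_iterate_two, carlitzAct_apply]
      linear_combination (-(x ^ 2 + x)) * h2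
    interval_cases d
    · exact (h1' (by linear_combination (t + 1) * (h2 - ht) - t * (t + 1) * two)).elim
    · exact ⟨10, hx2, by decide⟩
    · exfalso
      have : t ^ 3 = 1 := by linear_combination (t - 1) * h2
      norm_num at ht
      apply h1'
      grind
    · exact ⟨10 * 2, carlitzAct_iterate_pow (m := 2) ht2 hx2 2, by decide⟩
  interval_cases d
  · exact (mul_ne_zero h0 h1' (by linear_combination ht + t * two)).elim
  · exact (mul_ne_zero (mul_ne_zero h0 h1') h2
      (by linear_combination ht + (t ^ 3 + t ^ 2 + t) * two)).elim
  · by_cases h3 : t ^ 3 + t + 1 = 0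
    · refine ⟨7, ?_, by decide⟩
      rw [h.iterate_seven, carlitzAct_iterate_three, carlitzAct_apply]
      grind
    by_cases h3' : t ^ 3 + t ^ 2 + 1 = 0
    · refine ⟨13, ?_, by decide⟩
      rw [h.iterate_thirteen, carlitzAct_iterate_three, carlitzAct_iterate_two]
      grind
    exact (mul_ne_zero (mul_ne_zero h0 h1') (mul_ne_zero h3 h3') (by
      linear_combination
        ht + (t ^ 7 + t ^ 6 + 2 * t ^ 5 + 2 * t ^ 4 + t ^ 3 + t ^ 2 + t) * two)).elim
  · by_cases h3 : t ^ 4 + t ^ 3 + 1 = 0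
    · refine ⟨9, ?_, by decide⟩
      have : (carlitzAct t)^[9] x = (carlitzAct t)^[4] x + (carlitzAct t)^[3] x + x := by
        rw [h.iterate_nine, h]; grind
      rw [this, carlitzAct_iterate_four, carlitzAct_iterate_three]
      linear_combination (-(x + t ^ 2 * x ^ 2 + (t ^ 4 + t ^ 3 + t) * x ^ 4 +
        (t ^ 4 + t ^ 3 + t ^ 2 + t + 1) * x ^ 8)) * h3 +
        (-(x ^ 2 * t ^ 3) - x ^ 2 * t ^ 4 - x ^ 4 * t ^ 2 + x ^ 4 * t ^ 7 + x ^ 8 * t ^ 3 +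
          x ^ 8 * t ^ 4 + x ^ 8 * t ^ 5 + x ^ 8 * t ^ 6 + x ^ 8 * t ^ 7) * two
    by_cases h3' : t ^ 4 + t ^ 3 + t ^ 2 + t + 1 = 0
    · refine ⟨6, ?_, by decide⟩
      have : (carlitzAct t)^[6] x = (carlitzAct t)^[4] x + (carlitzAct t)^[3] x +
          (carlitzAct t)^[2] x + carlitzAct t x + x := by
        rw [h.iterate_six, h]; grind
      rw [this, carlitzAct_iterate_four, carlitzAct_iterate_three, carlitzAct_iterate_two,
        carlitzAct_apply]
      linear_combination (-(x + (t ^ 2 + 1) * x ^ 2 + (t ^ 4 + t ^ 3 + t ^ 2 + 1) * x ^ 4 +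
        (t ^ 4 + t ^ 3 + 1) * x ^ 8)) * h3' +
        (x ^ 4 + x ^ 8) * (t ^ 3 + t ^ 4 + t ^ 5 + t ^ 6 + t ^ 7) * two
    exact (mul_ne_zero (mul_ne_zero (mul_ne_zero h0 h1') h2)
      (mul_ne_zero (mul_ne_zero h3 h3') hM) (by
      linear_combination ht + (t + 2 * t ^ 2 + 4 * t ^ 3 + 6 * t ^ 4 + 9 * t ^ 5 + 13 * t ^ 6 +
        16 * t ^ 7 + 17 * t ^ 8 + 17 * t ^ 9 + 16 * t ^ 10 + 13 * t ^ 11 +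
        9 * t ^ 12 + 6 * t ^ 13 + 4 * t ^ 14 + 2 * t ^ 15) * two)).elim

end Field

section Frobenius

variable {R : Type*} [Field R] [CharP R 2] {g : R}

theorem minimalPeriod_frobenius (hg : g ^ 5 + g ^ 2 + 1 = 0) :
    Function.minimalPeriod (frobenius R 2) g = 5 := by
  have two : (2 : R) = 0 := CharTwo.two_eq_zero
  refine Function.minimalPeriod_eq_prime (p := 5) (hp := ⟨by norm_num⟩) ?_ ?_
  · rw [Function.IsPeriodicPt, Function.IsFixedPt, iterate_frobenius]
    have h10 : g ^ 10 = g ^ 4 + 1 := by grind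
    have h20 : g ^ 20 = g ^ 8 + 1 := by grind
    have : g ^ 32 = g ^ 20 * g ^ 10 * g ^ 2 := by ring
    norm_num
    rw [this, h10, h20]
    grind
  · intro H
    rw [Function.IsFixedPt, frobenius_def] at H
    have : g ^ 5 = g := by rw [show g ^ 5 = (g ^ 2) ^ 2 * g by ring, H, H, ← sq, H]
    rw [this, H] at hg
    have : (1 : R) = 0 := by linear_combination hg - g * two
    exact one_ne_zero this

theorem pow_two_pow_eq_iff (hg : g ^ 5 + g ^ 2 + 1 = 0) {m n : ℕ} :
    g ^ 2 ^ m = g ^ 2 ^ n ↔ m ≡ n [MOD 5] := by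
  rw [← iterate_frobenius, ← iterate_frobenius, ← minimalPeriod_frobenius hg,
    ← Function.iterate_mod_minimalPeriod_eq (n := m),
    ← Function.iterate_mod_minimalPeriod_eq (n := n), Nat.ModEq]
  have hp : 0 < Function.minimalPeriod (frobenius R 2) g := by
    rw [minimalPeriod_frobenius hg]; norm_num
  exact ⟨fun H ↦ Function.iterate_injOn_Iio_minimalPeriod (Nat.mod_lt _ hp) (Nat.mod_lt _ hp) H,
    fun H ↦ by rw [H]⟩

end Frobenius

end CFF

namespace CFF

section Tower

variable {K C : Type*} [Field K] [Algebra k2 K] [FiniteDimensional k2 K]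
  [Algebra.IsSeparable k2 K] [Algebra (ZMod 2) K] [Field C] [Algebra k2 C] [Algebra K C]
  [IsScalarTower k2 K C] [FiniteDimensional k2 C] [IsGalois k2 C] [Algebra (ZMod 2) C]

variable (C) in
theorem exists_place_above (p : Place (ZMod 2) K) :
    ∃ P : Place (ZMod 2) C, P.1.comap (algebraMap K C) = p.1 := by
  obtain ⟨P, hP, hloc⟩ := IsLocalRing.exists_factor_valuationRing
    ((algebraMap K C).comp (p.1.subtype))
  have heq : P.comap (algebraMap K C) = p.1 := by
    ext x
    refine ⟨fun hx ↦ ?_, fun hx ↦ hP ⟨x, hx⟩⟩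
    by_contra hxp
    have hx' := (p.1.mem_or_inv_mem x).resolve_left hxp
    have hx0 : x ≠ 0 := by rintro rfl; exact hxp p.1.zero_mem
    have hu : IsUnit (⟨x⁻¹, hx'⟩ : p.1) := by
      refine hloc.map_nonunit _ ?_
      refine IsUnit.of_mul_eq_one ⟨algebraMap K C x, hx⟩ (Subtype.ext ?_)
      change algebraMap K C x⁻¹ * algebraMap K C x = 1
      rw [← map_mul, inv_mul_cancel₀ hx0, map_one]
    obtain ⟨y, hy⟩ := hu.exists_right_inv
    have : x⁻¹ * (y : K) = 1 := congrArg Subtype.val hy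
    rw [inv_mul_eq_one₀ hx0] at this
    exact hxp (this ▸ y.2)
  refine ⟨⟨P, isPlace_of_ne_top ?_⟩, heq⟩
  rintro rfl
  exact p.2.1 (heq ▸ rfl)

section Above

variable {p : Place (ZMod 2) K} {P Q : Place (ZMod 2) C}

theorem mem_iff_of_comap (h : P.1.comap (algebraMap K C) = p.1) (x : K) :
    algebraMap K C x ∈ P.1 ↔ x ∈ p.1 := by rw [← h]; rfl

theorem valuation_lt_one_iff_of_comap (h : P.1.comap (algebraMap K C) = p.1) (x : K) :
    P.1.valuation (algebraMap K C x) < 1 ↔ p.1.valuation x < 1 := by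
  rw [← valuation_comap_lt_one, h]

theorem centre_eq_maximalIdeal (h : P.1.comap (algebraMap K C) = p.1)
    (h' : ∀ r : p.1, algebraMap p.1 C r ∈ P.1) :
    centre p.1 P.1 h' = IsLocalRing.maximalIdeal p.1 := by
  ext r
  exact mem_centre.trans ((valuation_lt_one_iff_of_comap h r).trans (mem_maximalIdeal_iff r).symm)

theorem exists_frobenius_above (h : P.1.comap (algebraMap K C) = p.1) :
    ∃ σ : C ≃ₐ[K] C, ∀ x ∈ P.1, P.1.valuation (σ x - x ^ 2 ^ placeDegree (ZMod 2) p) < 1 := by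
  have : FiniteDimensional K C := FiniteDimensional.right k2 K C
  have : IsGalois K C := IsGalois.tower_top_of_isGalois k2 K C
  have h' : ∀ r : p.1, algebraMap p.1 C r ∈ P.1 := fun r ↦ (mem_iff_of_comap h r).2 r.2
  have hc := centre_eq_maximalIdeal h h'
  have e : Nat.card (p.1 ⧸ centre p.1 P.1 h') = 2 ^ placeDegree (ZMod 2) p := by
    rw [hc]; exact natCard_residueField p
  have : Finite (p.1 ⧸ centre p.1 P.1 h') := by
    rw [hc]; exact (inferInstance : Finite (IsLocalRing.ResidueField p.1))
  obtain ⟨σ, hσ⟩ := exists_frobenius (k := K) h' P.2.1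
  rw [e] at hσ
  exact ⟨σ, hσ⟩

theorem exists_conj_above (h : P.1.comap (algebraMap K C) = p.1)
    (hQ : Q.1.comap (algebraMap K C) = p.1) : ∃ σ : C ≃ₐ[K] C, ∀ x, x ∈ P.1 ↔ σ x ∈ Q.1 := by
  have : FiniteDimensional K C := FiniteDimensional.right k2 K C
  have : IsGalois K C := IsGalois.tower_top_of_isGalois k2 K C
  have h' : ∀ r : p.1, algebraMap p.1 C r ∈ P.1 := fun r ↦ (mem_iff_of_comap h r).2 r.2
  have h'' : ∀ r : p.1, algebraMap p.1 C r ∈ Q.1 := fun r ↦ (mem_iff_of_comap hQ r).2 r.2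
  exact exists_conj h' P.2.1 h'' (by
    rw [centre_eq_maximalIdeal h h', centre_eq_maximalIdeal hQ h''])

/-- The embedding of residue fields attached to an extension of places. -/
def residueMap (h : P.1.comap (algebraMap K C) = p.1) :
    IsLocalRing.ResidueField p.1 →+* IsLocalRing.ResidueField P.1 :=
  Ideal.Quotient.lift (IsLocalRing.maximalIdeal p.1)
    ((IsLocalRing.residue P.1).comp (((algebraMap K C).comp p.1.subtype).codRestrict P.1.toSubring
      fun r ↦ (mem_iff_of_comap h r).2 r.2)) fun r hr ↦ by
    rw [RingHom.comp_apply, residue_eq_zero_iff']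
    exact (valuation_lt_one_iff_of_comap h r).2 ((mem_maximalIdeal_iff r).1 hr)

theorem placeDegree_dvd_of_comap (h : P.1.comap (algebraMap K C) = p.1) :
    placeDegree (ZMod 2) p ∣ placeDegree (ZMod 2) P := by
  let := (residueMap h).toAlgebra
  have h1 := Module.natCard_eq_pow_finrank (K := IsLocalRing.ResidueField p.1)
    (V := IsLocalRing.ResidueField P.1)
  rw [natCard_residueField, natCard_residueField, ← pow_mul] at h1
  exact ⟨_, Nat.pow_right_injective le_rfl h1⟩

theorem exists_of_placeDegree_eq (h : P.1.comap (algebraMap K C) = p.1)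
    (hd : placeDegree (ZMod 2) p = placeDegree (ZMod 2) P) {x : C} (hx : x ∈ P.1) :
    ∃ y ∈ p.1, P.1.valuation (x - algebraMap K C y) < 1 := by
  have hb : Function.Bijective (residueMap h) := by
    rw [Nat.bijective_iff_injective_and_card, natCard_residueField, natCard_residueField, hd]
    exact ⟨(residueMap h).injective, rfl⟩
  obtain ⟨z, hz⟩ := hb.2 (IsLocalRing.residue P.1 ⟨x, hx⟩)
  obtain ⟨y, rfl⟩ := IsLocalRing.residue_surjective z
  exact ⟨y, y.2, (residue_eq_iff ⟨x, hx⟩ ⟨_, (mem_iff_of_comap h y).2 y.2⟩).1 hz.symm⟩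

end Above

end Tower

end CFF

namespace CFF

section Infinity

variable {C : Type*} [Field C] [CharP C 2]

instance (P : ValuationSubring C) : CharP P 2 :=
  CharTwo.of_one_ne_zero_of_two_eq_zero one_ne_zero
    (Subtype.ext (CharTwo.two_eq_zero (R := C)))

instance (P : ValuationSubring C) : CharP (IsLocalRing.ResidueField P) 2 :=
  CharTwo.of_one_ne_zero_of_two_eq_zero one_ne_zero (by
    have := congrArg (IsLocalRing.residue P) (CharTwo.two_eq_zero (R := P))
    rwa [map_ofNat, map_zero] at this)

variable {P : ValuationSubring C} {t x y : C}

omit [CharP C 2] in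
theorem mem_of_pow_sixteen {a b c d : C} (ha : a ∈ P) (hb : b ∈ P) (hc : c ∈ P) (hd : d ∈ P)
    (h : x ^ 16 = a * x ^ 8 + b * x ^ 4 + c * x ^ 2 + d * x) : x ∈ P := by
  by_contra hx
  have hy := (P.mem_or_inv_mem x).resolve_left hx
  have hx0 : x ≠ 0 := by rintro rfl; exact hx P.zero_mem
  have e : x = a * x⁻¹ ^ 7 + b * x⁻¹ ^ 11 + c * x⁻¹ ^ 13 + d * x⁻¹ ^ 14 := by
    refine mul_left_cancel₀ (pow_ne_zero 15 hx0) ?_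
    rw [← pow_succ, h]
    field_simp
  rw [e] at hx
  exact hx (by repeat' first | apply add_mem | apply mul_mem | apply pow_mem | assumption)

theorem IsTorsion.mem (h : IsTorsion t x) (ht : t ∈ P) : x ∈ P := by
  have two : (2 : C) = 0 := CharTwo.two_eq_zero
  rw [isTorsion_iff] at h
  refine mem_of_pow_sixteen (a := (t ^ 4 + t + 1) * (t ^ 4 + t))
    (b := (t ^ 4 + t + 1) * (t ^ 4 + t ^ 2)) (c := (t ^ 4 + t + 1) * (t ^ 2 + t + 1))
    (d := t ^ 4 + t + 1) ?_ ?_ ?_ ?_ ?_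
  any_goals repeat' first | apply add_mem | apply mul_mem | apply pow_mem | assumption |
    exact one_mem P
  linear_combination h - (t ^ 4 + t + 1) *
    ((t ^ 4 + t) * x ^ 8 + (t ^ 4 + t ^ 2) * x ^ 4 + (t ^ 2 + t + 1) * x ^ 2 + x) * two

theorem IsTorsion.div_pow_sixteen (h : IsTorsion t x) (ht : t ≠ 0) :
    (x / t) ^ 16 = (1 + t⁻¹ ^ 3 + t⁻¹ ^ 4) * (1 + t⁻¹ ^ 3) * (x / t) ^ 8 +
      (1 + t⁻¹ ^ 3 + t⁻¹ ^ 4) * (t⁻¹ ^ 4 + t⁻¹ ^ 6) * (x / t) ^ 4 +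
      (1 + t⁻¹ ^ 3 + t⁻¹ ^ 4) * (t⁻¹ ^ 8 + t⁻¹ ^ 9 + t⁻¹ ^ 10) * (x / t) ^ 2 +
      (1 + t⁻¹ ^ 3 + t⁻¹ ^ 4) * t⁻¹ ^ 11 * (x / t) := by
  have two : (2 : C) = 0 := CharTwo.two_eq_zero
  rw [isTorsion_iff] at h
  have h' : x ^ 16 = (t ^ 4 + t + 1) *
    ((t ^ 4 + t) * x ^ 8 + (t ^ 4 + t ^ 2) * x ^ 4 + (t ^ 2 + t + 1) * x ^ 2 + x) := by
    linear_combination h - (t ^ 4 + t + 1) *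
      ((t ^ 4 + t) * x ^ 8 + (t ^ 4 + t ^ 2) * x ^ 4 + (t ^ 2 + t + 1) * x ^ 2 + x) * two
  rw [div_pow, h']
  field_simp

variable (htP : t ∉ P)

include htP

omit [CharP C 2] in
theorem ne_zero_of_notMem : t ≠ 0 := by rintro rfl; exact htP P.zero_mem

omit [CharP C 2] in
theorem inv_mem_of_notMem : t⁻¹ ∈ P := (P.mem_or_inv_mem t).resolve_left htP

omit [CharP C 2] in
theorem valuation_inv_lt_one_of_notMem : P.valuation t⁻¹ < 1 := by
  rw [valuation_lt_one_iff_inv_notMem _ (inv_ne_zero (ne_zero_of_notMem htP)), inv_inv]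
  exact htP

theorem IsTorsion.div_mem (h : IsTorsion t x) : x / t ∈ P := by
  have hs := inv_mem_of_notMem htP
  refine mem_of_pow_sixteen ?_ ?_ ?_ ?_ (h.div_pow_sixteen (ne_zero_of_notMem htP))
  all_goals repeat' first | apply add_mem | apply mul_mem | apply pow_mem | assumption |
    exact one_mem P

/-- The leading coefficient at infinity of a torsion point. -/
def leadRes (h : IsTorsion t x) : IsLocalRing.ResidueField P :=
  IsLocalRing.residue P ⟨x / t, h.div_mem htP⟩

theorem leadRes_eq_zero_iff (h : IsTorsion t x) :
    leadRes htP h = 0 ↔ P.valuation (x / t) < 1 := residue_eq_zero_iff' _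

theorem leadRes_eq_zero_or_one (h : IsTorsion t x) : leadRes htP h = 0 ∨ leadRes htP h = 1 := by
  set s : P := ⟨t⁻¹, inv_mem_of_notMem htP⟩ with hs
  set z : P := ⟨x / t, h.div_mem htP⟩ with hz
  have e : z ^ 16 = (1 + s ^ 3 + s ^ 4) * (1 + s ^ 3) * z ^ 8 +
      (1 + s ^ 3 + s ^ 4) * (s ^ 4 + s ^ 6) * z ^ 4 +
      (1 + s ^ 3 + s ^ 4) * (s ^ 8 + s ^ 9 + s ^ 10) * z ^ 2 +
      (1 + s ^ 3 + s ^ 4) * s ^ 11 * z :=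
    Subtype.ext (h.div_pow_sixteen (ne_zero_of_notMem htP))
  have hs0 : IsLocalRing.residue P s = 0 :=
    (residue_eq_zero_iff' _).2 (valuation_inv_lt_one_of_notMem htP)
  have e' := congrArg (IsLocalRing.residue P) e
  simp only [map_add, map_mul, map_pow, map_one, hs0] at e'
  change (IsLocalRing.residue P z) = 0 ∨ (IsLocalRing.residue P z) = 1
  generalize IsLocalRing.residue P z = r at e'
  have e2 : r ^ 8 * (r - 1) ^ 8 = 0 := by
    have : (r - 1) ^ 8 = r ^ 8 - 1 := by
      have := sub_pow_char_pow (p := 2) (n := 3) r 1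
      simpa using this
    rw [this]
    linear_combination e'
  rcases mul_eq_zero.1 e2 with h | h
  · exact Or.inl (pow_eq_zero_iff (by norm_num) |>.1 h)
  · exact Or.inr (sub_eq_zero.1 (pow_eq_zero_iff (by norm_num) |>.1 h))

omit htP in
theorem IsTorsion.add (h : IsTorsion t x) (h' : IsTorsion t y) : IsTorsion t (x + y) := by
  rw [IsTorsion, iterate_map_add, map_add, h, h']; ring

theorem leadRes_add (h : IsTorsion t x) (h' : IsTorsion t y) :
    leadRes htP (h.add h') = leadRes htP h + leadRes htP h' := by
  rw [leadRes, leadRes, leadRes, ← map_add]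
  congr 1
  exact Subtype.ext (add_div _ _ _)

theorem leadRes_add_four (h : IsTorsion t x) (n : ℕ) :
    leadRes htP (h.iterate (n + 4)) =
      leadRes htP (h.iterate (n + 1)) + leadRes htP (h.iterate n) := by
  rw [← leadRes_add]
  congr 1
  exact h.iterate_add_four n

theorem valuation_carlitzAct_of_small (h : P.valuation (x / t) < 1) :
    P.valuation (carlitzAct t x) = P.valuation t * P.valuation x := by
  have ht := ne_zero_of_notMem htP
  have e : carlitzAct t x = t * x * (1 + x / t) := by rw [carlitzAct_apply]; field_simp; ring
  rw [e, map_mul, map_mul, Valuation.map_add_eq_of_lt_left, map_one, mul_one]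
  rwa [map_one]

theorem exists_leadRes_ne_zero (h : IsTorsion t x) (hx : x ≠ 0) :
    ∃ n, leadRes htP (h.iterate n) ≠ 0 := by
  by_contra! H
  simp only [leadRes_eq_zero_iff] at H
  have key : ∀ n, P.valuation ((carlitzAct t)^[n] x) = P.valuation t ^ n * P.valuation x := by
    intro n
    induction n with
    | zero => simp
    | succ n ih =>
      rw [Function.iterate_succ_apply', valuation_carlitzAct_of_small htP (H n), ih, pow_succ',
        mul_assoc]
  have h15 := key 15
  rw [h.iterate_fifteen, eq_comm, mul_eq_right₀ (by simpa using hx), ← map_pow] at h15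
  have ht1 : 1 < P.valuation t := by
    rw [← not_le, ValuationSubring.valuation_le_one_iff]; exact htP
  rw [map_pow] at h15
  exact (one_lt_pow₀ ht1 (by norm_num : (15 : ℕ) ≠ 0)).ne' h15

theorem eq_zero_of_leadRes (h : IsTorsion t x) (h0 : ∀ i < 4, leadRes htP (h.iterate i) = 0) :
    x = 0 := by
  by_contra hx
  obtain ⟨n, hn⟩ := exists_leadRes_ne_zero htP h hx
  refine hn ?_
  clear hn
  induction n using Nat.strong_induction_on with
  | _ n ih =>
    rcases lt_or_ge n 4 with h4 | h4
    · exact h0 n h4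
    · obtain ⟨m, rfl⟩ := Nat.exists_eq_add_of_le' h4
      rw [leadRes_add_four htP h, ih (m + 1) (by omega), ih m (by omega), add_zero]

omit htP [CharP C 2] in
theorem exists_window_aux {R : Type*} [Ring R] (h1 : (1 : R) + 1 = 0) {u : ℕ → R}
    (hu : ∀ n, u n = 0 ∨ u n = 1) (r : ∀ n, u (n + 4) = u (n + 1) + u n)
    (h0 : ¬ (u 0 = 0 ∧ u 1 = 0 ∧ u 2 = 0 ∧ u 3 = 0)) :
    ∃ n, u n = 0 ∧ u (n + 1) = 0 ∧ u (n + 2) = 0 ∧ u (n + 3) = 1 := by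
  let v : ℕ → ZMod 2 := fun n ↦ if u n = 0 then 0 else 1
  by_cases h : (1 : R) = 0
  · have : Subsingleton R := subsingleton_of_zero_eq_one h.symm
    exact ⟨0, Subsingleton.elim _ _, Subsingleton.elim _ _, Subsingleton.elim _ _,
      Subsingleton.elim _ _⟩
  have hv0 n : v n = 0 ↔ u n = 0 := by
    by_cases h : u n = 0 <;> simp [v, h]
  have hv1 n : v n = 1 ↔ u n = 1 := by
    rcases hu n with h | h <;> simp [v, h, ‹¬(1 : R) = 0›, Ne.symm ‹¬(1 : R) = 0›]
  have hr n : v (n + 4) = v (n + 1) + v n := by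
    have hn := r n
    rcases hu n with a | a <;> rcases hu (n + 1) with b | b <;> simp [a, b, h1] at hn <;>
      simp [v, hn, a, b, h] <;> rfl
  have key : ∀ a b c d : ZMod 2, ¬ (a = 0 ∧ b = 0 ∧ c = 0 ∧ d = 0) → ∃ n < 15,
      (fun s : ZMod 2 × ZMod 2 × ZMod 2 × ZMod 2 ↦ (s.2.1, s.2.2.1, s.2.2.2, s.2.1 + s.1))^[n]
        (a, b, c, d) = (0, 0, 0, 1) := by decide
  simp only [← hv0] at h0
  obtain ⟨n, -, hn⟩ := key _ _ _ _ h0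
  have it n :
      (fun s : ZMod 2 × ZMod 2 × ZMod 2 × ZMod 2 ↦ (s.2.1, s.2.2.1, s.2.2.2, s.2.1 + s.1))^[n]
        (v 0, v 1, v 2, v 3) = (v n, v (n + 1), v (n + 2), v (n + 3)) := by
    induction n with
    | zero => rfl
    | succ n ih => rw [Function.iterate_succ_apply', ih]; simp [← hr]
  rw [it, Prod.mk.injEq, Prod.mk.injEq, Prod.mk.injEq] at hn
  refine ⟨n, ?_⟩
  rwa [← hv0, ← hv0, ← hv0, ← hv1]

/-- Some iterate of a nonzero torsion point has a prescribed window of leading coefficients. -/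
theorem exists_window (h : IsTorsion t x) (hx : x ≠ 0) :
    ∃ n, leadRes htP (h.iterate n) = 0 ∧ leadRes htP (h.iterate (n + 1)) = 0 ∧
      leadRes htP (h.iterate (n + 2)) = 0 ∧ leadRes htP (h.iterate (n + 3)) = 1 := by
  have h1 : (1 : IsLocalRing.ResidueField P) + 1 = 0 := CharTwo.add_self_eq_zero 1
  have h0 : ¬ (leadRes htP (h.iterate 0) = 0 ∧ leadRes htP (h.iterate 1) = 0 ∧
      leadRes htP (h.iterate 2) = 0 ∧ leadRes htP (h.iterate 3) = 0) := by
    rintro ⟨a, b, c, d⟩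
    refine hx (eq_zero_of_leadRes htP h fun i hi ↦ ?_)
    interval_cases i <;> assumption
  have r : ∀ n, leadRes htP (h.iterate (n + 4)) =
      leadRes htP (h.iterate (n + 1)) + leadRes htP (h.iterate n) := leadRes_add_four htP h
  exact exists_window_aux h1 (fun n ↦ leadRes_eq_zero_or_one htP (h.iterate n)) r h0

theorem eq_of_window {y : C} (h : IsTorsion t x) (h' : IsTorsion t y)
    (e : ∀ i < 4, leadRes htP (h.iterate i) = leadRes htP (h'.iterate i)) : x = y := by
  have := eq_zero_of_leadRes htP (h.add h') fun i hi ↦ by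
    have e1 : leadRes htP ((h.add h').iterate i) =
        leadRes htP ((h.iterate i).add (h'.iterate i)) := by
      unfold leadRes
      congr 2
      rw [iterate_map_add]
    rw [e1, leadRes_add htP (h.iterate i) (h'.iterate i), e i hi, CharTwo.add_self_eq_zero]
  rwa [CharTwo.add_eq_zero] at this

/-- The torsion points with window `0, 0, 0, 1` at an infinite place. -/
theorem eq_of_small_window {y : C} (h : IsTorsion t x) (h' : IsTorsion t y)
    (hx : ∀ i < 3, P.valuation ((carlitzAct t)^[i] x / t) < 1)
    (hx3 : P.valuation ((carlitzAct t)^[3] x / t - 1) < 1)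
    (hy : ∀ i < 3, P.valuation ((carlitzAct t)^[i] y / t) < 1)
    (hy3 : P.valuation ((carlitzAct t)^[3] y / t - 1) < 1) : x = y := by
  refine eq_of_window htP h h' fun i hi ↦ ?_
  rcases lt_or_eq_of_le (Nat.lt_succ_iff.1 hi) with hi | rfl
  · rw [(leadRes_eq_zero_iff htP (h.iterate i)).2 (hx i hi),
      (leadRes_eq_zero_iff htP (h'.iterate i)).2 (hy i hi)]
  · rw [leadRes, leadRes, residue_eq_iff]
    have := P.valuation.map_sub_lt hx3 hy3
    simpa using this

theorem exists_small_window (h : IsTorsion t x) (hx : x ≠ 0) :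
    ∃ n, (∀ i < 3, P.valuation ((carlitzAct t)^[i] ((carlitzAct t)^[n] x) / t) < 1) ∧
      P.valuation ((carlitzAct t)^[3] ((carlitzAct t)^[n] x) / t - 1) < 1 := by
  obtain ⟨n, h0, h1, h2, h3⟩ := exists_window htP h hx
  refine ⟨n, fun i hi ↦ ?_, ?_⟩
  · rw [← Function.iterate_add_apply, add_comm]
    interval_cases i
    · exact (leadRes_eq_zero_iff htP (h.iterate n)).1 h0
    · exact (leadRes_eq_zero_iff htP (h.iterate (n + 1))).1 h1
    · exact (leadRes_eq_zero_iff htP (h.iterate (n + 2))).1 h2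
  · rw [← Function.iterate_add_apply, add_comm 3]
    have : leadRes htP (h.iterate (n + 3)) = IsLocalRing.residue P 1 := by rw [h3, map_one]
    exact (residue_eq_iff _ _).1 this

omit htP [CharP C 2] in
theorem valuation_sub_one_of_mul_one_add {z w : C}
    (h : P.valuation (z * (1 + w) - 1) < 1) (hw : P.valuation w < 1) :
    P.valuation (z - 1) < 1 := by
  have h1 : P.valuation (1 + w) = 1 := by
    rw [Valuation.map_add_eq_of_lt_left, map_one]; rwa [map_one]
  have e : (z - 1) * (1 + w) = (z * (1 + w) - 1) - w := by ring
  have := P.valuation.map_sub_lt h hw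
  rwa [← e, map_mul, h1, mul_one] at this

theorem residues_of_small_window
    (hx : ∀ i < 3, P.valuation ((carlitzAct t)^[i] x / t) < 1)
    (hx3 : P.valuation ((carlitzAct t)^[3] x / t - 1) < 1) :
    P.valuation ((carlitzAct t)^[2] x - 1) < 1 ∧ P.valuation (t * carlitzAct t x - 1) < 1 ∧
      P.valuation (t ^ 2 * x - 1) < 1 := by
  have ht := ne_zero_of_notMem htP
  have key (z : C) : carlitzAct t z / t = z * (1 + z / t) := by
    rw [carlitzAct_apply]; field_simp; ring
  have key' (z : C) : carlitzAct t z = (t * z) * (1 + z / t) := by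
    rw [carlitzAct_apply]; field_simp; ring
  have h2 : P.valuation ((carlitzAct t)^[2] x - 1) < 1 := by
    refine valuation_sub_one_of_mul_one_add ?_ (hx 2 (by norm_num))
    rw [← key, ← Function.iterate_succ_apply' (carlitzAct t)]
    exact hx3
  have h1 : P.valuation (t * carlitzAct t x - 1) < 1 := by
    refine valuation_sub_one_of_mul_one_add ?_ (hx 1 (by norm_num))
    rw [Function.iterate_one, ← key']
    exact h2
  refine ⟨h2, h1, valuation_sub_one_of_mul_one_add ?_ (hx 0 (by norm_num))⟩
  convert h1 using 2
  rw [Function.iterate_zero, id, key' x]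
  ring

end Infinity

end CFF

namespace CFF

open Polynomial

section Gamma

variable {C : Type*} [Field C] [CharP C 2] {gam x : C}

theorem gamma_pow_two_pow (hg : gam ^ 5 + gam ^ 2 + 1 = 0) (i : ℕ) :
    (gam ^ 2 ^ i) ^ 5 + (gam ^ 2 ^ i) ^ 2 + 1 = 0 := by
  have := congrArg (iterateFrobenius C 2 i) hg
  rwa [map_add, map_add, map_pow, map_pow, map_one, map_zero, iterateFrobenius_def] at this

theorem exists_eq_gamma_pow (hg : gam ^ 5 + gam ^ 2 + 1 = 0) (hx : x ^ 5 + x ^ 2 + 1 = 0) :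
    ∃ i, x = gam ^ 2 ^ i := by
  set p : C[X] := X ^ 5 + X ^ 2 + 1 with hp
  have hdeg : p.natDegree = 5 := by rw [hp]; compute_degree!
  have hp0 : p ≠ 0 := fun H ↦ by simp [H] at hdeg
  have hroot : ∀ z, z ∈ p.roots.toFinset ↔ z ^ 5 + z ^ 2 + 1 = 0 := fun z ↦ by
    rw [Multiset.mem_toFinset, mem_roots hp0, IsRoot.def, hp]; simp
  set s : Finset C := (Finset.range 5).image fun i ↦ gam ^ 2 ^ i with hs
  have hsc : s.card = 5 := by
    rw [hs, Finset.card_image_of_injOn, Finset.card_range]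
    intro i hi j hj hij
    rw [pow_two_pow_eq_iff hg] at hij
    simp only [Finset.coe_range, Set.mem_Iio] at hi hj
    rwa [Nat.ModEq, Nat.mod_eq_of_lt hi, Nat.mod_eq_of_lt hj] at hij
  have hsub : s ⊆ p.roots.toFinset := by
    intro z hz
    obtain ⟨i, -, rfl⟩ := Finset.mem_image.1 hz
    exact (hroot _).2 (gamma_pow_two_pow hg i)
  have heq := Finset.eq_of_subset_of_card_le hsub (by
    rw [hsc, ← hdeg]
    exact (Multiset.toFinset_card_le _).trans (card_roots' p))
  have hmem := (hroot x).2 hx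
  rw [← heq] at hmem
  obtain ⟨i, -, rfl⟩ := Finset.mem_image.1 hmem
  exact ⟨i, rfl⟩

theorem five_le_natDegree_of_aeval_gamma [Algebra (ZMod 2) C] (hg : gam ^ 5 + gam ^ 2 + 1 = 0)
    {q : (ZMod 2)[X]} (hq : q ≠ 0) (h : aeval gam q = 0) : 5 ≤ q.natDegree := by
  have hi : Function.Injective (algebraMap (ZMod 2) C) := (algebraMap (ZMod 2) C).injective
  have hq0 : q.map (algebraMap (ZMod 2) C) ≠ 0 := by rwa [Polynomial.map_ne_zero_iff hi]
  have hs : (Finset.range 5).image (fun i ↦ gam ^ 2 ^ i) ⊆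
      (q.map (algebraMap (ZMod 2) C)).roots.toFinset := by
    intro z hz
    obtain ⟨i, -, rfl⟩ := Finset.mem_image.1 hz
    rw [Multiset.mem_toFinset, mem_roots hq0, IsRoot.def, eval_map_algebraMap]
    have h1 := congrArg (iterateFrobenius C 2 i) h
    rw [map_zero, aeval_def, hom_eval₂, iterateFrobenius_def] at h1
    rw [aeval_def, ← h1]
    congr 1
    exact RingHom.ext_zmod _ _
  have hsc : ((Finset.range 5).image fun i ↦ gam ^ 2 ^ i).card = 5 := by
    rw [Finset.card_image_of_injOn, Finset.card_range]
    intro i hi j hj hij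
    rw [pow_two_pow_eq_iff hg] at hij
    simp only [Finset.coe_range, Set.mem_Iio] at hi hj
    rwa [Nat.ModEq, Nat.mod_eq_of_lt hi, Nat.mod_eq_of_lt hj] at hij
  calc 5 = _ := hsc.symm
    _ ≤ _ := Finset.card_le_card hs
    _ ≤ _ := (Multiset.toFinset_card_le _).trans (card_roots' _)
    _ = _ := natDegree_map _

end Gamma

section Generators

variable (C : Type*) [Field C] [Algebra k2 C]

/-- The image of the variable `T`. -/
abbrev tC : C := algebraMap k2 C (coord true)

variable {C}

/-- `lam` is a nonzero torsion point, `gam` a generator of the constants of order 32, and they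
generate `C`. -/
structure CarlitzGen [CharP C 2] (lam gam : C) : Prop where
  torsion : IsTorsion (tC C) lam
  ne_zero : lam ≠ 0
  gam_eq : gam ^ 5 + gam ^ 2 + 1 = 0
  adjoin_eq : IntermediateField.adjoin k2 {lam, gam} = ⊤

variable [CharP C 2]

/-- The automorphism `g` maps `lam` to its Carlitz translate by `T ^ e`, and `gam` to
`gam ^ 2 ^ i`. -/
def Acts (lam gam : C) (g : C ≃ₐ[k2] C) (e i : ℕ) : Prop :=
  g lam = (carlitzAct (tC C))^[e] lam ∧ g gam = gam ^ 2 ^ i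

theorem map_carlitzAct_aut (g : C ≃ₐ[k2] C) (n : ℕ) (x : C) :
    g ((carlitzAct (tC C))^[n] x) = (carlitzAct (tC C))^[n] (g x) := by
  have := map_carlitzAct_iterate (g : C →+* C) (tC C) x n
  rwa [RingHom.coe_coe, g.commutes] at this

theorem IsTorsion.map_aut {x : C} (h : IsTorsion (tC C) x) (g : C ≃ₐ[k2] C) :
    IsTorsion (tC C) (g x) := by
  have := h.map (g : C →+* C)
  rwa [RingHom.coe_coe, g.commutes] at this

variable {lam gam : C} {g h : C ≃ₐ[k2] C} {e i e' i' : ℕ}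

namespace CarlitzGen

theorem exists_acts (hC : CarlitzGen lam gam) (g : C ≃ₐ[k2] C) : ∃ e i, Acts lam gam g e i := by
  obtain ⟨e, -, he⟩ := hC.torsion.exists_iterate hC.ne_zero (hC.torsion.map_aut g)
    (by simpa using hC.ne_zero)
  obtain ⟨i, hi⟩ := exists_eq_gamma_pow hC.gam_eq (x := g gam) (by
    have := congrArg g hC.gam_eq
    simpa using this)
  exact ⟨e, i, he, hi⟩

theorem ext (hC : CarlitzGen lam gam) (h1 : g lam = h lam) (h2 : g gam = h gam) : g = h := by
  have key : (g : C →ₐ[k2] C).comp (⊤ : IntermediateField k2 C).val =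
      (h : C →ₐ[k2] C).comp (⊤ : IntermediateField k2 C).val := by
    refine IntermediateField.algHom_ext_of_eq_adjoin k2 hC.adjoin_eq.symm fun x hx ↦ ?_
    rcases hx with rfl | rfl
    exacts [h1, h2]
  exact AlgEquiv.ext fun x ↦ DFunLike.congr_fun key ⟨x, IntermediateField.mem_top⟩

theorem eq_of_acts (hC : CarlitzGen lam gam) (hg : Acts lam gam g e i) (hh : Acts lam gam h e' i')
    (he : e ≡ e' [MOD 15]) (hi : i ≡ i' [MOD 5]) : g = h := by
  refine hC.ext ?_ ?_
  · rw [hg.1, hh.1, hC.torsion.iterate_eq_iff hC.ne_zero]; exact he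
  · rw [hg.2, hh.2, pow_two_pow_eq_iff hC.gam_eq]; exact hi

theorem modEq_of_acts (hC : CarlitzGen lam gam) (hg : Acts lam gam g e i)
    (hh : Acts lam gam g e' i') : e ≡ e' [MOD 15] ∧ i ≡ i' [MOD 5] := by
  constructor
  · rw [← hC.torsion.iterate_eq_iff hC.ne_zero, ← hg.1, hh.1]
  · rw [← pow_two_pow_eq_iff hC.gam_eq, ← hg.2, hh.2]

end CarlitzGen

theorem acts_one : Acts lam gam 1 0 0 := ⟨rfl, by simp⟩

theorem Acts.mul (hg : Acts lam gam g e i) (hh : Acts lam gam h e' i') :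
    Acts lam gam (g * h) (e + e') (i + i') := by
  constructor
  · rw [AlgEquiv.mul_apply, hh.1, map_carlitzAct_aut, hg.1, ← Function.iterate_add_apply, add_comm]
  · rw [AlgEquiv.mul_apply, hh.2, map_pow, hg.2, ← pow_mul, ← pow_add]

theorem Acts.pow (hg : Acts lam gam g e i) (n : ℕ) : Acts lam gam (g ^ n) (n * e) (n * i) := by
  induction n with
  | zero => simpa using acts_one
  | succ n ih => rw [pow_succ, add_mul, add_mul, one_mul, one_mul]; exact ih.mul hg

theorem CarlitzGen.mul_comm (hC : CarlitzGen lam gam) (g h : C ≃ₐ[k2] C) : g * h = h * g := by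
  obtain ⟨e, i, hg⟩ := hC.exists_acts g
  obtain ⟨e', i', hh⟩ := hC.exists_acts h
  exact hC.eq_of_acts (hg.mul hh) (hh.mul hg) (by rw [add_comm]) (by rw [add_comm])

end Generators

end CFF

namespace CFF

section Reduction

variable {C : Type*} [Field C] [CharP C 2] {P : ValuationSubring C} {t x gam : C}

theorem IsTorsion.residue (h : IsTorsion t x) (ht : t ∈ P) :
    IsTorsion (IsLocalRing.residue P ⟨t, ht⟩) (IsLocalRing.residue P ⟨x, h.mem ht⟩) := by
  refine IsTorsion.map _ (Subtype.ext ?_)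
  have e := map_carlitzAct_iterate P.subtype ⟨t, ht⟩ ⟨x, h.mem ht⟩ 4
  exact e.trans h

theorem IsTorsion.residue_iterate (h : IsTorsion t x) (ht : t ∈ P) (n : ℕ) :
    IsLocalRing.residue P ⟨(carlitzAct t)^[n] x, (h.iterate n).mem ht⟩ =
      (carlitzAct (IsLocalRing.residue P ⟨t, ht⟩))^[n] (IsLocalRing.residue P ⟨x, h.mem ht⟩) := by
  rw [← map_carlitzAct_iterate]
  congr 1
  exact Subtype.ext (map_carlitzAct_iterate P.subtype ⟨t, ht⟩ ⟨x, h.mem ht⟩ n).symm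

theorem IsTorsion.residue_ne_zero (h : IsTorsion t x) (hx : x ≠ 0) (ht : t ∈ P)
    (hM : ¬ P.valuation (t ^ 4 + t + 1) < 1) : IsLocalRing.residue P ⟨x, h.mem ht⟩ ≠ 0 := by
  intro H
  refine hM ?_
  set t' : P := ⟨t, ht⟩
  set x' : P := ⟨x, h.mem ht⟩
  have e : x' ^ 15 = (t' ^ 4 + t' + 1) *
    (1 + x' * ((t' ^ 4 + t') * x' ^ 6 + (t' ^ 4 + t' ^ 2) * x' ^ 2 + (t' ^ 2 + t' + 1))) :=
    Subtype.ext (h.pow_fifteen hx)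
  have e' := congrArg (IsLocalRing.residue P) e
  rw [map_pow, map_mul, map_add _ 1, map_mul _ x', H] at e'
  have e2 : IsLocalRing.residue P (t' ^ 4 + t' + 1) = 0 := by
    rw [map_one] at e'; linear_combination -e'
  exact (residue_eq_zero_iff' _).1 e2

theorem gamma_mem (P : ValuationSubring C) (hg : gam ^ 5 + gam ^ 2 + 1 = 0) : gam ∈ P := by
  have two : (2 : C) = 0 := CharTwo.two_eq_zero
  by_contra hx
  have hy := (P.mem_or_inv_mem gam).resolve_left hx
  have hx0 : gam ≠ 0 := by rintro rfl; exact hx P.zero_mem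
  have e : gam = gam⁻¹ ^ 2 + gam⁻¹ ^ 4 := by
    refine mul_left_cancel₀ (pow_ne_zero 4 hx0) ?_
    field_simp
    linear_combination hg - (gam ^ 2 + 1) * two
  rw [e] at hx
  exact hx (add_mem (pow_mem hy _) (pow_mem hy _))

theorem residue_gamma (hg : gam ^ 5 + gam ^ 2 + 1 = 0) :
    (IsLocalRing.residue P ⟨gam, gamma_mem P hg⟩) ^ 5 +
      (IsLocalRing.residue P ⟨gam, gamma_mem P hg⟩) ^ 2 + 1 = 0 := by
  rw [← map_pow, ← map_pow, ← map_one (IsLocalRing.residue P), ← map_add, ← map_add,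
    ← map_zero (IsLocalRing.residue P)]
  congr 1
  exact Subtype.ext hg

end Reduction

section Frobenius

variable {C : Type*} [Field C] [Algebra k2 C] [CharP C 2] {lam gam : C} {P : ValuationSubring C}
  {σ : C ≃ₐ[k2] C} {d e i : ℕ}

theorem modEq_of_frobenius_gamma (hC : CarlitzGen lam gam)
    (hσ : ∀ x ∈ P, P.valuation (σ x - x ^ 2 ^ d) < 1) (h : Acts lam gam σ e i) :
    d ≡ i [MOD 5] := by
  have h1 := hσ gam (gamma_mem P hC.gam_eq)
  rw [h.2] at h1
  have h2 := (residue_eq_iff (⟨gam, gamma_mem P hC.gam_eq⟩ ^ 2 ^ i)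
    (⟨gam, gamma_mem P hC.gam_eq⟩ ^ 2 ^ d : P)).2 h1
  rw [map_pow, map_pow, pow_two_pow_eq_iff (residue_gamma hC.gam_eq)] at h2
  exact h2.symm

theorem residue_pow_of_frobenius (hC : CarlitzGen lam gam) (ht : tC C ∈ P)
    (hσ : ∀ x ∈ P, P.valuation (σ x - x ^ 2 ^ d) < 1) (h : Acts lam gam σ e i) :
    (IsLocalRing.residue P ⟨lam, hC.torsion.mem ht⟩) ^ 2 ^ d =
      (carlitzAct (IsLocalRing.residue P ⟨tC C, ht⟩))^[e]
        (IsLocalRing.residue P ⟨lam, hC.torsion.mem ht⟩) := by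
  have h1 := hσ lam (hC.torsion.mem ht)
  rw [h.1] at h1
  rw [← hC.torsion.residue_iterate ht, ← map_pow, eq_comm]
  exact (residue_eq_iff _ _).2 h1

theorem valuation_lt_one_of_frobenius (hσ : ∀ x ∈ P, P.valuation (σ x - x ^ 2 ^ d) < 1) (x : C)
    (hx : P.valuation x < 1) : P.valuation (σ x) < 1 := by
  have h1 := hσ x ((P.valuation_le_one_iff x).1 hx.le)
  have h2 : P.valuation (x ^ 2 ^ d) < 1 := by
    rw [map_pow]; exact pow_lt_one' hx (by positivity)
  have h3 := P.valuation.map_add_lt h1 h2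
  rwa [sub_add_cancel] at h3

theorem modEq_zero_of_notMem (hC : CarlitzGen lam gam) (ht : tC C ∉ P)
    (hm : ∀ x, P.valuation x < 1 → P.valuation (σ x) < 1) (h : Acts lam gam σ e i) :
    e ≡ 0 [MOD 15] := by
  obtain ⟨n, hn, hn3⟩ := exists_small_window ht hC.torsion hC.ne_zero
  have hx := hC.torsion.iterate n
  have e1 := eq_of_small_window ht (hx.map_aut σ) hx (fun i hi ↦ ?_) ?_ hn hn3
  · rw [map_carlitzAct_aut, h.1, ← Function.iterate_add_apply,
      hC.torsion.iterate_eq_iff hC.ne_zero] at e1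
    exact Nat.ModEq.add_left_cancel' n e1
  · have := hm _ (hn i hi)
    rwa [map_div₀, map_carlitzAct_aut, σ.commutes] at this
  · have := hm _ hn3
    rwa [map_sub, map_div₀, map_carlitzAct_aut, σ.commutes, map_one] at this

end Frobenius

end CFF

namespace CFF

open Polynomial

theorem evc_X_add_C {K : Type*} [Field K] [Algebra k2 K] (b : Bool) (c : ZMod 2) :
    evc K b (X + C c) = algebraMap k2 K (coord b) + algebraMap k2 K (algebraMap (ZMod 2) k2 c) := by
  simp [evc_apply]

theorem exists_place_k2 (b : Bool) (c : ZMod 2) : ∃ p : Place (ZMod 2) k2,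
    p.1.valuation (coord b + algebraMap (ZMod 2) k2 c) < 1 ∧ placeDegree (ZMod 2) p = 1 := by
  have hni : ¬ IsIntegral (ZMod 2) (coord b + algebraMap (ZMod 2) k2 c) := by
    intro h
    have := h.sub (isIntegral_algebraMap (x := c))
    rw [add_sub_cancel_right] at this
    exact transcendental_coord b this.isAlgebraic
  obtain ⟨p, hp⟩ := exists_valuation_lt_one hni
  refine ⟨p, hp, ?_⟩
  have hc : algebraMap (ZMod 2) k2 c ∈ p.1 := p.2.2 c
  have hb : algebraMap k2 k2 (coord b) ∈ p.1 := by
    have := sub_mem ((p.1.valuation_le_one_iff _).1 hp.le) hc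
    rwa [add_sub_cancel_right] at this
  have hv : p.1.valuation (evc k2 b (X + C c)) < 1 := by
    rw [evc_X_add_C]; exact hp
  have h1 := ordAt_mul_placeDegree_le (irreducible_of_degree_eq_one (degree_X_add_C c)) hb hv
  rw [natDegree_X_add_C, Module.finrank_self, Nat.cast_one, mul_one] at h1
  have h2 := one_le_ordAt_of_valuation_lt_one (evc_ne_zero (X_add_C_ne_zero c)) hv
  have h3 := placeDegree_pos' p
  zify at h3 ⊢
  nlinarith

section Frobenius

variable {C : Type*} [Field C] [Algebra k2 C] [CharP C 2]
  [FiniteDimensional k2 C] [IsGalois k2 C] [Algebra (ZMod 2) C] {lam gam : C}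

/-- `φ` is a Frobenius automorphism of degree one at `P`, acting on torsion by `T ^ a`. -/
structure IsFrob (lam gam : C) (a : ℕ) (P : ValuationSubring C) (φ : C ≃ₐ[k2] C) : Prop where
  acts : Acts lam gam φ a 1
  frob : ∀ x ∈ P, P.valuation (φ x - x ^ 2) < 1

theorem exists_isFrob_aux (hC : CarlitzGen lam gam) (b : Bool) (c : ZMod 2) :
    ∃ (P : Place (ZMod 2) C) (φ : C ≃ₐ[k2] C) (e : ℕ),
      P.1.valuation (algebraMap k2 C (coord b) + algebraMap (ZMod 2) C c) < 1 ∧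
      Acts lam gam φ e 1 ∧ ∀ x ∈ P.1, P.1.valuation (φ x - x ^ 2) < 1 := by
  obtain ⟨p, hp, hd⟩ := exists_place_k2 b c
  obtain ⟨P, hP⟩ := exists_place_above C p
  obtain ⟨φ, hφ⟩ := exists_frobenius_above hP
  obtain ⟨e, i, ha⟩ := hC.exists_acts φ
  have hi := modEq_of_frobenius_gamma hC hφ ha
  refine ⟨P, φ, e, ?_, ⟨ha.1, ?_⟩, ?_⟩
  · rw [← valuation_lt_one_iff_of_comap hP, map_add] at hp
    convert hp using 3
    exact DFunLike.congr_fun (RingHom.ext_zmod (algebraMap (ZMod 2) C)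
      ((algebraMap k2 C).comp (algebraMap (ZMod 2) k2))) c
  · rw [ha.2, pow_two_pow_eq_iff hC.gam_eq, ← hd]
    exact hi.symm
  · simpa [hd] using hφ

theorem exists_isFrob_infty (hC : CarlitzGen lam gam) :
    ∃ (P : Place (ZMod 2) C) (φ : C ≃ₐ[k2] C), tC C ∉ P.1 ∧ IsFrob lam gam 0 P.1 φ := by
  obtain ⟨P, φ, e, hv, ha, hφ⟩ := exists_isFrob_aux hC false 0
  rw [map_zero, add_zero, ← coord_not_mem_iff] at hv
  have he := modEq_zero_of_notMem hC hv
    (valuation_lt_one_of_frobenius (d := 1) (by simpa using hφ)) ha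
  refine ⟨P, φ, hv, ⟨?_, ha.2⟩, hφ⟩
  rw [ha.1, hC.torsion.iterate_eq_iff hC.ne_zero]
  exact he

theorem exists_isFrob_zero (hC : CarlitzGen lam gam) :
    ∃ (P : Place (ZMod 2) C) (φ : C ≃ₐ[k2] C), P.1.valuation (tC C) < 1 ∧
      IsFrob lam gam 1 P.1 φ := by
  obtain ⟨P, φ, e, hv, ha, hφ⟩ := exists_isFrob_aux hC true 0
  rw [map_zero, add_zero] at hv
  have ht : tC C ∈ P.1 := (P.1.valuation_le_one_iff _).1 hv.le
  have hM : ¬ P.1.valuation (tC C ^ 4 + tC C + 1) < 1 := by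
    intro h
    have h1 : P.1.valuation (tC C ^ 4) < 1 := by
      rw [map_pow]; exact pow_lt_one' hv (by norm_num)
    have h2 := P.1.valuation.map_sub_lt h (P.1.valuation.map_add_lt h1 hv)
    simp at h2
  have h1 := residue_pow_of_frobenius (d := 1) hC ht (by simpa using hφ) ha
  have hr := hC.torsion.residue ht
  have h2 : IsLocalRing.residue P.1 ⟨tC C, ht⟩ = 0 := (residue_eq_zero_iff' _).2 hv
  rw [pow_one, sq_eq_carlitzAct_of_eq_zero h2,
    hr.iterate_eq_iff (hC.torsion.residue_ne_zero hC.ne_zero ht hM)] at h1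
  refine ⟨P, φ, hv, ⟨?_, ha.2⟩, hφ⟩
  rw [ha.1, hC.torsion.iterate_eq_iff hC.ne_zero]
  exact h1.symm

theorem exists_isFrob_one (hC : CarlitzGen lam gam) :
    ∃ (P : Place (ZMod 2) C) (φ : C ≃ₐ[k2] C), P.1.valuation (tC C + 1) < 1 ∧
      IsFrob lam gam 4 P.1 φ := by
  obtain ⟨P, φ, e, hv, ha, hφ⟩ := exists_isFrob_aux hC true 1
  rw [map_one] at hv
  have ht : tC C ∈ P.1 := by
    have := sub_mem ((P.1.valuation_le_one_iff _).1 hv.le) (one_mem P.1)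
    rwa [add_sub_cancel_right] at this
  have hM : ¬ P.1.valuation (tC C ^ 4 + tC C + 1) < 1 := by
    intro h
    have h1 : P.1.valuation (tC C ^ 4 + 1) < 1 := by
      have : tC C ^ 4 + 1 = (tC C + 1) ^ 4 := by
        have := add_pow_char_pow (p := 2) (n := 2) (tC C) 1
        simpa using this.symm
      rw [this, map_pow]; exact pow_lt_one' hv (by norm_num)
    have h2 := P.1.valuation.map_sub_lt (P.1.valuation.map_add_lt h1 hv) h
    have e : tC C ^ 4 + 1 + (tC C + 1) - (tC C ^ 4 + tC C + 1) = 1 := by ring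
    rw [e, map_one] at h2
    exact lt_irrefl _ h2
  have h1 := residue_pow_of_frobenius (d := 1) hC ht (by simpa using hφ) ha
  have hr := hC.torsion.residue ht
  have h2 : IsLocalRing.residue P.1 ⟨tC C, ht⟩ = 1 := by
    rw [← map_one (IsLocalRing.residue P.1), residue_eq_iff]
    change P.1.valuation (tC C - 1) < 1
    rwa [CharTwo.sub_eq_add]
  rw [pow_one, hr.sq_eq_of_eq_one h2,
    hr.iterate_eq_iff (hC.torsion.residue_ne_zero hC.ne_zero ht hM)] at h1
  refine ⟨P, φ, hv, ⟨?_, ha.2⟩, hφ⟩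
  rw [ha.1, hC.torsion.iterate_eq_iff hC.ne_zero]
  exact h1.symm

theorem CarlitzGen.exists_acts_eq (hC : CarlitzGen lam gam) (e i : ℕ) :
    ∃ g : C ≃ₐ[k2] C, Acts lam gam g e i := by
  obtain ⟨_, φ, _, h⟩ := exists_isFrob_zero hC
  obtain ⟨_, ψ, _, h'⟩ := exists_isFrob_infty hC
  refine ⟨φ ^ e * ψ ^ (4 * e + i), ?_⟩
  have := (h.acts.pow e).mul (h'.acts.pow (4 * e + i))
  refine ⟨?_, ?_⟩
  · rw [this.1]; simp
  · rw [this.2, pow_two_pow_eq_iff hC.gam_eq, Nat.ModEq]; omega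

theorem CarlitzGen.finrank_eq (hC : CarlitzGen lam gam) : Module.finrank k2 C = 75 := by
  rw [← IsGalois.card_aut_eq_finrank]
  choose f hf using hC.exists_acts_eq
  have hb : Function.Bijective fun x : Fin 15 × Fin 5 ↦ f x.1 x.2 := by
    constructor
    · rintro ⟨a, b⟩ ⟨a', b'⟩ h
      have h1 := hf a b
      have h2 : f a b = f a' b' := h
      rw [h2] at h1
      obtain ⟨h3, h4⟩ := hC.modEq_of_acts h1 (hf a' b')
      rw [Nat.ModEq, Nat.mod_eq_of_lt a.2, Nat.mod_eq_of_lt a'.2] at h3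
      rw [Nat.ModEq, Nat.mod_eq_of_lt b.2, Nat.mod_eq_of_lt b'.2] at h4
      exact Prod.ext (Fin.ext h3) (Fin.ext h4)
    · intro g
      obtain ⟨e, i, hg⟩ := hC.exists_acts g
      refine ⟨(⟨e % 15, Nat.mod_lt _ (by norm_num)⟩, ⟨i % 5, Nat.mod_lt _ (by norm_num)⟩), ?_⟩
      exact hC.eq_of_acts (hf _ _) hg (Nat.mod_modEq _ _) (Nat.mod_modEq _ _)
  rw [← Nat.card_eq_of_bijective _ hb]
  simp

end Frobenius

end CFF

namespace CFF
open Polynomial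

theorem exists_eq_pow_of_ringHom {k : Type*} [Field k] [Finite k] [CharP k 2] (f : k →+* k) :
    ∃ d, ∀ x, f x = x ^ 2 ^ d := by
  let _ := ZMod.algebra k 2
  let f' : k →ₐ[ZMod 2] k := { f with
    commutes' := fun r ↦ DFunLike.congr_fun
      (RingHom.ext_zmod (f.comp (algebraMap (ZMod 2) k)) (algebraMap (ZMod 2) k)) r }
  obtain ⟨d, hd⟩ := (FiniteField.bijective_frobeniusAlgHom_pow (ZMod 2) k).2 f'
  refine ⟨d, fun x ↦ ?_⟩
  have := DFunLike.congr_fun hd x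
  change f' x = _
  rw [← this]
  simp [FiniteField.coe_frobeniusAlgHom, pow_iterate, ZMod.card]

theorem irreducible_M0 : Irreducible M0 := by
  have hdeg : M0.natDegree = 4 := by rw [M0]; compute_degree!
  have hmon : M0.Monic := by rw [M0]; monicity!
  have h0 : ∀ c : ZMod 2, c = 0 ∨ c = 1 := by decide
  rw [hmon.irreducible_iff_lt_natDegree_lt (by rintro h; simp [h] at hdeg)]
  intro q hq hmem ⟨r, hr⟩
  rw [hdeg, Finset.mem_Ioc] at hmem
  have : Nontrivial (AdjoinRoot q) :=
    AdjoinRoot.nontrivial q (by rw [degree_eq_natDegree hq.ne_zero]; exact_mod_cast hmem.1.ne')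
  have hr1 : (AdjoinRoot.root q) ^ 4 + AdjoinRoot.root q + 1 = 0 := by
    have := congrArg (AdjoinRoot.mk q) hr
    rw [map_mul, AdjoinRoot.mk_self, zero_mul, M0] at this
    simpa using this
  have hr2 : eval₂ (AdjoinRoot.of q) (AdjoinRoot.root q) q = 0 := AdjoinRoot.eval₂_root q
  have two : (2 : AdjoinRoot q) = 0 := by
    have := congrArg (AdjoinRoot.of q) (CharTwo.two_eq_zero (R := ZMod 2))
    rwa [map_ofNat, map_zero] at this
  generalize AdjoinRoot.root q = x at hr1 hr2
  have hone : (1 : AdjoinRoot q) ≠ 0 := one_ne_zero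
  rw [eval₂_eq_sum_range] at hr2
  have hlead := hq.coeff_natDegree
  obtain h1 | h1 : q.natDegree = 1 ∨ q.natDegree = 2 := by omega
  · rw [h1] at hr2 hlead
    simp only [Finset.sum_range_succ, Finset.sum_range_zero, hlead, map_one] at hr2
    refine hone ?_
    rcases h0 (q.coeff 0) with h | h <;> simp only [h, map_zero, map_one] at hr2
    · linear_combination hr1 - (x ^ 3 + 1) * hr2
    · linear_combination hr1 - (x ^ 3 - x ^ 2 + x) * hr2
  · rw [h1] at hr2 hlead
    simp only [Finset.sum_range_succ, Finset.sum_range_zero, hlead, map_one] at hr2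
    refine hone ?_
    rcases h0 (q.coeff 0) with h | h <;> rcases h0 (q.coeff 1) with h' | h' <;>
      simp only [h, h', map_zero, map_one] at hr2 <;> clear hlead h h' <;> grind

theorem evc_M0 {K : Type*} [Field K] [Algebra k2 K] :
    evc K true M0 = algebraMap k2 K (coord true) ^ 4 + algebraMap k2 K (coord true) + 1 := by
  simp [evc_apply, M0]

section Stable

variable {C : Type*} [Field C] [Algebra k2 C] [CharP C 2]
  [FiniteDimensional k2 C] [IsGalois k2 C] [Algebra (ZMod 2) C] {lam gam : C}
  {P : Place (ZMod 2) C}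

theorem valuation_lt_one_of_stable {P : ValuationSubring C} {g : C ≃ₐ[k2] C}
    (hg : ∀ x, x ∈ P ↔ g x ∈ P) (x : C) (hx : P.valuation x < 1) : P.valuation (g x) < 1 := by
  by_cases h0 : x = 0
  · simp [h0]
  · rw [valuation_lt_one_iff_inv_notMem _ h0] at hx
    rwa [valuation_lt_one_iff_inv_notMem _ (by simpa using h0), ← map_inv₀, ← hg]

theorem exists_frobenius_pow_of_stable {g : C ≃ₐ[k2] C} (hg : ∀ x, x ∈ P.1 ↔ g x ∈ P.1) :
    ∃ d, ∀ x ∈ P.1, P.1.valuation (g x - x ^ 2 ^ d) < 1 := by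
  let G : P.1 →+* P.1 := (g : C →+* C).restrict P.1 P.1 fun x hx ↦ (hg x).1 hx
  have hG : ∀ x ∈ IsLocalRing.maximalIdeal P.1,
      ((IsLocalRing.residue P.1).comp G) x = 0 := by
    intro x hx
    rw [mem_maximalIdeal_iff] at hx
    exact (residue_eq_zero_iff' _).2 (valuation_lt_one_of_stable hg _ hx)
  let f : IsLocalRing.ResidueField P.1 →+* IsLocalRing.ResidueField P.1 :=
    Ideal.Quotient.lift _ _ hG
  obtain ⟨d, hd⟩ := exists_eq_pow_of_ringHom f
  refine ⟨d, fun x hx ↦ ?_⟩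
  have h1 : IsLocalRing.residue P.1 (G ⟨x, hx⟩) = (IsLocalRing.residue P.1 ⟨x, hx⟩) ^ 2 ^ d :=
    hd (IsLocalRing.residue P.1 ⟨x, hx⟩)
  rw [← map_pow] at h1
  exact (residue_eq_iff _ _).1 h1

theorem frobenius_pow {P : ValuationSubring C} {φ : C ≃ₐ[k2] C}
    (hφ : ∀ x ∈ P, P.valuation (φ x - x ^ 2) < 1) (d : ℕ) :
    ∀ x ∈ P, P.valuation ((φ ^ d) x - x ^ 2 ^ d) < 1 := by
  have hst : ∀ x ∈ P, φ x ∈ P := fun x hx ↦ by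
    have := add_mem ((P.valuation_le_one_iff _).1 (hφ x hx).le) (pow_mem hx 2)
    rwa [sub_add_cancel] at this
  induction d with
  | zero => intro x _; simp
  | succ d ih =>
    intro x hx
    have h1 := ih _ (hst x hx)
    have h2 : P.valuation ((φ x) ^ 2 ^ d - (x ^ 2) ^ 2 ^ d) < 1 := by
      rw [← sub_pow_char_pow (p := 2), map_pow]
      exact pow_lt_one' (hφ x hx) (by positivity)
    have h3 := P.valuation.map_add_lt h1 h2
    rwa [sub_add_sub_cancel, ← pow_mul, ← pow_succ'] at h3

theorem IsFrob.exists_eq_pow {a : ℕ} {φ g : C ≃ₐ[k2] C} (hC : CarlitzGen lam gam)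
    (hφ : IsFrob lam gam a P.1 φ) (hM : ¬ P.1.valuation (tC C ^ 4 + tC C + 1) < 1)
    (hg : ∀ x, x ∈ P.1 ↔ g x ∈ P.1) : ∃ d, g = φ ^ d := by
  obtain ⟨d, hd⟩ := exists_frobenius_pow_of_stable hg
  refine ⟨d, ?_⟩
  obtain ⟨e, i, ha⟩ := hC.exists_acts g
  have hφd := frobenius_pow hφ.frob d
  have had := hφ.acts.pow d
  have h1 := modEq_of_frobenius_gamma hC hd ha
  have h2 := modEq_of_frobenius_gamma hC hφd had
  refine hC.eq_of_acts ha had ?_ (h1.symm.trans h2)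
  by_cases ht : tC C ∈ P.1
  · have h3 := residue_pow_of_frobenius hC ht hd ha
    rw [residue_pow_of_frobenius hC ht hφd had] at h3
    rw [(hC.torsion.residue ht).iterate_eq_iff
      (hC.torsion.residue_ne_zero hC.ne_zero ht hM)] at h3
    exact h3.symm
  · exact (modEq_zero_of_notMem hC ht (valuation_lt_one_of_frobenius hd) ha).trans
      (modEq_zero_of_notMem hC ht (valuation_lt_one_of_frobenius hφd) had).symm

theorem tC_mem_of_valuation_lt_one {P : ValuationSubring C}
    (h : P.valuation (tC C ^ 4 + tC C + 1) < 1) : tC C ∈ P := by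
  by_contra ht
  have hi := (P.mem_or_inv_mem (tC C)).resolve_left ht
  have h0 : tC C ≠ 0 := fun H ↦ ht (H ▸ P.zero_mem)
  have hv := inv_mem_of_notMem ht
  refine ht ?_
  have e : tC C = (tC C ^ 4 + tC C + 1) * (tC C)⁻¹ ^ 3 - (tC C)⁻¹ ^ 2 - (tC C)⁻¹ ^ 3 := by
    field_simp; ring
  rw [e]
  exact sub_mem (sub_mem (mul_mem ((P.valuation_le_one_iff _).1 h.le) (pow_mem hi _))
    (pow_mem hi _)) (pow_mem hi _)

theorem five_dvd_placeDegree {K : Type*} [Field K] [Algebra k2 K] [CharP K 2]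
    [FiniteDimensional k2 K] [Algebra.IsSeparable k2 K] [Algebra (ZMod 2) K] {gam : K}
    (hg : gam ^ 5 + gam ^ 2 + 1 = 0) (P : Place (ZMod 2) K) : 5 ∣ placeDegree (ZMod 2) P := by
  have h1 := residue_gamma (P := P.1) hg
  have : (IsLocalRing.residue P.1 ⟨gam, gamma_mem P.1 hg⟩) ^ 2 ^ placeDegree (ZMod 2) P =
      (IsLocalRing.residue P.1 ⟨gam, gamma_mem P.1 hg⟩) ^ 2 ^ 0 := by
    rw [← natCard_residueField, pow_zero, pow_one]
    let _ := Fintype.ofFinite (IsLocalRing.ResidueField P.1)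
    rw [Nat.card_eq_fintype_card, FiniteField.pow_card]
  rw [pow_two_pow_eq_iff h1] at this
  exact (Nat.modEq_zero_iff_dvd).1 this

theorem placeDegree_eq_of_valuation_M0 (hC : CarlitzGen lam gam)
    (hM : P.1.valuation (tC C ^ 4 + tC C + 1) < 1) : placeDegree (ZMod 2) P = 20 ∧
      ∀ Q : Place (ZMod 2) C, Q.1.valuation (tC C ^ 4 + tC C + 1) < 1 → Q = P := by
  have ht := tC_mem_of_valuation_lt_one hM
  have hdeg : M0.natDegree = 4 := by rw [M0]; compute_degree!
  have hv : P.1.valuation (evc C true M0) < 1 := by rw [evc_M0]; exact hM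
  have h4 := natDegree_dvd_placeDegree P ht irreducible_M0 hv
  rw [hdeg] at h4
  have h5 := five_dvd_placeDegree hC.gam_eq P
  have h20 : 20 ∣ placeDegree (ZMod 2) P :=
    (show Nat.Coprime 4 5 by norm_num).mul_dvd_of_dvd_of_dvd h4 h5
  have hpos := placeDegree_pos' P
  have hlam := hC.torsion.mem ht
  have e15 := hC.torsion.pow_fifteen hC.ne_zero
  set u := (tC C ^ 4 + tC C) * lam ^ 6 + (tC C ^ 4 + tC C ^ 2) * lam ^ 2 +
    (tC C ^ 2 + tC C + 1) with hu
  have hum : u ∈ P.1 := by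
    rw [hu]
    exact add_mem (add_mem (mul_mem (add_mem (pow_mem ht _) ht) (pow_mem hlam _))
      (mul_mem (add_mem (pow_mem ht _) (pow_mem ht _)) (pow_mem hlam _)))
      (add_mem (add_mem (pow_mem ht _) ht) (one_mem _))
  have hlam1 : P.1.valuation lam < 1 := by
    by_contra hl
    have h1 : P.1.valuation (lam ^ 15) < 1 := by
      rw [e15, map_mul]
      exact mul_lt_one_of_lt_of_le hM ((P.1.valuation_le_one_iff _).2
        (add_mem (one_mem _) (mul_mem hlam hum)))
    rw [map_pow] at h1
    exact absurd (one_le_pow_of_one_le' (not_lt.1 hl) 15) (not_le.2 h1)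
  have hunit : P.1.valuation (1 + lam * u) = 1 := by
    have : P.1.valuation (lam * u) < P.1.valuation 1 := by
      rw [map_one, map_mul]
      exact mul_lt_one_of_lt_of_le hlam1 ((P.1.valuation_le_one_iff _).2 hum)
    rw [P.1.valuation.map_add_eq_of_lt_left this, map_one]
  have hM0 : tC C ^ 4 + tC C + 1 ≠ 0 := by
    intro H; rw [H, zero_mul] at e15; exact pow_ne_zero 15 hC.ne_zero e15
  have hu0 : 1 + lam * u ≠ 0 := by
    intro H; rw [H, map_zero] at hunit; exact zero_ne_one hunit
  have hord : ordAt P.1 (tC C ^ 4 + tC C + 1) = 15 * ordAt P.1 lam := by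
    have h1 := congrArg (ordAt P.1) e15
    rw [ordAt_pow hC.ne_zero, ordAt_mul hM0 hu0, (valuation_eq_one_iff_ordAt hu0).1 hunit] at h1
    push_cast at h1
    linarith
  have hl1 := (valuation_lt_one_iff_ordAt hC.ne_zero).1 hlam1
  have hle := ordAt_mul_placeDegree_le irreducible_M0 ht hv
  rw [hC.finrank_eq, hdeg] at hle
  rw [evc_M0, hord] at hle
  obtain ⟨m, hm⟩ := h20
  have hm1 : m = 1 := by
    have : 0 < m := by omega
    by_contra hne
    have h2 : 2 ≤ m := by omega
    rw [hm] at hle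
    push_cast at hle
    zify at h2
    nlinarith
  have hd : placeDegree (ZMod 2) P = 20 := by rw [hm, hm1]
  refine ⟨hd, fun Q hQ ↦ eq_of_le_ordAt_mul_placeDegree irreducible_M0 ht hv
    (tC_mem_of_valuation_lt_one hQ) (by rw [evc_M0]; exact hQ) ?_⟩
  rw [hC.finrank_eq, hdeg, hd, evc_M0, hord]
  push_cast
  linarith

theorem four_dvd_of_pow_eq {k : Type*} [Field k] [CharP k 2] {t : k} (ht : t ^ 4 + t + 1 = 0)
    {d : ℕ} (h : t ^ 2 ^ d = t) : 4 ∣ d := by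
  have two : (2 : k) = 0 := CharTwo.two_eq_zero
  have h4 : t ^ 4 = t + 1 := by linear_combination ht - (t + 1) * two
  have h8 : t ^ 8 = t ^ 2 + 1 := by linear_combination (t ^ 4 + t + 1) * h4 + t * two
  have h16 : t ^ 16 = t := by linear_combination (t ^ 8 + t ^ 2 + 1) * h8 + h4 + (t ^ 2 + 1) * two
  have hq : ∀ q, t ^ 2 ^ (4 * q) = t := by
    intro q
    induction q with
    | zero => simp
    | succ q ih => rw [mul_add, pow_add, pow_mul, ih]; exact h16
  have hone : (1 : k) ≠ 0 := one_ne_zero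
  rw [← Nat.div_add_mod d 4, pow_add, pow_mul, hq] at h
  have hlt := Nat.mod_lt d (show 4 > 0 by norm_num)
  rw [Nat.dvd_iff_mod_eq_zero]
  by_contra hne
  obtain hr | hr | hr : d % 4 = 1 ∨ d % 4 = 2 ∨ d % 4 = 3 := by omega
  all_goals rw [hr] at h; norm_num at h; refine hone ?_; clear hq hone hne hlt hr; grind

theorem valuation_sub_lt_one_of_acts (hC : CarlitzGen lam gam)
    (hM : P.1.valuation (tC C ^ 4 + tC C + 1) < 1) {g : C ≃ₐ[k2] C} {e : ℕ}
    (ha : Acts lam gam g e 0) (hg : ∀ x, x ∈ P.1 ↔ g x ∈ P.1) :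
    ∀ x ∈ P.1, P.1.valuation (g x - x) < 1 := by
  obtain ⟨d, hd⟩ := exists_frobenius_pow_of_stable hg
  have h5 : 5 ∣ d := (Nat.modEq_zero_iff_dvd).1 (modEq_of_frobenius_gamma hC hd ha)
  have ht := tC_mem_of_valuation_lt_one hM
  have h4 : 4 ∣ d := by
    refine four_dvd_of_pow_eq (t := IsLocalRing.residue P.1 ⟨tC C, ht⟩) ?_ ?_
    · rw [← map_pow, ← map_one (IsLocalRing.residue P.1), ← map_add, ← map_add]
      exact (residue_eq_zero_iff' _).2 hM
    · rw [← map_pow]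
      have := hd _ ht
      rw [g.commutes, P.1.valuation.map_sub_swap] at this
      exact (residue_eq_iff _ _).2 this
  obtain ⟨q, rfl⟩ : 20 ∣ d := (show Nat.Coprime 4 5 by norm_num).mul_dvd_of_dvd_of_dvd h4 h5
  intro x hx
  have h1 := (residue_eq_iff (⟨g x, (hg x).1 hx⟩ : P.1) (⟨x, hx⟩ ^ 2 ^ (20 * q))).2 (hd x hx)
  rw [map_pow, pow_mul, ← (placeDegree_eq_of_valuation_M0 hC hM).1, ← natCard_residueField] at h1
  let _ := Fintype.ofFinite (IsLocalRing.ResidueField P.1)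
  rw [Nat.card_eq_fintype_card, FiniteField.pow_card_pow] at h1
  exact (residue_eq_iff _ _).1 h1

end Stable

end CFF

namespace CFF
open Polynomial

section FixedBy

variable {K C : Type*} [Field K] [Algebra k2 K] [FiniteDimensional k2 K]
  [Algebra.IsSeparable k2 K] [Algebra (ZMod 2) K] [Field C] [Algebra k2 C] [Algebra K C]
  [IsScalarTower k2 K C] [FiniteDimensional k2 C] [IsGalois k2 C] [Algebra (ZMod 2) C]
  [CharP C 2] [CharP K 2] {lam gam : C} {ρ : C ≃ₐ[k2] C}

variable (K) in
/-- `K` is the fixed field of the automorphism `ρ` of `C`. -/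
structure FixedBy (ρ : C ≃ₐ[k2] C) : Prop where
  apply_algebraMap : ∀ z, ρ (algebraMap K C z) = algebraMap K C z
  mem_range : ∀ y, ρ y = y → ∃ z, algebraMap K C z = y
  exists_pow : ∀ g : C ≃ₐ[K] C, ∃ n : ℕ, g.restrictScalars k2 = ρ ^ n

theorem algebraMap_tC : algebraMap K C (tC K) = tC C :=
  (IsScalarTower.algebraMap_apply k2 K C _).symm

theorem exists_acts_frobenius (hK : FixedBy K ρ) (hρ : Acts lam gam ρ 1 2)
    {p : Place (ZMod 2) K} {P : Place (ZMod 2) C} (h : P.1.comap (algebraMap K C) = p.1) :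
    ∃ (φ : C ≃ₐ[k2] C) (n : ℕ), Acts lam gam φ n (2 * n) ∧
      ∀ x ∈ P.1, P.1.valuation (φ x - x ^ 2 ^ placeDegree (ZMod 2) p) < 1 := by
  obtain ⟨σ, hσ⟩ := exists_frobenius_above h
  obtain ⟨n, hn⟩ := hK.exists_pow σ
  refine ⟨ρ ^ n, n, ?_, ?_⟩
  · have := hρ.pow n
    rwa [mul_one, mul_comm n 2] at this
  · rw [← hn]; exact hσ

theorem five_dvd_placeDegree_of_fixedBy (hC : CarlitzGen lam gam) (hK : FixedBy K ρ)
    (hρ : Acts lam gam ρ 1 2) {p : Place (ZMod 2) K} (ht : tC K ∉ p.1) :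
    5 ∣ placeDegree (ZMod 2) p := by
  obtain ⟨P, hP⟩ := exists_place_above C p
  obtain ⟨φ, n, ha, hφ⟩ := exists_acts_frobenius hK hρ hP
  have h1 := modEq_of_frobenius_gamma hC hφ ha
  have ht' : tC C ∉ P.1 := by
    rwa [← algebraMap_tC (K := K), mem_iff_of_comap hP]
  have h2 := modEq_zero_of_notMem hC ht' (valuation_lt_one_of_frobenius hφ) ha
  rw [Nat.ModEq] at h1 h2
  omega

theorem five_le_placeDegree_of_fixedBy (hC : CarlitzGen lam gam) (hK : FixedBy K ρ)
    (hρ : Acts lam gam ρ 1 2) {p : Place (ZMod 2) K}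
    (hM : ¬ p.1.valuation (tC K ^ 4 + tC K + 1) < 1) : 5 ≤ placeDegree (ZMod 2) p := by
  by_cases ht : tC K ∈ p.1
  swap
  · exact Nat.le_of_dvd (placeDegree_pos' p) (five_dvd_placeDegree_of_fixedBy hC hK hρ ht)
  obtain ⟨P, hP⟩ := exists_place_above C p
  obtain ⟨φ, n, ha, hφ⟩ := exists_acts_frobenius hK hρ hP
  have h1 := modEq_of_frobenius_gamma hC hφ ha
  have ht' : tC C ∈ P.1 := by
    rwa [← algebraMap_tC (K := K), mem_iff_of_comap hP]
  have hM' : ¬ P.1.valuation (tC C ^ 4 + tC C + 1) < 1 := by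
    rw [← valuation_lt_one_iff_of_comap hP] at hM
    simpa [← algebraMap_tC (K := K) (C := C)] using hM
  by_contra! hlt
  have hr := hC.torsion.residue ht'
  have h2 := residue_pow_of_frobenius hC ht' hφ ha
  obtain ⟨e, he, hne⟩ := hr.exists_pow_eq (placeDegree_pos' p) (by omega) (by
    rw [← map_pow]
    have := hφ _ ht'
    rw [φ.commutes, P.1.valuation.map_sub_swap] at this
    exact (residue_eq_iff _ _).2 this) (by
    intro H
    refine hM' ?_
    rw [← map_pow, ← map_one (IsLocalRing.residue P.1), ← map_add, ← map_add] at H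
    exact (residue_eq_zero_iff' _).1 H)
  rw [h2, hr.iterate_eq_iff (hC.torsion.residue_ne_zero hC.ne_zero ht' hM')] at he
  refine hne ?_
  rw [Nat.ModEq] at h1 he ⊢
  omega

theorem valuation_M0_comap {p : Place (ZMod 2) K} {P : Place (ZMod 2) C}
    (h : P.1.comap (algebraMap K C) = p.1) : P.1.valuation (tC C ^ 4 + tC C + 1) < 1 ↔
      p.1.valuation (tC K ^ 4 + tC K + 1) < 1 := by
  rw [← valuation_lt_one_iff_of_comap h]
  simp [← algebraMap_tC (K := K) (C := C)]

theorem placeDegree_eq_four_of_fixedBy (hC : CarlitzGen lam gam) (hK : FixedBy K ρ)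
    (hρ : Acts lam gam ρ 1 2) {p : Place (ZMod 2) K}
    (hM : p.1.valuation (tC K ^ 4 + tC K + 1) < 1) : placeDegree (ZMod 2) p = 4 := by
  obtain ⟨P, hP⟩ := exists_place_above C p
  have hM' := (valuation_M0_comap hP).2 hM
  obtain ⟨hd, -⟩ := placeDegree_eq_of_valuation_M0 hC hM'
  have hdvd := placeDegree_dvd_of_comap hP
  have ht := (mem_iff_of_comap hP (tC K)).1 (by
    rw [algebraMap_tC]; exact tC_mem_of_valuation_lt_one hM')
  have h4 := natDegree_dvd_placeDegree p ht irreducible_M0 (by rw [evc_M0]; exact hM)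
  have hdeg : M0.natDegree = 4 := by rw [M0]; compute_degree!
  rw [hdeg] at h4
  rw [hd] at hdvd
  have hle := Nat.le_of_dvd (by norm_num) hdvd
  by_contra hne
  have h20 : placeDegree (ZMod 2) p = 20 := by
    obtain ⟨m, hm⟩ := h4
    rw [hm] at hdvd hne hle ⊢
    have : m ∣ 5 := by
      rw [show 20 = 4 * 5 by norm_num] at hdvd
      exact Nat.dvd_of_mul_dvd_mul_left (by norm_num) hdvd
    rcases (Nat.dvd_prime (by norm_num)).1 this with h | h <;> omega
  obtain ⟨y, hy, hv⟩ := exists_of_placeDegree_eq hP (h20.trans hd.symm) (gamma_mem P.1 hC.gam_eq)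
  have hst : ∀ x, x ∈ P.1 ↔ ρ x ∈ P.1 := by
    have huniq := (placeDegree_eq_of_valuation_M0 hC hM').2
      ⟨P.1.comap (ρ : C →+* C), isPlace_of_ne_top fun H ↦ P.2.1 ?_⟩ ?_
    · intro x
      have := congrArg (fun q : Place (ZMod 2) C ↦ x ∈ q.1) huniq
      exact (iff_of_eq this).symm
    · refine eq_top_iff.2 fun x _ ↦ ?_
      have : ρ.symm x ∈ P.1.comap (ρ : C →+* C) := H ▸ ValuationSubring.mem_top _
      simpa using this
    · rw [valuation_comap_lt_one]
      simpa [ρ.commutes] using hM'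
  have h1 := valuation_lt_one_of_stable hst _ hv
  rw [map_sub, hρ.2, hK.apply_algebraMap] at h1
  have h2 := P.1.valuation.map_sub_lt h1 hv
  rw [sub_sub_sub_cancel_right] at h2
  have h3 := (residue_eq_iff (⟨gam, gamma_mem P.1 hC.gam_eq⟩ ^ 2 ^ 2)
    (⟨gam, gamma_mem P.1 hC.gam_eq⟩ ^ 2 ^ 0 : P.1)).2 (by simpa using h2)
  rw [map_pow, map_pow, pow_two_pow_eq_iff (residue_gamma hC.gam_eq)] at h3
  exact absurd h3 (by decide)

theorem eq_of_valuation_M0 (hC : CarlitzGen lam gam) {p q : Place (ZMod 2) K}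
    (hp : p.1.valuation (tC K ^ 4 + tC K + 1) < 1)
    (hq : q.1.valuation (tC K ^ 4 + tC K + 1) < 1) : q = p := by
  obtain ⟨P, hP⟩ := exists_place_above C p
  obtain ⟨Q, hQ⟩ := exists_place_above C q
  have := (placeDegree_eq_of_valuation_M0 hC ((valuation_M0_comap hP).2 hp)).2 Q
    ((valuation_M0_comap hQ).2 hq)
  rw [this] at hQ
  exact Subtype.ext (hQ.symm.trans hP)

theorem not_isIntegral_coord {K : Type*} [Field K] [Algebra k2 K] [Algebra (ZMod 2) K] (b : Bool) :
    ¬ IsIntegral (ZMod 2) (algebraMap k2 K (coord b)) := by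
  intro h
  let f : k2 →ₐ[ZMod 2] K := { algebraMap k2 K with
    commutes' := fun r ↦ DFunLike.congr_fun
      (RingHom.ext_zmod ((algebraMap k2 K).comp (algebraMap (ZMod 2) k2))
        (algebraMap (ZMod 2) K)) r }
  have h1 : IsIntegral (ZMod 2) (coord b) :=
    (isIntegral_algHom_iff f (algebraMap k2 K).injective).1 h
  exact transcendental_coord b h1.isAlgebraic

theorem exists_valuation_M0 : ∃ p : Place (ZMod 2) K,
    p.1.valuation (tC K ^ 4 + tC K + 1) < 1 := by
  refine exists_valuation_lt_one fun h ↦ not_isIntegral_coord (K := K) true ?_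
  have hm : (X ^ 4 + X + 1 : (ZMod 2)[X]).Monic := by monicity!
  refine IsIntegral.of_aeval_monic (p := X ^ 4 + X + 1) hm ?_ (by simpa using h)
  have : (X ^ 4 + X + 1 : (ZMod 2)[X]).natDegree = 4 := by compute_degree!
  rw [this]; norm_num

theorem exists_tC_notMem : ∃ p : Place (ZMod 2) K, tC K ∉ p.1 := by
  by_contra! h
  exact not_isIntegral_coord true (isIntegral_of_forall_place h)

theorem infinite_place_of_fixedBy (hC : CarlitzGen lam gam) (hK : FixedBy K ρ)
    (hρ : Acts lam gam ρ 1 2) (h5 : Module.finrank k2 K = 5) {p : Place (ZMod 2) K}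
    (ht : tC K ∉ p.1) : placeDegree (ZMod 2) p = 5 ∧ ordAt p.1 (tC K) = -1 ∧
      ∀ q : Place (ZMod 2) K, tC K ∉ q.1 → q = p := by
  have hX : evc K false X = algebraMap k2 K (coord false) := evc_X false
  have hv := coord_not_mem_iff.1 ht
  have hle := ordAt_mul_placeDegree_le (irreducible_X (R := ZMod 2)) (coord_false_mem ht)
    (by rw [hX]; exact hv)
  have hd := five_dvd_placeDegree_of_fixedBy hC hK hρ ht
  have h1 := one_le_ordAt_of_valuation_lt_one
    (by simpa using coord_ne_zero false) hv
  rw [hX, h5, natDegree_X] at hle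
  obtain ⟨m, hm⟩ := hd
  have hpos := placeDegree_pos' p
  rw [hm] at hle hpos
  have hm0 : 1 ≤ m := by omega
  push_cast at hle
  zify at hm0
  have hm1 : (m : ℤ) = 1 := by nlinarith
  have ho : ordAt p.1 (algebraMap k2 K (coord false)) = 1 := by nlinarith
  have hm' : m = 1 := by exact_mod_cast hm1
  have hd5 : placeDegree (ZMod 2) p = 5 := by rw [hm, hm']
  refine ⟨hd5, ?_, fun q hq ↦ ?_⟩
  · rw [ordAt_coord_false] at ho
    change ordAt p.1 (algebraMap k2 K (coord true)) = -1
    linarith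
  · refine eq_of_le_ordAt_mul_placeDegree (irreducible_X (R := ZMod 2)) (coord_false_mem ht)
      (by rw [hX]; exact hv) (coord_false_mem hq) (by rw [hX]; exact coord_not_mem_iff.1 hq) ?_
    rw [hX, h5, hd5, ho, natDegree_X]
    norm_num

end FixedBy

end CFF

namespace CFF
open Polynomial

section Twist

variable {C : Type*} [Field C] [CharP C 2] {t x gam : C}

/-- The alternating biadditive form `x ^ 2 * y + x * y ^ 2`. -/
def bracket (x y : C) : C := x ^ 2 * y + x * y ^ 2

/-- The twisted sum over the Carlitz translates of a torsion point. -/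
def twist (t x gam : C) (s : ℕ) : C :=
  ∑ i ∈ Finset.range 5, gam ^ 2 ^ (2 * i + s) *
    bracket ((carlitzAct t)^[i] x) ((carlitzAct t)^[i + 5] x)

theorem twist_eq (h : IsTorsion t x) (s : ℕ) {x0 x1 x2 x3 : C} (h0 : x = x0)
    (h1 : carlitzAct t x = x1) (h2 : (carlitzAct t)^[2] x = x2) (h3 : (carlitzAct t)^[3] x = x3) :
    twist t x gam s = gam ^ 2 ^ s * bracket x0 (x2 + x1) +
      gam ^ 2 ^ (2 + s) * bracket x1 (x3 + x2) + gam ^ 2 ^ (4 + s) * bracket x2 (x3 + (x1 + x0)) +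
      gam ^ 2 ^ (6 + s) * bracket x3 (x2 + x0) +
      gam ^ 2 ^ (8 + s) * bracket (x1 + x0) (x3 + x1) := by
  have two : (2 : C) = 0 := CharTwo.two_eq_zero
  have e4 : (carlitzAct t)^[4] x = x1 + x0 := by rw [← h1, ← h0]; exact h
  have e5 : (carlitzAct t)^[5] x = x2 + x1 := by rw [← h1, ← h2]; exact h.iterate_add_four 1
  have e6 : (carlitzAct t)^[6] x = x3 + x2 := by rw [← h3, ← h2]; exact h.iterate_add_four 2
  have e7 : (carlitzAct t)^[7] x = x3 + (x1 + x0) := by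
    rw [← h3, ← e4]; exact (h.iterate_add_four 3).trans (add_comm _ _)
  have e8 : (carlitzAct t)^[8] x = x2 + x0 := by
    have := h.iterate_add_four 4
    rw [e4, e5] at this
    linear_combination this + x1 * two
  have e9 : (carlitzAct t)^[9] x = x3 + x1 := by
    have := h.iterate_add_four 5
    rw [e5, e6] at this
    linear_combination this + x2 * two
  simp only [twist, Finset.sum_range_succ, Finset.sum_range_zero, Nat.reduceAdd, Nat.reduceMul,
    e4, e5, e6, e7, e8, e9, h2, h3, Function.iterate_zero_apply, Function.iterate_one, h1]
  rw [h0]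
  ring_nf

theorem map_twist {ρ : C →+* C} (ht : ρ t = t) (hx : ρ x = carlitzAct t x)
    (hg : ρ gam = gam ^ 4) (hgam : gam ^ 5 + gam ^ 2 + 1 = 0) (h : IsTorsion t x) (s : ℕ) :
    ρ (twist t x gam s) = twist t x gam s := by
  have two : (2 : C) = 0 := CharTwo.two_eq_zero
  have e0 : carlitzAct t x = carlitzAct t x := rfl
  have e4 : (carlitzAct t)^[4] x = carlitzAct t x + x := h
  have r1 : ρ (carlitzAct t x) = (carlitzAct t)^[2] x := by
    have := map_carlitzAct_iterate ρ t x 1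
    rw [ht, hx] at this; exact this
  have r2 : ρ ((carlitzAct t)^[2] x) = (carlitzAct t)^[3] x := by
    rw [map_carlitzAct_iterate, ht, hx]; rfl
  have r3 : ρ ((carlitzAct t)^[3] x) = carlitzAct t x + x := by
    rw [map_carlitzAct_iterate, ht, hx]; exact h
  have hpow : ∀ n, ρ (gam ^ 2 ^ n) = gam ^ 2 ^ (n + 2) := fun n ↦ by
    rw [map_pow, hg, ← pow_mul, pow_add, Nat.mul_comm 4]; rfl
  have h10 : gam ^ 2 ^ (8 + s + 2) = gam ^ 2 ^ s := by
    rw [pow_two_pow_eq_iff hgam, Nat.ModEq]; omega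
  rw [twist_eq h s rfl rfl rfl rfl]
  simp only [map_add, map_mul, bracket, map_pow ρ (_ : C) 2, hpow, r1, r2, r3, hx, h10]
  generalize carlitzAct t x = x1
  generalize (carlitzAct t)^[2] x = x2
  generalize (carlitzAct t)^[3] x = x3
  ring_nf
  grind

theorem twist_mem {P : ValuationSubring C} (ht : t ∈ P) (h : IsTorsion t x)
    (hgam : gam ^ 5 + gam ^ 2 + 1 = 0) (s : ℕ) : twist t x gam s ∈ P := by
  refine sum_mem fun i _ ↦ mul_mem (pow_mem (gamma_mem P hgam) _) ?_
  have h1 := (h.iterate i).mem ht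
  have h2 := (h.iterate (i + 5)).mem ht
  exact add_mem (mul_mem (pow_mem h1 _) h2) (mul_mem h1 (pow_mem h2 _))

theorem bracket_div {a y : C} (ht : t ≠ 0) : bracket x (a * t + y) / t ^ 2 =
    x ^ 2 * (a * t⁻¹ + y * t⁻¹ ^ 2) + x * (a ^ 2 + y ^ 2 * t⁻¹ ^ 2) := by
  rw [bracket, CharTwo.add_sq]
  field_simp

theorem bracket_comm (x y : C) : bracket x y = bracket y x := by
  rw [bracket, bracket]; ring

theorem valuation_twist_sub_lt_one {P : ValuationSubring C} (htP : t ∉ P) (h : IsTorsion t x)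
    (hgam : gam ^ 5 + gam ^ 2 + 1 = 0)
    (hx : ∀ i < 3, P.valuation ((carlitzAct t)^[i] x / t) < 1)
    (hx3 : P.valuation ((carlitzAct t)^[3] x / t - 1) < 1) (s : ℕ) :
    P.valuation (twist t x gam s / t ^ 2 - (gam ^ 2 ^ (4 + s) + gam ^ 2 ^ (6 + s))) < 1 := by
  have ht0 : t ≠ 0 := ne_zero_of_notMem htP
  have hmem : ∀ y, P.valuation (y - 1) < 1 → y ∈ P := fun y hy ↦ by
    have := add_mem ((P.valuation_le_one_iff _).1 hy.le) (one_mem P)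
    rwa [sub_add_cancel] at this
  obtain ⟨h2, h1, h0⟩ := residues_of_small_window htP hx hx3
  set ε : P := ⟨t⁻¹, inv_mem_of_notMem htP⟩ with hε
  set a : P := ⟨_, hmem _ hx3⟩ with ha
  set b2 : P := ⟨_, hmem _ h2⟩ with hb2
  set b1 : P := ⟨_, hmem _ h1⟩ with hb1
  set b0 : P := ⟨_, hmem _ h0⟩ with hb0
  set g : P := ⟨gam, gamma_mem P hgam⟩ with hg
  have rε : IsLocalRing.residue P ε = 0 :=
    (residue_eq_zero_iff' _).2 (valuation_inv_lt_one_of_notMem htP)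
  have ra : IsLocalRing.residue P a = 1 := by
    rw [← map_one (IsLocalRing.residue P)]; exact (residue_eq_iff _ _).2 hx3
  have rb2 : IsLocalRing.residue P b2 = 1 := by
    rw [← map_one (IsLocalRing.residue P)]; exact (residue_eq_iff _ _).2 h2
  have e0 : x = ((ε ^ 2 * b0 : P) : C) := by
    simp only [hε, hb0]; push_cast; field_simp
  have e1 : carlitzAct t x = ((ε * b1 : P) : C) := by
    simp only [hε, hb1]; push_cast; field_simp
  have e3 : (carlitzAct t)^[3] x = (a : C) * t := by
    simp only [ha]; field_simp
  have key : twist t x gam s / t ^ 2 = ((g ^ 2 ^ s * ((ε ^ 2 * b0) ^ 2 * (b2 + ε * b1) * ε ^ 2 +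
        (ε ^ 2 * b0) * (b2 + ε * b1) ^ 2 * ε ^ 2) +
      g ^ 2 ^ (2 + s) * ((ε * b1) ^ 2 * (a * ε + b2 * ε ^ 2) +
        (ε * b1) * (a ^ 2 + b2 ^ 2 * ε ^ 2)) +
      g ^ 2 ^ (4 + s) * (b2 ^ 2 * (a * ε + (ε * b1 + ε ^ 2 * b0) * ε ^ 2) +
        b2 * (a ^ 2 + (ε * b1 + ε ^ 2 * b0) ^ 2 * ε ^ 2)) +
      g ^ 2 ^ (6 + s) * ((b2 + ε ^ 2 * b0) ^ 2 * (a * ε + 0 * ε ^ 2) +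
        (b2 + ε ^ 2 * b0) * (a ^ 2 + 0 ^ 2 * ε ^ 2)) +
      g ^ 2 ^ (8 + s) * ((ε * b1 + ε ^ 2 * b0) ^ 2 * (a * ε + (ε * b1) * ε ^ 2) +
        (ε * b1 + ε ^ 2 * b0) * (a ^ 2 + (ε * b1) ^ 2 * ε ^ 2)) : P) : C) := by
    rw [twist_eq h s e0 e1 (show _ = (b2 : C) from rfl) e3,
      bracket_comm ((a : C) * t) ((b2 : C) + ((ε ^ 2 * b0 : P) : C))]
    rw [← add_zero ((a : C) * t), add_div, add_div, add_div, add_div, mul_div_assoc, mul_div_assoc,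
      mul_div_assoc, mul_div_assoc, mul_div_assoc]
    simp only [add_zero]
    rw [bracket_div ht0, bracket_div ht0, bracket_div ht0]
    have e6 : bracket ((b2 : C) + ((ε ^ 2 * b0 : P) : C)) ((a : C) * t) / t ^ 2 =
      ((b2 : C) + ((ε ^ 2 * b0 : P) : C)) ^ 2 * (a * t⁻¹ + 0 * t⁻¹ ^ 2) +
        ((b2 : C) + ((ε ^ 2 * b0 : P) : C)) * ((a : C) ^ 2 + 0 ^ 2 * t⁻¹ ^ 2) := by
      rw [← bracket_div ht0, add_zero]
    rw [e6, bracket, add_div, div_eq_mul_inv, div_eq_mul_inv, ← inv_pow]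
    rfl
  rw [key]
  refine (residue_eq_iff _ (g ^ 2 ^ (4 + s) + g ^ 2 ^ (6 + s))).1 ?_
  simp only [map_add, map_mul, map_pow, rε, ra, rb2, map_zero]
  ring

end Twist

end CFF

namespace CFF
open Polynomial

section FixedByEll

variable {K C : Type*} [Field K] [Algebra k2 K] [FiniteDimensional k2 K]
  [Algebra.IsSeparable k2 K] [Algebra (ZMod 2) K] [Field C] [Algebra k2 C] [Algebra K C]
  [IsScalarTower k2 K C] [FiniteDimensional k2 C] [IsGalois k2 C] [Algebra (ZMod 2) C]
  [CharP C 2] [CharP K 2] {lam gam : C} {ρ : C ≃ₐ[k2] C}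

theorem eq_zero_of_sum_gamma (hg : gam ^ 5 + gam ^ 2 + 1 = 0)
    (a : Fin 5 → ZMod 2) (h : algebraMap (ZMod 2) C (a 0) +
      ∑ s : Fin 4, algebraMap (ZMod 2) C (a s.succ) *
        (gam ^ 2 ^ (4 + (s : ℕ)) + gam ^ 2 ^ (6 + (s : ℕ))) = 0) : a = 0 := by
  have two : (2 : C) = 0 := CharTwo.two_eq_zero
  have two' : (2 : ZMod 2) = 0 := CharTwo.two_eq_zero
  have h3 : gam ^ 2 ^ 3 = gam ^ 3 + gam ^ 2 + 1 := by
    linear_combination (gam ^ 3 - 1) * hg - gam ^ 3 * two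
  have h4 : gam ^ 2 ^ 4 = gam ^ 4 + gam ^ 3 + gam + 1 := by
    rw [pow_succ 2 3, pow_mul, h3]; linear_combination gam * hg + (gam ^ 5 + gam ^ 2 - gam) * two
  have h5 : gam ^ 2 ^ 5 = gam := by
    simpa using (pow_two_pow_eq_iff (m := 5) (n := 0) hg).2 rfl
  have h6 : gam ^ 2 ^ 6 = gam ^ 2 := by rw [pow_succ 2 5, pow_mul, h5]
  have h7 : gam ^ 2 ^ 7 = gam ^ 4 := by rw [pow_succ 2 6, pow_mul, h6]; ring
  have h8 : gam ^ 2 ^ 8 = gam ^ 3 + gam ^ 2 + 1 := by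
    rw [pow_succ 2 7, pow_mul, h7]
    linear_combination (gam ^ 3 - 1) * hg - gam ^ 3 * two
  have h9 : gam ^ 2 ^ 9 = gam ^ 4 + gam ^ 3 + gam + 1 := by
    rw [pow_succ 2 8, pow_mul, h8]; linear_combination gam * hg + (gam ^ 5 + gam ^ 2 - gam) * two
  simp only [Fin.sum_univ_four, Fin.isValue, Fin.val_zero, Fin.val_one, Fin.val_two,
    Nat.reduceAdd, add_zero, show ((3 : Fin 4) : ℕ) = 3 from rfl, h4, h5, h6, h7, h8, h9] at h
  change algebraMap (ZMod 2) C (a 0) + (algebraMap (ZMod 2) C (a 1) * _ +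
    algebraMap (ZMod 2) C (a 2) * _ + algebraMap (ZMod 2) C (a 3) * _ +
    algebraMap (ZMod 2) C (a 4) * _) = 0 at h
  set q : (ZMod 2)[X] := Polynomial.C (a 1 + a 2) * X ^ 4 + Polynomial.C (a 1 + a 3 + a 4) * X ^ 3 +
    Polynomial.C (a 1) * X ^ 2 + Polynomial.C (a 1 + a 2 + a 4) * X +
    Polynomial.C (a 0 + a 1 + a 3 + a 4) with hq
  have hq0 : q = 0 := by
    by_contra hne
    have h1 := five_le_natDegree_of_aeval_gamma hg hne (by
      simp only [hq, map_add, map_mul, map_pow, aeval_C, aeval_X]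
      linear_combination h - (gam ^ 2 * (algebraMap (ZMod 2) C) (a 3) +
        gam ^ 4 * (algebraMap (ZMod 2) C) (a 4)) * two)
    have h2 : q.natDegree ≤ 4 := by rw [hq]; compute_degree
    omega
  have c0 := congrArg (fun r ↦ coeff r 0) hq0
  have c1 := congrArg (fun r ↦ coeff r 1) hq0
  have c2 := congrArg (fun r ↦ coeff r 2) hq0
  have c3 := congrArg (fun r ↦ coeff r 3) hq0
  have c4 := congrArg (fun r ↦ coeff r 4) hq0
  simp only [hq, coeff_add, coeff_C_mul, coeff_X_pow, coeff_X, coeff_C, coeff_zero]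
    at c0 c1 c2 c3 c4
  norm_num at c0 c1 c2 c3 c4
  have e2 : a 2 = 0 := by simpa [c2] using c4
  have e4 : a 4 = 0 := by simpa [c2, e2] using c1
  have e3 : a 3 = 0 := by simpa [c2, e4] using c3
  have e0 : a 0 = 0 := by simpa [c2, e4, e3] using c0
  funext i
  fin_cases i <;> assumption

theorem valuation_sum_lt_one {P : ValuationSubring C} {ι : Type*} {s : Finset ι} {f : ι → C}
    (h : ∀ i ∈ s, P.valuation (f i) < 1) : P.valuation (∑ i ∈ s, f i) < 1 :=
  P.valuation.map_sum_lt one_ne_zero h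

variable (hC : CarlitzGen lam gam) (hK : FixedBy K ρ) (hρ : Acts lam gam ρ 1 2)
include hC hK hρ

theorem exists_twist {p : Place (ZMod 2) K} (ht : tC K ∉ p.1) : ∃ (w : Fin 5 → K),
    w 0 = tC K ^ 2 ∧ (∀ i, w i / tC K ^ 2 ∈ p.1) ∧
    (∀ (q : Place (ZMod 2) K), tC K ∈ q.1 → ∀ i, w i ∈ q.1) ∧
    ∀ a : Fin 5 → ZMod 2, p.1.valuation (∑ i, a i • (w i / tC K ^ 2)) < 1 → a = 0 := by
  obtain ⟨P, hP⟩ := exists_place_above C p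
  have htP : tC C ∉ P.1 := by
    rwa [← algebraMap_tC (K := K), mem_iff_of_comap hP]
  have ht0 := ne_zero_of_notMem htP
  obtain ⟨n, hs, hs3⟩ := exists_small_window htP hC.torsion hC.ne_zero
  set x := (carlitzAct (tC C))^[n] lam with hx
  have hxt : IsTorsion (tC C) x := hC.torsion.iterate n
  have hρx : ρ x = carlitzAct (tC C) x := by
    rw [hx, map_carlitzAct_aut, hρ.1, ← Function.iterate_add_apply, Nat.add_comm,
      Function.iterate_add_apply]; rfl
  have hρg : ρ gam = gam ^ 4 := by rw [hρ.2]; norm_num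
  have hz : ∀ s, ∃ z : K, algebraMap K C z = twist (tC C) x gam s := fun s ↦
    hK.mem_range _ (map_twist (ρ := (ρ : C →+* C)) (ρ.commutes _) hρx hρg hC.gam_eq hxt s)
  choose z hz using hz
  have hv := fun s ↦ valuation_twist_sub_lt_one htP hxt hC.gam_eq hs hs3 s
  have hgm := gamma_mem P.1 hC.gam_eq
  have hmem : ∀ i, (Fin.cons (tC K ^ 2) (fun s : Fin 4 ↦ z s) : Fin 5 → K) i / tC K ^ 2 ∈ p.1 := by
    intro i
    rw [← mem_iff_of_comap hP, map_div₀, map_pow, algebraMap_tC]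
    refine Fin.cases ?_ (fun s ↦ ?_) i
    · rw [Fin.cons_zero, map_pow, algebraMap_tC, div_self (pow_ne_zero _ ht0)]
      exact one_mem _
    · rw [Fin.cons_succ, hz]
      have := add_mem ((P.1.valuation_le_one_iff _).1 (hv s).le)
        (add_mem (pow_mem hgm (2 ^ (4 + (s : ℕ)))) (pow_mem hgm (2 ^ (6 + (s : ℕ)))))
      rwa [sub_add_cancel] at this
  refine ⟨Fin.cons (tC K ^ 2) fun s : Fin 4 ↦ z s, rfl, hmem, ?_, ?_⟩
  · intro q hq i
    obtain ⟨Q, hQ⟩ := exists_place_above C q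
    refine Fin.cases ?_ (fun s ↦ ?_) i
    · exact pow_mem hq 2
    · rw [Fin.cons_succ, ← mem_iff_of_comap hQ, hz]
      exact twist_mem (by rwa [← algebraMap_tC (K := K), mem_iff_of_comap hQ]) hxt hC.gam_eq _
  · intro a ha
    refine eq_zero_of_sum_gamma hC.gam_eq a ?_
    rw [← valuation_lt_one_iff_of_comap hP, map_sum, Fin.sum_univ_succ] at ha
    set θ : C := algebraMap (ZMod 2) C (a 0) + ∑ s : Fin 4, algebraMap (ZMod 2) C (a s.succ) *
        (gam ^ 2 ^ (4 + (s : ℕ)) + gam ^ 2 ^ (6 + (s : ℕ))) with hθ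
    have hamem : ∀ b : ZMod 2, P.1.valuation (algebraMap (ZMod 2) C b) ≤ 1 := fun b ↦
      (P.1.valuation_le_one_iff _).2 (mem_of_isIntegral P.2.2 isIntegral_algebraMap)
    have h_int : IsIntegral (ZMod 2) θ := by
      have hgi : IsIntegral (ZMod 2) gam := by
        refine ⟨X ^ 5 + X ^ 2 + 1, by monicity!, by simpa using hC.gam_eq⟩
      refine isIntegral_algebraMap.add (IsIntegral.sum _ fun s _ ↦ isIntegral_algebraMap.mul
        ((hgi.pow _).add (hgi.pow _)))
    have hsmul : ∀ (b : ZMod 2) (y : K), algebraMap K C (b • y) =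
        algebraMap (ZMod 2) C b * algebraMap K C y := fun b y ↦ by
      rw [Algebra.smul_def, map_mul, ← RingHom.comp_apply, RingHom.ext_zmod
        ((algebraMap K C).comp (algebraMap (ZMod 2) K)) (algebraMap (ZMod 2) C)]
    have hθ1 : P.1.valuation θ < 1 := by
      have h1 : P.1.valuation (∑ s : Fin 4, algebraMap (ZMod 2) C (a s.succ) *
          (twist (tC C) x gam s / tC C ^ 2 -
            (gam ^ 2 ^ (4 + (s : ℕ)) + gam ^ 2 ^ (6 + (s : ℕ))))) < 1 :=
        valuation_sum_lt_one fun s _ ↦ by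
          rw [map_mul, mul_comm]; exact mul_lt_one_of_lt_of_le (hv s) (hamem _)
      refine lt_of_eq_of_lt (congrArg P.1.valuation ?_) (Valuation.map_sub_lt _ ha h1)
      simp only [hsmul, Fin.cons_zero, Fin.cons_succ, map_div₀, map_pow, algebraMap_tC, hz, mul_sub,
        Finset.sum_sub_distrib, div_self (pow_ne_zero 2 ht0), mul_one, hθ]
      ring
    by_contra hne
    have h2 := ordAt_of_isIntegral h_int P
    have h3 := (valuation_lt_one_iff_ordAt hne).1 hθ1
    omega

end FixedByEll
end CFF

namespace CFF
open Polynomial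

section FixedByGenus

variable {K C : Type*} [Field K] [Algebra k2 K] [FiniteDimensional k2 K]
  [Algebra.IsSeparable k2 K] [Algebra (ZMod 2) K] [Field C] [Algebra k2 C] [Algebra K C]
  [IsScalarTower k2 K C] [FiniteDimensional k2 C] [IsGalois k2 C] [Algebra (ZMod 2) C]
  [CharP C 2] [CharP K 2] {lam gam : C} {ρ : C ≃ₐ[k2] C}

theorem valuation_div_pow_lt_one_of_mem {p : Place (ZMod 2) K} {t : K} (hord : ordAt p.1 t = -1)
    (ht : t ≠ 0) {m : ℕ} {y : K}
    (hy : y ∈ RRspace (ZMod 2) (Finsupp.single p (m : ℤ) : Divisor (ZMod 2) K)) :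
    p.1.valuation (y / t ^ (m + 1)) < 1 := by
  by_cases h0 : y = 0
  · simp [h0]
  have h := (mem_RRspace_of_ne h0).1 hy p
  have hp := pow_ne_zero (m + 1) ht
  rw [valuation_lt_one_iff_ordAt (div_ne_zero h0 hp), ordAt_div h0 hp, ordAt_pow ht, hord]
  rw [Finsupp.single_eq_same] at h
  push_cast; omega

theorem mem_RRspace_single {p : Place (ZMod 2) K} {t : K} (hord : ordAt p.1 t = -1)
    (ht : t ≠ 0) {m : ℕ} {y : K} (hp : y / t ^ m ∈ p.1)
    (hq : ∀ q : Place (ZMod 2) K, q ≠ p → y ∈ q.1) :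
    y ∈ RRspace (ZMod 2) (Finsupp.single p (m : ℤ) : Divisor (ZMod 2) K) := by
  refine mem_RRspace.2 fun h0 q ↦ ?_
  by_cases hqp : q = p
  · subst hqp
    have ht' := pow_ne_zero m ht
    have h := mem_iff_ordAt_nonneg.1 hp
    rw [ordAt_div h0 ht', ordAt_pow ht, hord] at h
    rw [Finsupp.single_eq_same]; omega
  · rw [Finsupp.single_eq_of_ne hqp, zero_add]
    exact mem_iff_ordAt_nonneg.1 (hq q hqp)

variable (hC : CarlitzGen lam gam) (hK : FixedBy K ρ) (hρ : Acts lam gam ρ 1 2)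
include hC hK hρ

theorem ell_single_succ (h5 : Module.finrank k2 K = 5) {p : Place (ZMod 2) K}
    (ht : tC K ∉ p.1) {m : ℕ} (hm : 1 ≤ m) :
    ell (ZMod 2) (Finsupp.single p (m : ℤ) : Divisor (ZMod 2) K) + 5 ≤
      ell (ZMod 2) (Finsupp.single p ((m + 1 : ℕ) : ℤ) : Divisor (ZMod 2) K) := by
  obtain ⟨-, hord, hu⟩ := infinite_place_of_fixedBy hC hK hρ h5 ht
  have ht0 := ne_zero_of_notMem ht
  obtain ⟨w, -, hw1, hw2, hw⟩ := exists_twist hC hK hρ ht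
  have hmem : ∀ q : Place (ZMod 2) K, q ≠ p → tC K ∈ q.1 := fun q hq ↦ by
    by_contra h; exact hq (hu q h)
  set W := RRspace (ZMod 2) (Finsupp.single p (m : ℤ) : Divisor (ZMod 2) K) with hW
  set V := RRspace (ZMod 2) (Finsupp.single p ((m + 1 : ℕ) : ℤ) : Divisor (ZMod 2) K) with hV
  have hf : ∀ i, tC K ^ (m - 1) * w i ∈ V := fun i ↦ by
    refine mem_RRspace_single hord ht0 ?_ fun q hq ↦
      mul_mem (pow_mem (hmem q hq) _) (hw2 q (hmem q hq) i)
    convert hw1 i using 1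
    obtain ⟨n, rfl⟩ := Nat.exists_eq_add_of_le' hm
    rw [Nat.add_sub_cancel, show n + 1 + 1 = n + 2 from rfl, pow_add]
    field_simp
  have hWV : W ≤ V := RRspace_mono (Finsupp.single_mono (by push_cast; omega))
  set L : (Fin 5 → ZMod 2) →ₗ[ZMod 2] V :=
    Fintype.linearCombination (ZMod 2) (fun i ↦ (⟨_, hf i⟩ : V)) with hL
  have hLa : ∀ a, ((L a : V) : K) / tC K ^ (m + 1) = ∑ i, a i • (w i / tC K ^ 2) := fun a ↦ by
    rw [hL, Fintype.linearCombination_apply]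
    push_cast
    rw [Finset.sum_div]
    refine Finset.sum_congr rfl fun i _ ↦ ?_
    rw [smul_div_assoc]
    congr 1
    obtain ⟨n, rfl⟩ := Nat.exists_eq_add_of_le' hm
    rw [Nat.add_sub_cancel, show n + 1 + 1 = n + 2 from rfl, pow_add]
    field_simp
  have hinj : Function.Injective ((Submodule.inclusion hWV).coprod L) := by
    rw [injective_iff_map_eq_zero]
    rintro ⟨y, a⟩ h
    have h1 : (y : K) + (L a : K) = 0 := congrArg Subtype.val h
    have ha : a = 0 := by
      refine hw a ?_
      rw [← hLa]
      refine valuation_div_pow_lt_one_of_mem hord ht0 ?_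
      rw [eq_neg_of_add_eq_zero_right h1]
      exact neg_mem y.2
    subst ha
    rw [map_zero] at h1
    refine Prod.ext (Subtype.ext ?_) rfl
    simpa using h1
  have := LinearMap.finrank_le_finrank_of_injective hinj
  rwa [Module.finrank_prod, Module.finrank_fin_fun] at this

theorem riemannBound_of_fixedBy (h5 : Module.finrank k2 K = 5) : RiemannBound K := by
  obtain ⟨p, ht⟩ := exists_tC_notMem (K := K)
  obtain ⟨hd, hord, hu⟩ := infinite_place_of_fixedBy hC hK hρ h5 ht
  refine riemannBound_of (P := p) ht hu (hd.trans h5.symm) hord h5 fun m hm ↦ ?_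
  induction m, hm using Nat.le_induction with
  | base =>
    have ht0 := ne_zero_of_notMem ht
    have hT : tC K ∈ RRspace (ZMod 2) (Finsupp.single p ((1 : ℕ) : ℤ) : Divisor (ZMod 2) K) :=
      mem_RRspace_single hord ht0 (by rw [pow_one, div_self ht0]; exact one_mem _) fun q hq ↦ by
        by_contra h; exact hq (hu q h)
    have h0 : 0 < ell (ZMod 2) (0 : Divisor (ZMod 2) K) := ell_pos one_ne_zero one_mem_RRspace_zero
    have hlt : RRspace (ZMod 2) (0 : Divisor (ZMod 2) K) <
        RRspace (ZMod 2) (Finsupp.single p ((1 : ℕ) : ℤ) : Divisor (ZMod 2) K) := by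
      refine lt_of_le_of_ne (RRspace_mono ?_) fun h ↦ ?_
      · exact Finsupp.single_nonneg.2 (by norm_num)
      · rw [← h, mem_RRspace_zero] at hT
        exact not_isIntegral_coord true hT
    have := Submodule.finrank_lt_finrank_of_lt hlt
    change ell _ _ < ell _ _ at this
    omega
  | succ m hm ih =>
    have := ell_single_succ hC hK hρ h5 ht hm
    omega

end FixedByGenus
end CFF

namespace CFF

section

variable {K C : Type*} [Field K] [Algebra k2 K] [FiniteDimensional k2 K]
  [Algebra.IsSeparable k2 K] [Algebra (ZMod 2) K] [Field C] [Algebra k2 C] [Algebra K C]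
  [IsScalarTower k2 K C] [FiniteDimensional k2 C] [IsGalois k2 C] [Algebra (ZMod 2) C]
  [CharP C 2] [CharP K 2] {lam gam : C} {ρ : C ≃ₐ[k2] C}

theorem eq_zero_of_isIntegral_of_valuation_lt_one {a : K} (ha : IsIntegral (ZMod 2) a)
    {p : Place (ZMod 2) K} (h : p.1.valuation a < 1) : a = 0 := by
  by_contra hne
  have h2 := ordAt_of_isIntegral ha p
  have h3 := (valuation_lt_one_iff_ordAt hne).1 h
  omega

theorem pow_two_pow_placeDegree_of_isIntegral {a : K} (ha : IsIntegral (ZMod 2) a)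
    (p : Place (ZMod 2) K) : a ^ 2 ^ placeDegree (ZMod 2) p = a := by
  have hmem := mem_of_isIntegral p.2.2 ha
  refine sub_eq_zero.1 (eq_zero_of_isIntegral_of_valuation_lt_one (p := p) ((ha.pow _).sub ha) ?_)
  refine (residue_eq_iff (⟨a, hmem⟩ ^ 2 ^ placeDegree (ZMod 2) p) ⟨a, hmem⟩).1 ?_
  rw [map_pow, ← natCard_residueField]
  have := Fintype.ofFinite (IsLocalRing.ResidueField p.1)
  rw [Nat.card_eq_fintype_card, FiniteField.pow_card]

theorem isIntegral_of_divOf_nonneg {f : K} (hf : f ≠ 0) (h : 0 ≤ divOf f hf) :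
    IsIntegral (ZMod 2) f :=
  isIntegral_of_forall_place fun p ↦ mem_iff_ordAt_nonneg.2 (by simpa using h p)

theorem effective_add_divOf {D : Divisor (ZMod 2) K} {f : K} (hf : f ≠ 0)
    (h : f ∈ RRspace (ZMod 2) D) : 0 ≤ D + divOf f hf := fun p ↦ by
  simpa using (mem_RRspace_of_ne hf).1 h p

theorem divOf_inv {f : K} (hf : f ≠ 0) : divOf f⁻¹ (inv_ne_zero hf) = -divOf f hf := by
  ext p; simp [ordAt_inv]

theorem eq_single_of_degHom_eq {p : Place (ZMod 2) K}
    (hp : ∀ q : Place (ZMod 2) K, q ≠ p → placeDegree (ZMod 2) p < placeDegree (ZMod 2) q)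
    {E : Divisor (ZMod 2) K} (hE : 0 ≤ E)
    (hd : degHom (ZMod 2) K E = placeDegree (ZMod 2) p) : E = Finsupp.single p 1 := by
  have hEp : E = Finsupp.single p (E p) := by
    ext q
    by_cases hq : q = p
    · rw [hq, Finsupp.single_eq_same]
    rw [Finsupp.single_eq_of_ne hq]
    by_contra h
    have h1 : (Finsupp.single q 1 : Divisor (ZMod 2) K) ≤ E := by
      intro r
      have h0 := hE r
      rw [Finsupp.coe_zero, Pi.zero_apply] at h0
      by_cases hr : r = q
      · subst hr; rw [Finsupp.single_eq_same]; omega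
      · rwa [Finsupp.single_eq_of_ne hr]
    have h2 := degHom_mono h1
    rw [degHom_single, hd, one_mul] at h2
    have := hp q hq
    omega
  rw [hEp, degHom_single] at hd
  rw [hEp]
  congr 1
  have := placeDegree_pos' p
  have h3 : (placeDegree (ZMod 2) p : ℤ) ≠ 0 := by omega
  exact mul_right_cancel₀ h3 (hd.trans (one_mul _).symm)

theorem genus_eq_four_and_classNumber_eq_one (hR : RiemannBound K) {p : Place (ZMod 2) K}
    (hp4 : placeDegree (ZMod 2) p = 4)
    (hp : ∀ q : Place (ZMod 2) K, q ≠ p → placeDegree (ZMod 2) p < placeDegree (ZMod 2) q)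
    {q : Place (ZMod 2) K} (hq : placeDegree (ZMod 2) q = 5) :
    genus (ZMod 2) K = 4 ∧ classNumber (ZMod 2) K = 1 := by
  have hconst : ∀ a : K, IsIntegral (ZMod 2) a → a ≠ 0 → a = 1 := fun a ha h0 ↦ by
    have h4 := pow_two_pow_placeDegree_of_isIntegral ha p
    have h5 := pow_two_pow_placeDegree_of_isIntegral ha q
    rw [hp4] at h4
    rw [hq, pow_succ, pow_mul, h4, sq] at h5
    exact mul_left_cancel₀ h0 (h5.trans (mul_one a).symm)
  have heff : ∀ D : Divisor (ZMod 2) K, degHom (ZMod 2) K D = 4 → ∀ f ∈ RRspace (ZMod 2) D,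
      ∀ hf : f ≠ 0, D + divOf f hf = Finsupp.single p 1 := fun D hD f hfD hf ↦ by
    refine eq_single_of_degHom_eq hp (effective_add_divOf hf hfD) ?_
    rw [map_add, hR.degHom_divOf hf, hD, hp4]; rfl
  have hdp : degHom (ZMod 2) K (Finsupp.single p 1) = 4 := by rw [degHom_single, hp4]; rfl
  refine ⟨genus_eq_four_iff.2 ⟨hR, Finsupp.single p 1, ?_⟩, classNumber_eq_one_iff.2 fun D hD ↦ ?_⟩
  · have h1 : (1 : K) ∈ RRspace (ZMod 2) (Finsupp.single p 1 : Divisor (ZMod 2) K) :=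
      RRspace_mono (Finsupp.single_nonneg.2 zero_le_one) one_mem_RRspace_zero
    have hpos := ell_pos one_ne_zero h1
    have hle : ell (ZMod 2) (Finsupp.single p 1 : Divisor (ZMod 2) K) ≤ 1 := by
      refine finrank_le_one (⟨1, h1⟩ : RRspace (ZMod 2) _) fun ⟨f, hf⟩ ↦ ?_
      by_cases h0 : f = 0
      · exact ⟨0, Subtype.ext (by simp [h0])⟩
      · have hdiv : divOf f h0 = 0 := by simpa using heff _ hdp f hf h0
        refine ⟨1, Subtype.ext ?_⟩
        rw [one_smul]
        exact (hconst f (isIntegral_of_divOf_nonneg h0 hdiv.ge) h0).symm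
    rw [hdp]; omega
  · have hd : degHom (ZMod 2) K (D + Finsupp.single p 1) = 4 := by rw [map_add, hD, hdp]; rfl
    have := hR (D + Finsupp.single p 1)
    obtain ⟨f, hf, hfD⟩ := exists_ne_zero_of_ell_pos (D := D + Finsupp.single p 1) (by omega)
    refine ⟨f⁻¹, inv_ne_zero hf, ?_⟩
    have h := heff _ hd f hfD hf
    rw [divOf_inv, eq_neg_iff_add_eq_zero]
    have h' : D + divOf f hf + Finsupp.single p 1 = Finsupp.single p 1 := by
      rwa [add_right_comm]
    simpa using h'

theorem genus_and_classNumber_of_fixedBy (hC : CarlitzGen lam gam) (hK : FixedBy K ρ)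
    (hρ : Acts lam gam ρ 1 2) (h5 : Module.finrank k2 K = 5) :
    genus (ZMod 2) K = 4 ∧ classNumber (ZMod 2) K = 1 := by
  obtain ⟨q, ht⟩ := exists_tC_notMem (K := K)
  obtain ⟨p, hp⟩ := exists_valuation_M0 (K := K)
  have hp4 := placeDegree_eq_four_of_fixedBy hC hK hρ hp
  refine genus_eq_four_and_classNumber_eq_one (riemannBound_of_fixedBy hC hK hρ h5) hp4
    (fun r hr ↦ ?_) (infinite_place_of_fixedBy hC hK hρ h5 ht).1
  have := five_le_placeDegree_of_fixedBy hC hK hρ (p := r) fun h ↦ hr (eq_of_valuation_M0 hC hp h)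
  omega

end
end CFF

namespace CFF

section Conjugate

variable {K : Type*} [Field K] [Algebra k2 K] [FiniteDimensional k2 K]
  [Algebra.IsSeparable k2 K] [Algebra (ZMod 2) K] (p q : Place (ZMod 2) K) (g h : K ≃ₐ[k2] K)

/-- The preimage of a place under an automorphism. -/
def conj : Place (ZMod 2) K :=
  ⟨p.1.comap (g : K →+* K), isPlace_of_ne_top fun htop ↦ p.2.1 (by
    rw [eq_top_iff]
    intro y _
    obtain ⟨x, rfl⟩ := g.surjective y
    have : x ∈ p.1.comap (g : K →+* K) := htop ▸ ValuationSubring.mem_top x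
    exact this)⟩

variable {p q g h}

theorem mem_conj {x : K} : x ∈ (conj p g).1 ↔ g x ∈ p.1 := Iff.rfl

theorem place_ext (h : ∀ x, x ∈ p.1 ↔ x ∈ q.1) : p = q :=
  Subtype.ext (SetLike.ext h)

theorem conj_conj : conj (conj p g) h = conj p (g * h) := place_ext fun _ ↦ Iff.rfl

theorem conj_one : conj p 1 = p := place_ext fun _ ↦ Iff.rfl

theorem valuation_conj_lt_one {x : K} :
    (conj p g).1.valuation x < 1 ↔ p.1.valuation (g x) < 1 :=
  valuation_comap_lt_one p.1 (g : K →+* K) x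

theorem ordAt_conj_aux {f : K} (hf : f ≠ 0) (h0 : ordAt (conj p g).1 f = 0) :
    ordAt p.1 (g f) = 0 := by
  have hgf : g f ≠ 0 := (map_ne_zero g).2 hf
  have h1 : g f ∈ p.1 := mem_conj.1 (mem_iff_ordAt_nonneg.2 h0.ge)
  have h2 := valuation_conj_lt_one (p := p) (g := g) (x := f)
  rw [valuation_lt_one_iff_ordAt hf, valuation_lt_one_iff_ordAt hgf, h0] at h2
  have h3 := mem_iff_ordAt_nonneg.1 h1
  have : ¬ 0 < ordAt p.1 (g f) := fun h ↦ absurd (h2.2 h) (lt_irrefl _)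
  omega

theorem ordAt_conj (f : K) : ordAt (conj p g).1 f = ordAt p.1 (g f) := by
  by_cases hf : f = 0
  · rw [hf, map_zero, ordAt_zero, ordAt_zero]
  obtain ⟨π, hπ, h1⟩ := exists_ordAt_eq_one (conj p g).1
  have key : ∀ f : K, f ≠ 0 → ordAt p.1 (g f) = ordAt (conj p g).1 f * ordAt p.1 (g π) := by
    intro f hf
    have hgπ : g π ≠ 0 := (map_ne_zero g).2 hπ
    have hgf : g f ≠ 0 := (map_ne_zero g).2 hf
    obtain ⟨n, hn | hn⟩ := Int.eq_nat_or_neg (ordAt (conj p g).1 f)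
    · have := ordAt_conj_aux (p := p) (g := g) (div_ne_zero hf (pow_ne_zero n hπ)) (by
        rw [ordAt_div hf (pow_ne_zero n hπ), ordAt_pow hπ, h1, hn]; ring)
      rw [map_div₀, map_pow, ordAt_div hgf (pow_ne_zero n hgπ), ordAt_pow hgπ] at this
      rw [hn]; linarith
    · have := ordAt_conj_aux (p := p) (g := g) (mul_ne_zero hf (pow_ne_zero n hπ)) (by
        rw [ordAt_mul hf (pow_ne_zero n hπ), ordAt_pow hπ, h1, hn]; ring)
      rw [map_mul, map_pow, ordAt_mul hgf (pow_ne_zero n hgπ), ordAt_pow hgπ] at this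
      rw [hn]; linarith
  have hk : ordAt p.1 (g π) = 1 := by
    have hpos : 0 < ordAt p.1 (g π) := by
      rw [← valuation_lt_one_iff_ordAt ((map_ne_zero g).2 hπ), ← valuation_conj_lt_one,
        valuation_lt_one_iff_ordAt hπ, h1]
      exact one_pos
    obtain ⟨ϖ, hϖ, h2⟩ := exists_ordAt_eq_one p.1
    have h3 := key (g.symm ϖ) ((map_ne_zero g.symm).2 hϖ)
    rw [AlgEquiv.apply_symm_apply, h2] at h3
    exact (Int.isUnit_iff.1 (IsUnit.of_mul_eq_one_right _ h3.symm)).resolve_right (by omega)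
  rw [key f hf, hk, mul_one]

theorem placeDegree_conj_le : placeDegree (ZMod 2) (conj p g) ≤ placeDegree (ZMod 2) p := by
  set ψ : IsLocalRing.ResidueField (conj p g).1 →+* IsLocalRing.ResidueField p.1 :=
    Ideal.Quotient.lift (IsLocalRing.maximalIdeal (conj p g).1)
      ((IsLocalRing.residue p.1).comp
        (((g : K →+* K).comp (conj p g).1.subtype).codRestrict p.1.toSubring
        fun r ↦ mem_conj.1 r.2)) fun r hr ↦ by
      rw [RingHom.comp_apply, residue_eq_zero_iff']
      exact valuation_conj_lt_one.1 ((mem_maximalIdeal_iff r).1 hr)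
  have := Nat.card_le_card_of_injective ψ ψ.injective
  rw [natCard_residueField, natCard_residueField] at this
  exact (Nat.pow_le_pow_iff_right one_lt_two).1 this

theorem placeDegree_conj : placeDegree (ZMod 2) (conj p g) = placeDegree (ZMod 2) p := by
  refine le_antisymm placeDegree_conj_le ?_
  have := placeDegree_conj_le (p := conj p g) (g := g⁻¹)
  rwa [conj_conj, mul_inv_cancel, conj_one] at this

end Conjugate

section ClassNumberOne

variable {K : Type*} [Field K] [Algebra k2 K] [FiniteDimensional k2 K]
  [Algebra.IsSeparable k2 K] [Algebra (ZMod 2) K] [CharP K 2] {p q : Place (ZMod 2) K}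
  {g φ : K ≃ₐ[k2] K}

theorem eq_of_divOf_eq (hconst : ∀ a : K, IsIntegral (ZMod 2) a → a ≠ 0 → a = 1) {f f' : K}
    (hf : f ≠ 0) (hf' : f' ≠ 0) (h : ∀ p : Place (ZMod 2) K, ordAt p.1 f = ordAt p.1 f') :
    f = f' := by
  rw [← div_eq_one_iff_eq hf']
  refine hconst _ (isIntegral_of_divOf_nonneg (div_ne_zero hf hf') fun p ↦ ?_) (div_ne_zero hf hf')
  simp [ordAt_div hf hf', h]

/-- The situation of a nontrivial conjugate place in a field with class number one: a function
whose divisor is the difference of the two places. -/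
theorem exists_divOf_conj (hh : classNumber (ZMod 2) K = 1) (p : Place (ZMod 2) K)
    (g : K ≃ₐ[k2] K) : ∃ f : K, ∃ hf : f ≠ 0,
      divOf f hf = Finsupp.single p 1 - Finsupp.single (conj p g) 1 := by
  obtain ⟨f, hf, h⟩ := classNumber_eq_one_iff.1 hh
    (Finsupp.single p 1 - Finsupp.single (conj p g) 1) (by
      rw [map_sub, degHom_single, degHom_single, placeDegree_conj, sub_self])
  exact ⟨f, hf, h.symm⟩

variable (hconst : ∀ a : K, IsIntegral (ZMod 2) a → a ≠ 0 → a = 1)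
  (hcomm : ∀ a b : K ≃ₐ[k2] K, a * b = b * a)
  (hφ : ∀ x ∈ p.1, p.1.valuation (φ x - x ^ 2) < 1)
include hcomm hφ

theorem conj_eq_of_frobenius : conj p φ = p := by
  have h1 : ∀ x ∈ p.1, φ x ∈ p.1 := fun x hx ↦ by
    have := add_mem ((p.1.valuation_le_one_iff _).1 (hφ x hx).le) (pow_mem hx 2)
    rwa [sub_add_cancel] at this
  refine place_ext fun x ↦ ⟨fun hx ↦ ?_, h1 x⟩
  by_contra hne
  have hv : p.1.valuation x⁻¹ < 1 := by
    rw [valuation_lt_one_iff_inv_notMem _ (inv_ne_zero (ne_zero_of_notMem hne)), inv_inv]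
    exact hne
  have h2 := hφ _ ((p.1.valuation_le_one_iff _).1 hv.le)
  have h3 : p.1.valuation (φ x⁻¹) < 1 := by
    have h4 : p.1.valuation (x⁻¹ ^ 2) < 1 := by rw [map_pow]; exact pow_lt_one' hv two_ne_zero
    have := Valuation.map_add_lt _ h2 h4
    rwa [sub_add_cancel] at this
  have h0 : φ x⁻¹ ≠ 0 := (map_ne_zero φ).2 (inv_ne_zero (ne_zero_of_notMem hne))
  rw [valuation_lt_one_iff_inv_notMem _ h0, ← map_inv₀, inv_inv] at h3
  exact h3 (mem_conj.1 hx)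

theorem frobenius_conj (g : K ≃ₐ[k2] K) :
    ∀ x ∈ (conj p g).1, (conj p g).1.valuation (φ x - x ^ 2) < 1 := fun x hx ↦ by
  rw [valuation_conj_lt_one, map_sub, map_pow]
  have := hφ (g x) (mem_conj.1 hx)
  rwa [← AlgEquiv.mul_apply, hcomm, AlgEquiv.mul_apply] at this

include hconst

theorem apply_eq_of_divOf_eq {f : K} (hf : f ≠ 0)
    (hdiv : divOf f hf = Finsupp.single p 1 - Finsupp.single (conj p g) 1) : φ f = f := by
  refine eq_of_divOf_eq hconst ((map_ne_zero φ).2 hf) hf fun r ↦ ?_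
  have hst : ∀ g', conj (conj p g') φ = conj p g' := fun g' ↦
    conj_eq_of_frobenius hcomm (frobenius_conj hcomm hφ g')
  have hinj : ∀ r' : Place (ZMod 2) K, conj r φ = conj r' φ → r = r' := fun r' h ↦ by
    have := congrArg (fun s ↦ conj s φ⁻¹) h
    simpa only [conj_conj, mul_inv_cancel, conj_one] using this
  have h1 : conj r φ = p ↔ r = p := by
    refine ⟨fun h ↦ hinj _ ?_, fun h ↦ ?_⟩
    · rw [h]; exact (conj_eq_of_frobenius hcomm hφ).symm
    · rw [h]; exact conj_eq_of_frobenius hcomm hφ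
  have h2 : conj r φ = conj p g ↔ r = conj p g :=
    ⟨fun h ↦ hinj _ (by rw [h, hst]), fun h ↦ by rw [h, hst]⟩
  rw [← ordAt_conj, ← divOf_apply f hf, ← divOf_apply f hf, hdiv]
  simp only [Finsupp.coe_sub, Pi.sub_apply, Finsupp.single_apply, eq_comm (b := conj r φ),
    eq_comm (b := r), h1, h2]

theorem valuation_sub_one_of_divOf_eq {f : K} (hf : f ≠ 0)
    (hdiv : divOf f hf = Finsupp.single p 1 - Finsupp.single (conj p g) 1) {x : K ≃ₐ[k2] K}
    (h1 : conj p x ≠ p) (h2 : conj p x ≠ conj p g) : (conj p x).1.valuation (1 + f) < 1 := by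
  have hord : ordAt (conj p x).1 f = 0 := by
    rw [← divOf_apply f hf, hdiv]
    simp [h1.symm, h2.symm]
  have hfr := frobenius_conj hcomm hφ x f (mem_iff_ordAt_nonneg.2 hord.ge)
  rw [apply_eq_of_divOf_eq hconst hcomm hφ hf hdiv] at hfr
  have hv : (conj p x).1.valuation f = 1 := (valuation_eq_one_iff_ordAt hf).2 hord
  have e : f - f ^ 2 = f * (1 + f) := by rw [← CharTwo.sub_eq_add 1 f]; ring
  rwa [e, map_mul, hv, one_mul] at hfr

end ClassNumberOne
end CFF

namespace CFF

section CubeStabilizes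

variable {K : Type*} [Field K] [Algebra k2 K] [FiniteDimensional k2 K]
  [Algebra.IsSeparable k2 K] [Algebra (ZMod 2) K] [CharP K 2] {p q : Place (ZMod 2) K}
  {g h φ : K ≃ₐ[k2] K}

theorem conj_cancel : conj p h = conj q h ↔ p = q := by
  refine ⟨fun H ↦ ?_, fun H ↦ H ▸ rfl⟩
  have := congrArg (fun s ↦ conj s h⁻¹) H
  simpa only [conj_conj, mul_inv_cancel, conj_one] using this

theorem conj_pow_eq (hg : conj p g = p) (n : ℕ) : conj p (g ^ n) = p := by
  induction n with
  | zero => exact conj_one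
  | succ n ih => rw [pow_succ, ← conj_conj, ih, hg]

theorem ordAt_of_divOf_eq {f : K} {hf : f ≠ 0}
    (hdiv : divOf f hf = Finsupp.single p 1 - Finsupp.single q 1) (r : Place (ZMod 2) K) :
    ordAt r.1 f = (if p = r then 1 else 0) - (if q = r then 1 else 0) := by
  rw [← divOf_apply f hf, hdiv, Finsupp.sub_apply, Finsupp.single_apply, Finsupp.single_apply]

theorem one_add_ne_zero_of_divOf_eq {f : K} {hf : f ≠ 0}
    (hdiv : divOf f hf = Finsupp.single p 1 - Finsupp.single q 1) (hpq : p ≠ q) : 1 + f ≠ 0 := by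
  intro h
  have h1 := ordAt_of_divOf_eq hdiv p
  rw [← CharTwo.add_eq_zero.1 h, ordAt_one, if_pos rfl, if_neg hpq.symm] at h1
  omega

theorem min_zero_le_ordAt_one_add {f : K} (hf : f ≠ 0) (hf1 : 1 + f ≠ 0) (r : Place (ZMod 2) K) :
    min 0 (ordAt r.1 f) ≤ ordAt r.1 (1 + f) := by
  have := min_ordAt_le_ordAt_add (O := r.1) one_ne_zero hf hf1
  rwa [ordAt_one] at this

variable (hconst : ∀ a : K, IsIntegral (ZMod 2) a → a ≠ 0 → a = 1)
  (hcomm : ∀ a b : K ≃ₐ[k2] K, a * b = b * a)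
  (hφ : ∀ x ∈ p.1, p.1.valuation (φ x - x ^ 2) < 1) (hh : classNumber (ZMod 2) K = 1)
include hconst hcomm hφ hh

theorem conj_pow_three_eq (hR : RiemannBound K) (h75 : g ^ 75 = 1) : conj p (g ^ 3) = p := by
  by_contra h3
  have h1 : conj p g ≠ p := fun h ↦ h3 (conj_pow_eq h 3)
  have h2 : conj p (g ^ 2) ≠ p := fun h ↦ h1 (by
    have := conj_pow_eq h 38
    rwa [← pow_mul, show 2 * 38 = 75 + 1 by rfl, pow_succ, h75, one_mul] at this)
  have h21 : conj p (g ^ 2) ≠ conj p g := fun h ↦ h1 (by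
    rwa [pow_succ, pow_one, ← conj_conj, conj_cancel] at h)
  have h31 : conj p (g ^ 3) ≠ conj p g := fun h ↦ h2 (by
    rwa [pow_succ, ← conj_conj, conj_cancel] at h)
  have h32 : conj p (g ^ 3) ≠ conj p (g ^ 2) := fun h ↦ h1 (by
    rwa [pow_succ' g 2, ← conj_conj, conj_cancel] at h)
  obtain ⟨f, hf, hdiv⟩ := exists_divOf_conj hh p g
  have hv2 := valuation_sub_one_of_divOf_eq hconst hcomm hφ hf hdiv h2 h21
  have hv3 := valuation_sub_one_of_divOf_eq hconst hcomm hφ hf hdiv h3 h31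
  have hf1 : 1 + f ≠ 0 := one_add_ne_zero_of_divOf_eq hdiv h1.symm
  have hle : Finsupp.single (conj p (g ^ 2)) 1 + Finsupp.single (conj p (g ^ 3)) 1 -
      Finsupp.single (conj p g) 1 ≤ divOf (1 + f) hf1 := fun r ↦ by
    rw [Finsupp.sub_apply, Finsupp.add_apply, Finsupp.single_apply, Finsupp.single_apply,
      Finsupp.single_apply, divOf_apply]
    have hm := min_zero_le_ordAt_one_add hf hf1 r
    rw [ordAt_of_divOf_eq hdiv] at hm
    by_cases e2 : conj p (g ^ 2) = r
    · have := one_le_ordAt_of_valuation_lt_one hf1 hv2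
      rw [e2] at this
      rw [if_pos e2, if_neg (fun e ↦ h32 (e.trans e2.symm)), if_neg fun e ↦ h21 (e2.trans e.symm)]
      simpa using this
    by_cases e3 : conj p (g ^ 3) = r
    · have := one_le_ordAt_of_valuation_lt_one hf1 hv3
      rw [e3] at this
      rw [if_neg e2, if_pos e3, if_neg fun e ↦ h31 (e3.trans e.symm)]
      simpa using this
    rw [if_neg e2, if_neg e3]
    refine le_trans ?_ hm
    split_ifs <;> simp
  have := degHom_mono hle
  rw [hR.degHom_divOf, map_sub, map_add, degHom_single, degHom_single, degHom_single,
    placeDegree_conj, placeDegree_conj, placeDegree_conj] at this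
  have := placeDegree_pos' p
  omega

theorem exists_mul_apply_eq (h3 : conj p (g ^ 3) = p) (h1 : conj p g ≠ p) :
    ∃ f : K, ∃ hf : f ≠ 0, divOf f hf = Finsupp.single p 1 - Finsupp.single (conj p g) 1 ∧
      f * g f = 1 + f := by
  have h2 : conj p (g ^ 2) ≠ p := fun h ↦ h1 (by
    rwa [pow_succ, ← conj_conj, h] at h3)
  have h21 : conj p (g ^ 2) ≠ conj p g := fun h ↦ h1 (by
    rwa [pow_succ, pow_one, ← conj_conj, conj_cancel] at h)
  obtain ⟨f, hf, hdiv⟩ := exists_divOf_conj hh p g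
  refine ⟨f, hf, hdiv, ?_⟩
  have hf1 : 1 + f ≠ 0 := one_add_ne_zero_of_divOf_eq hdiv h1.symm
  have hv2 := valuation_sub_one_of_divOf_eq hconst hcomm hφ hf hdiv h2 h21
  have hgf : g f ≠ 0 := (map_ne_zero g).2 hf
  have hne := mul_ne_zero hf hgf
  have : (1 + f) / (f * g f) = 1 := by
    refine hconst _ (isIntegral_of_divOf_nonneg (div_ne_zero hf1 hne) fun r ↦ ?_)
      (div_ne_zero hf1 hne)
    have hm := min_zero_le_ordAt_one_add hf hf1 r
    have e1 : p = conj r g ↔ conj p (g ^ 2) = r := by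
      rw [← conj_cancel (h := g) (p := conj p (g ^ 2)), conj_conj, ← pow_succ, h3]
    have e2 : conj p g = conj r g ↔ p = r := conj_cancel
    have ho : ordAt r.1 (g f) = (if conj p (g ^ 2) = r then 1 else 0) - if p = r then 1 else 0 := by
      rw [← ordAt_conj, ordAt_of_divOf_eq hdiv]
      simp only [e1, e2]
    rw [divOf_apply, ordAt_div hf1 hne, ordAt_mul hf hgf, ho]
    rw [ordAt_of_divOf_eq hdiv] at hm ⊢
    by_cases e2 : conj p (g ^ 2) = r
    · have := one_le_ordAt_of_valuation_lt_one hf1 hv2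
      rw [e2] at this
      rw [if_pos e2, if_neg fun e ↦ h2 (e2.trans e.symm), if_neg fun e ↦ h21 (e2.trans e.symm)]
      simpa using this
    rw [if_neg e2]
    by_cases e0 : p = r
    · rw [if_pos e0, if_neg fun e ↦ h1 (e.trans e0.symm)] at hm ⊢
      simpa using hm
    · rw [if_neg e0] at hm ⊢
      split_ifs at hm ⊢ <;> simp at hm ⊢ <;> omega
  rw [div_eq_one_iff_eq hne] at this
  exact this.symm

end CubeStabilizes
end CFF

namespace CFF
open Polynomial

section Rational

variable {K : Type*} [Field K] [Algebra k2 K] [FiniteDimensional k2 K]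
  [Algebra.IsSeparable k2 K] [Algebra (ZMod 2) K] {p : Place (ZMod 2) K}

theorem not_isIntegral_evc {g : (ZMod 2)[X]} (hm : g.Monic) (hd : g.natDegree ≠ 0) :
    ¬ IsIntegral (ZMod 2) (evc K true g) := fun h ↦ by
  refine not_isIntegral_coord (K := K) true (IsIntegral.of_aeval_monic (p := g) hm hd ?_)
  have e : aeval (algebraMap k2 K (coord true)) g = evc K true g := by
    have : (aeval (algebraMap k2 K (coord true)) : (ZMod 2)[X] →ₐ[ZMod 2] K).toRingHom =
        evc K true := by
      refine Polynomial.ringHom_ext' (RingHom.ext_zmod _ _) ?_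
      simp [evc_X]
    exact congrArg (fun φ : (ZMod 2)[X] →+* K ↦ φ g) this
  rwa [e]

theorem tC_mem_of_valuation_evc_lt_one {g : (ZMod 2)[X]} (hg : g ≠ 0)
    (h : p.1.valuation (evc K true g) < 1) : tC K ∈ p.1 := by
  by_contra hT
  have h1 := one_le_ordAt_of_valuation_lt_one (evc_ne_zero hg) h
  rw [ordAt_evc_of_not_mem hT hg] at h1
  have h2 : ordAt p.1 (tC K) < 0 := by
    by_contra! h
    exact hT (mem_iff_ordAt_nonneg.2 h)
  have := mul_nonpos_of_nonneg_of_nonpos (Int.natCast_nonneg g.natDegree) h2.le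
  linarith

/-- An element of `k2` with poles at infinity only is a polynomial. -/
theorem exists_evc_eq (s : k2) (h : ∀ r : Place (ZMod 2) K, tC K ∈ r.1 → algebraMap k2 K s ∈ r.1) :
    ∃ a, algebraMap k2 K s = evc K true a := by
  have e : ∀ g : (ZMod 2)[X], evc K true g = algebraMap k2 K (algebraMap (ZMod 2)[X] k2 g) :=
    fun g ↦ by rw [evc_apply, ← RatFunc.aeval_X_left_eq_algebraMap]; rfl
  have hb : evc K true s.denom ≠ 0 := evc_ne_zero s.denom_ne_zero
  have hs : algebraMap k2 K s * evc K true s.denom = evc K true s.num := by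
    rw [← eq_div_iff hb, e, e, ← map_div₀, RatFunc.num_div_denom]
  by_cases hd : s.denom.natDegree = 0
  · rw [(Monic.natDegree_eq_zero (RatFunc.monic_denom s)).1 hd, map_one, mul_one] at hs
    exact ⟨_, hs⟩
  · exfalso
    obtain ⟨r, hr⟩ := exists_valuation_lt_one (not_isIntegral_evc (K := K) (RatFunc.monic_denom s)
      hd)
    have hmem := h r (tC_mem_of_valuation_evc_lt_one s.denom_ne_zero hr)
    have hT := tC_mem_of_valuation_evc_lt_one s.denom_ne_zero hr
    have hmul : ∀ x y : K, x ∈ r.1 → r.1.valuation y < 1 → r.1.valuation (x * y) < 1 :=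
      fun x y hx hy ↦ by
        rw [mul_comm, map_mul]
        exact mul_lt_one_of_lt_of_le hy ((r.1.valuation_le_one_iff x).2 hx)
    obtain ⟨u, w, huw⟩ := RatFunc.isCoprime_num_denom s
    have h1 := Valuation.map_add_lt _ (hmul _ _ (evc_mem hT u) (hs ▸ hmul _ _ hmem hr))
      (hmul _ _ (evc_mem hT w) hr)
    rw [← map_mul, ← map_mul, ← map_add, huw, map_one, map_one] at h1
    exact lt_irrefl _ h1

theorem eq_of_evc_of_neg_one_le_ordAt (hp : tC K ∉ p.1) {a : (ZMod 2)[X]}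
    (h : -1 ≤ ordAt p.1 (evc K true a)) :
    evc K true a = 0 ∨ evc K true a = 1 ∨ evc K true a = tC K ∨ evc K true a = tC K + 1 := by
  have hd : a.natDegree ≤ 1 := by
    by_cases ha : a = 0
    · simp [ha]
    rw [ordAt_evc_of_not_mem hp ha] at h
    have h2 : ordAt p.1 (tC K) < 0 := by
      by_contra! h
      exact hp (mem_iff_ordAt_nonneg.2 h)
    by_contra! h3
    have : (2 : ℤ) ≤ a.natDegree := by exact_mod_cast h3
    nlinarith
  have h01 : ∀ c : ZMod 2, c = 0 ∨ c = 1 := by decide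
  rw [eq_X_add_C_of_natDegree_le_one hd, map_add, map_mul, evc_X]
  rcases h01 (a.coeff 0) with h0 | h0 <;> rcases h01 (a.coeff 1) with h1 | h1 <;>
    simp [h0, h1]

end Rational
end CFF

namespace CFF

section Infinity

variable {K C : Type*} [Field K] [Algebra k2 K] [FiniteDimensional k2 K]
  [Algebra.IsSeparable k2 K] [Algebra (ZMod 2) K] [Field C] [Algebra k2 C] [Algebra K C]
  [IsScalarTower k2 K C] [FiniteDimensional k2 C] [IsGalois k2 C] [Algebra (ZMod 2) C]
  [CharP C 2] [CharP K 2] {lam gam : C} {p : Place (ZMod 2) K} {g φ : K ≃ₐ[k2] K}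

variable (K) in
theorem exists_place_below (P : Place (ZMod 2) C) :
    ∃ q : Place (ZMod 2) K, P.1.comap (algebraMap K C) = q.1 := by
  refine ⟨⟨P.1.comap (algebraMap K C), isPlace_of_ne_top fun htop ↦ P.2.1 ?_⟩, rfl⟩
  have : FiniteDimensional K C := FiniteDimensional.right k2 K C
  have h : ∀ r : K, algebraMap K C r ∈ P.1 := fun r ↦ by
    have : r ∈ P.1.comap (algebraMap K C) := htop ▸ ValuationSubring.mem_top r
    exact this
  exact eq_top_iff.2 fun x _ ↦ mem_of_isIntegral h (Algebra.IsIntegral.isIntegral (R := K) x)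

theorem not_valuation_lt_one_of_mem_list {Q : Place (ZMod 2) C}
    (hQ : Q.1.valuation (tC C ^ 4 + tC C + 1) < 1) {t : C}
    (ht : t = 0 ∨ t = 1 ∨ t = tC C ∨ t = tC C + 1) : ¬ Q.1.valuation (t ^ 2 + t + 1) < 1 := by
  intro h
  have two : (2 : C) = 0 := CharTwo.two_eq_zero
  have hT := tC_mem_of_valuation_lt_one hQ
  have key : ¬ Q.1.valuation (tC C ^ 2 + tC C + 1) < 1 := fun h ↦ by
    have h1 : Q.1.valuation ((tC C ^ 2 + tC C + 1) * (tC C ^ 2 + tC C)) < 1 := by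
      rw [map_mul]
      exact mul_lt_one_of_lt_of_le h
        ((Q.1.valuation_le_one_iff _).2 (add_mem (pow_mem hT 2) hT))
    have h2 := Valuation.map_sub_lt _ hQ h1
    have e : tC C ^ 4 + tC C + 1 - (tC C ^ 2 + tC C + 1) * (tC C ^ 2 + tC C) = 1 := by
      linear_combination (-tC C ^ 3 - tC C ^ 2) * two
    rw [e, map_one] at h2
    exact lt_irrefl _ h2
  rcases ht with rfl | rfl | rfl | rfl
  · simp at h
  · have e : (1 : C) ^ 2 + 1 + 1 = 1 := by linear_combination two
    rw [e, map_one] at h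
    exact lt_irrefl _ h
  · exact key h
  · have e : (tC C + 1) ^ 2 + (tC C + 1) + 1 = tC C ^ 2 + tC C + 1 := by
      linear_combination (tC C + 1) * two
    rw [e] at h
    exact key h

theorem conj_eq_of_infinity (hC : CarlitzGen lam gam)
    (hconst : ∀ a : K, IsIntegral (ZMod 2) a → a ≠ 0 → a = 1)
    (hcomm : ∀ a b : K ≃ₐ[k2] K, a * b = b * a)
    (hφ : ∀ x ∈ p.1, p.1.valuation (φ x - x ^ 2) < 1) (hh : classNumber (ZMod 2) K = 1)
    (hR : RiemannBound K) (hp : tC K ∉ p.1) {σ : C ≃ₐ[k2] C} (hσ : Acts lam gam σ 1 0)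
    (hg : ∀ x, algebraMap K C (g x) = σ (algebraMap K C x)) (h75 : g ^ 75 = 1)
    (hgen : ∀ x, φ x = x → g x = x → ∃ s, algebraMap k2 K s = x) : conj p g = p := by
  by_contra h1
  have h3 := conj_pow_three_eq hconst hcomm hφ hh hR h75
  obtain ⟨f, hf, hdiv, hrel⟩ := exists_mul_apply_eq hconst hcomm hφ hh h3 h1
  have two : (2 : K) = 0 := CharTwo.two_eq_zero
  have hrel1 : g f * g (g f) = 1 + g f := by
    have := congrArg g hrel
    rwa [map_mul, map_add, map_one] at this
  have hrel2 : g (g f) * g (g (g f)) = 1 + g (g f) := by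
    have := congrArg g hrel1
    rwa [map_mul, map_add, map_one] at this
  have hprod : f * g f * g (g f) = 1 := by
    linear_combination f * hrel1 + hrel + f * two
  have hprod1 : g f * g (g f) * g (g (g f)) = 1 := by
    linear_combination g f * hrel2 + hrel1 + g f * two
  have hg3 : g (g (g f)) = f := by
    have hne : g f * g (g f) ≠ 0 := by
      intro h0
      rw [h0, zero_mul] at hprod1
      exact zero_ne_one hprod1
    refine mul_left_cancel₀ hne ?_
    rw [hprod1, ← hprod]; ring
  have hφf : φ f = f := apply_eq_of_divOf_eq hconst hcomm hφ hf hdiv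
  have hφg : ∀ x, φ x = x → φ (g x) = g x := fun x hx ↦ by
    rw [← AlgEquiv.mul_apply, hcomm, AlgEquiv.mul_apply, hx]
  obtain ⟨s, hs⟩ := hgen (f + g f + g (g f))
    (by rw [map_add, map_add, hφf, hφg f hφf, hφg _ (hφg f hφf)])
    (by rw [map_add, map_add, hg3]; ring)
  have hgT : ∀ r : Place (ZMod 2) K, tC K ∈ (conj r g).1 ↔ tC K ∈ r.1 := fun r ↦ by
    rw [mem_conj, AlgEquiv.commutes]
  have hfmem : ∀ r : Place (ZMod 2) K, tC K ∈ r.1 → f ∈ r.1 := fun r hr ↦ by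
    rw [mem_iff_ordAt_nonneg, ordAt_of_divOf_eq hdiv, if_neg (c := conj p g = r)]
    · split_ifs <;> simp
    · rintro rfl
      exact hp ((hgT p).1 hr)
  have hgmem : ∀ r : Place (ZMod 2) K, tC K ∈ r.1 → g f ∈ r.1 := fun r hr ↦
    mem_conj.1 (hfmem _ ((hgT r).2 hr))
  have hggmem : ∀ r : Place (ZMod 2) K, tC K ∈ r.1 → g (g f) ∈ r.1 := fun r hr ↦
    mem_conj.1 (hgmem _ ((hgT r).2 hr))
  obtain ⟨a, ha⟩ := exists_evc_eq (K := K) s fun r hr ↦ by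
    rw [hs]
    exact add_mem (add_mem (hfmem r hr) (hgmem r hr)) (hggmem r hr)
  have hord : ∀ r : Place (ZMod 2) K, -1 ≤ ordAt r.1 f := fun r ↦ by
    rw [ordAt_of_divOf_eq hdiv]
    split_ifs <;> simp
  have hgord : ∀ r : Place (ZMod 2) K, -1 ≤ ordAt r.1 (g f) := fun r ↦ by
    rw [← ordAt_conj]
    exact hord _
  have hggord : ∀ r : Place (ZMod 2) K, -1 ≤ ordAt r.1 (g (g f)) := fun r ↦ by
    rw [← ordAt_conj]
    exact hgord _
  obtain ⟨π, hπ0, hπ⟩ := exists_ordAt_eq_one p.1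
  have hπmem : ∀ x : K, -1 ≤ ordAt p.1 x → π * x ∈ p.1 := fun x hx ↦ by
    by_cases hx0 : x = 0
    · rw [hx0, mul_zero]
      exact zero_mem _
    rw [mem_iff_ordAt_nonneg, ordAt_mul hπ0 hx0, hπ]
    omega
  have hord_t : -1 ≤ ordAt p.1 (evc K true a) := by
    have h := add_mem (add_mem (hπmem _ (hord p)) (hπmem _ (hgord p))) (hπmem _ (hggord p))
    rw [← mul_add, ← mul_add, ← hs, ha] at h
    by_cases ht0 : evc K true a = 0
    · rw [ht0, ordAt_zero]
      omega
    rw [mem_iff_ordAt_nonneg, ordAt_mul hπ0 ht0, hπ] at h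
    omega
  have hlist := eq_of_evc_of_neg_one_le_ordAt hp hord_t
  rw [← ha, hs] at hlist
  obtain ⟨Q, hQ⟩ := exists_valuation_M0 (K := C)
  obtain ⟨q, hq⟩ := exists_place_below K Q
  have hstab : ∀ x, x ∈ Q.1 ↔ σ x ∈ Q.1 := fun x ↦ by
    have e : σ (tC C ^ 4 + tC C + 1) = tC C ^ 4 + tC C + 1 := by
      simp only [map_add, map_pow, AlgEquiv.commutes, map_one]
    have : conj Q σ = Q := (placeDegree_eq_of_valuation_M0 hC hQ).2 _
      (valuation_conj_lt_one.2 (e.symm ▸ hQ))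
    rw [← mem_conj, this]
  have hqT : tC K ∈ q.1 := by
    rw [← mem_iff_of_comap hq, algebraMap_tC]
    exact tC_mem_of_valuation_lt_one hQ
  have hred : ∀ x ∈ q.1, q.1.valuation (g x - x) < 1 := fun x hx ↦ by
    have := valuation_sub_lt_one_of_acts hC hQ hσ hstab _ ((mem_iff_of_comap hq x).2 hx)
    rwa [← hg, ← map_sub, valuation_lt_one_iff_of_comap hq] at this
  have hr1 := hred _ (hfmem q hqT)
  have hr2 := hred _ (hgmem q hqT)
  have hmul : ∀ x y : K, q.1.valuation x < 1 → y ∈ q.1 → q.1.valuation (x * y) < 1 :=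
    fun x y hx hy ↦ by
      rw [map_mul]
      exact mul_lt_one_of_lt_of_le hx ((q.1.valuation_le_one_iff y).2 hy)
  have hsub : q.1.valuation (f + g f + g (g f) - f) < 1 := by
    have h := Valuation.map_add_lt _ (Valuation.map_add_lt _ hr1 hr1) hr2
    have e : g f - f + (g f - f) + (g (g f) - g f) = f + g f + g (g f) - f := by
      linear_combination (-f) * two
    rwa [e] at h
  have hquad : q.1.valuation (f ^ 2 + f + 1) < 1 := by
    have h := hmul _ _ hr1 (hfmem q hqT)
    have e : (g f - f) * f = f ^ 2 + f + 1 := by linear_combination hrel - f ^ 2 * two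
    rwa [e] at h
  have hfin : q.1.valuation ((f + g f + g (g f)) ^ 2 + (f + g f + g (g f)) + 1) < 1 := by
    have hmem : f + g f + g (g f) + f + 1 ∈ q.1 := add_mem (add_mem (add_mem (add_mem
      (hfmem q hqT) (hgmem q hqT)) (hggmem q hqT)) (hfmem q hqT)) (one_mem _)
    have h := Valuation.map_add_lt _ hquad (hmul _ _ hsub hmem)
    have e : f ^ 2 + f + 1 + (f + g f + g (g f) - f) * (f + g f + g (g f) + f + 1) =
      (f + g f + g (g f)) ^ 2 + (f + g f + g (g f)) + 1 := by ring
    rwa [e] at h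
  have hfin' := (valuation_lt_one_iff_of_comap hq _).2 hfin
  rw [(algebraMap K C).map_add, (algebraMap K C).map_add, (algebraMap K C).map_pow,
    (algebraMap K C).map_one] at hfin'
  refine not_valuation_lt_one_of_mem_list hQ ?_ hfin'
  rcases hlist with h | h | h | h <;> rw [h] <;> simp [algebraMap_tC]

end Infinity
end CFF

namespace CFF
open Polynomial

section Excluded

variable {K : Type*} [Field K] [Algebra k2 K] [FiniteDimensional k2 K]
  [Algebra.IsSeparable k2 K] [Algebra (ZMod 2) K]

theorem isIntegral_gamma {y : K} (hy : y ^ 5 + y ^ 2 + 1 = 0) : IsIntegral (ZMod 2) y :=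
  ⟨X ^ 5 + X ^ 2 + 1, by monicity!, by simpa using hy⟩

theorem five_dvd_ell [CharP K 2] {y : K} (hy : y ^ 5 + y ^ 2 + 1 = 0) (D : Divisor (ZMod 2) K) :
    5 ∣ ell (ZMod 2) D := by
  have h_int := isIntegral_gamma hy
  set F := IntermediateField.adjoin (ZMod 2) {y} with hF
  have hfin : FiniteDimensional (ZMod 2) F := IntermediateField.adjoin.finiteDimensional h_int
  have hrank : Module.finrank (ZMod 2) F = 5 := by
    rw [IntermediateField.adjoin.finrank h_int]
    refine le_antisymm ?_ (five_le_natDegree_of_aeval_gamma hy (minpoly.ne_zero h_int)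
      (minpoly.aeval _ _))
    have hm : (X ^ 5 + X ^ 2 + 1 : (ZMod 2)[X]).natDegree = 5 := by compute_degree!
    rw [← hm]
    exact natDegree_le_of_dvd (minpoly.dvd _ _ (by simpa using hy)) (by
      rintro h0
      rw [h0, natDegree_zero] at hm
      omega)
  let V : Submodule F K :=
    { carrier := RRspace (ZMod 2) D
      add_mem' := fun ha hb ↦ add_mem ha hb
      zero_mem' := zero_mem _
      smul_mem' := fun c x hx ↦ by
        have hx' := mem_RRspace.1 hx
        refine mem_RRspace.2 fun h0 q ↦ ?_
        rw [IntermediateField.smul_def, smul_eq_mul] at h0 ⊢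
        have hc : IsIntegral (ZMod 2) (c : K) := (Algebra.IsIntegral.isIntegral c).map F.val
        rw [ordAt_mul (left_ne_zero_of_mul h0) (right_ne_zero_of_mul h0), ordAt_of_isIntegral hc q,
          zero_add]
        exact hx' (right_ne_zero_of_mul h0) q }
  have h := Module.finrank_mul_finrank (ZMod 2) F V
  rw [hrank] at h
  exact ⟨_, h.symm⟩

theorem genus_ne_four_of_gamma [CharP K 2] {y : K} (hy : y ^ 5 + y ^ 2 + 1 = 0) :
    genus (ZMod 2) K ≠ 4 := fun h ↦ by
  obtain ⟨-, D, hD⟩ := genus_eq_four_iff.1 h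
  have h1 : (5 : ℤ) ∣ ell (ZMod 2) D := by exact_mod_cast five_dvd_ell hy D
  have h2 : (5 : ℤ) ∣ degHom (ZMod 2) K D := by
    rw [degHom_apply]
    exact Finset.dvd_sum fun p _ ↦ Dvd.dvd.mul_left (by exact_mod_cast five_dvd_placeDegree hy p) _
  omega

theorem genus_ne_four_of_finrank_eq_one [CharP K 2] (h1 : Module.finrank k2 K = 1)
    (hh : classNumber (ZMod 2) K = 1) : genus (ZMod 2) K ≠ 4 := fun h ↦ by
  obtain ⟨-, D, hD⟩ := genus_eq_four_iff.1 h
  obtain ⟨p, hp⟩ := exists_tC_notMem (K := K)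
  have ht0 : tC K ≠ 0 := ne_zero_of_notMem hp
  have hv := coord_not_mem_iff.1 hp
  have hc0 : algebraMap k2 K (coord false) ≠ 0 := (_root_.map_ne_zero _).2 (coord_ne_zero false)
  have hX : ∀ q : Place (ZMod 2) K, q.1.valuation (algebraMap k2 K (coord false)) < 1 →
      q.1.valuation (evc K false X) < 1 := fun q hq ↦ by rwa [evc_X]
  have hpos := one_le_ordAt_of_valuation_lt_one hc0 hv
  have hdeg : (1 : ℤ) ≤ placeDegree (ZMod 2) p := by exact_mod_cast placeDegree_pos p
  have hle := ordAt_mul_placeDegree_le (K := K) (b := false) irreducible_X (coord_false_mem hp)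
    (hX p hv)
  rw [evc_X, h1, natDegree_X] at hle
  have hdeg1 : (placeDegree (ZMod 2) p : ℤ) = 1 := by push_cast at hle; nlinarith
  have hord1 : ordAt p.1 (algebraMap k2 K (coord false)) = 1 := by push_cast at hle; nlinarith
  have hord : ordAt p.1 (tC K) = -1 := by
    rw [ordAt_coord_false] at hord1
    exact neg_eq_iff_eq_neg.1 hord1
  have hmem : ∀ q : Place (ZMod 2) K, q ≠ p → tC K ∈ q.1 := fun q hq ↦ by
    by_contra hqT
    refine hq (eq_of_le_ordAt_mul_placeDegree (b := false) irreducible_X (coord_false_mem hp)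
      (hX p hv) (coord_false_mem hqT) (hX q (coord_not_mem_iff.1 hqT)) ?_)
    rw [evc_X, h1, natDegree_X, hord1, hdeg1]
    simp
  have hpow : ∀ m : ℕ,
      tC K ^ m ∈ RRspace (ZMod 2) (Finsupp.single p (m : ℤ) : Divisor (ZMod 2) K) := fun m ↦
    mem_RRspace_single hord ht0 (by rw [div_self (pow_ne_zero m ht0)]; exact one_mem _)
      fun q hq ↦ pow_mem (hmem q hq) m
  have hell : ∀ m : ℕ,
      m + 1 ≤ ell (ZMod 2) (Finsupp.single p (m : ℤ) : Divisor (ZMod 2) K) := fun m ↦ by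
    induction m with
    | zero => exact ell_pos one_ne_zero (by simpa using hpow 0)
    | succ m ih =>
      have hle : (Finsupp.single p (m : ℤ) : Divisor (ZMod 2) K) ≤
          Finsupp.single p ((m + 1 : ℕ) : ℤ) := Finsupp.single_mono (by simp)
      have hlt : RRspace (ZMod 2) (Finsupp.single p (m : ℤ) : Divisor (ZMod 2) K) <
          RRspace (ZMod 2) (Finsupp.single p ((m + 1 : ℕ) : ℤ)) := by
        refine lt_of_le_of_ne (RRspace_mono hle) fun heq ↦ ?_
        have h2 := hpow (m + 1)
        rw [← heq] at h2
        have h3 := (mem_RRspace_of_ne (pow_ne_zero (m + 1) ht0)).1 h2 p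
        rw [Finsupp.single_eq_same, ordAt_pow ht0, hord] at h3
        push_cast at h3
        omega
      have h4 : ell (ZMod 2) (Finsupp.single p (m : ℤ) : Divisor (ZMod 2) K) <
          ell (ZMod 2) (Finsupp.single p ((m + 1 : ℕ) : ℤ) : Divisor (ZMod 2) K) :=
        Submodule.finrank_lt_finrank_of_lt hlt
      omega
  have hdpos : 0 ≤ degHom (ZMod 2) K D := by omega
  obtain ⟨d, hd⟩ := Int.eq_ofNat_of_zero_le hdpos
  obtain ⟨f, hf, hdiv⟩ := classNumber_eq_one_iff.1 hh (D - Finsupp.single p (d : ℤ)) (by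
    rw [map_sub, degHom_single, hdeg1, hd]; ring)
  have h2 := ell_add_divOf (Finsupp.single p (d : ℤ)) hf
  rw [← hdiv, add_sub_cancel] at h2
  have h3 := hell d
  omega

end Excluded
end CFF

namespace CFF

section Restriction

variable {K C : Type*} [Field K] [Algebra k2 K] [FiniteDimensional k2 K]
  [Algebra.IsSeparable k2 K] [Algebra (ZMod 2) K] [Field C] [Algebra k2 C] [Algebra K C]
  [IsScalarTower k2 K C] [FiniteDimensional k2 C] [IsGalois k2 C] [Algebra (ZMod 2) C]
  [CharP C 2] [CharP K 2] {lam gam : C} {p : Place (ZMod 2) K} {P : Place (ZMod 2) C}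
  {φ x : C ≃ₐ[k2] C} {a e i : ℕ}

theorem CarlitzGen.isAbelianGalois (hC : CarlitzGen lam gam) : IsAbelianGalois k2 K :=
  have : IsAbelianGalois k2 C := { is_comm := ⟨hC.mul_comm⟩ }
  IsAbelianGalois.tower_bot k2 K C

theorem CarlitzGen.exists_restrict (hC : CarlitzGen lam gam) (x : C ≃ₐ[k2] C) :
    ∃ g : K ≃ₐ[k2] K, ∀ y, algebraMap K C (g y) = x (algebraMap K C y) :=
  have : IsAbelianGalois k2 K := hC.isAbelianGalois (C := C)
  ⟨x.restrictNormal K, AlgEquiv.restrictNormal_commutes x K⟩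

theorem CarlitzGen.restrict_comm (hC : CarlitzGen lam gam) (g h : K ≃ₐ[k2] K) : g * h = h * g :=
  have : IsAbelianGalois k2 K := hC.isAbelianGalois (C := C)
  mul_comm' g h

theorem pow_commutes_of_commutes {g : K ≃ₐ[k2] K}
    (h : ∀ y, algebraMap K C (g y) = x (algebraMap K C y)) (n : ℕ) (y : K) :
    algebraMap K C ((g ^ n) y) = (x ^ n) (algebraMap K C y) := by
  induction n generalizing y with
  | zero => rfl
  | succ n ih => rw [pow_succ, pow_succ, AlgEquiv.mul_apply, AlgEquiv.mul_apply, ih, h]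

theorem Acts.restrict_pow_eq_one (hC : CarlitzGen lam gam) (hx : Acts lam gam x e i)
    {g : K ≃ₐ[k2] K} (h : ∀ y, algebraMap K C (g y) = x (algebraMap K C y)) : g ^ 75 = 1 := by
  have h1 : x ^ 75 = 1 := hC.eq_of_acts (hx.pow 75) acts_one
    ((Nat.modEq_zero_iff_dvd).2 ⟨5 * e, by ring⟩) ((Nat.modEq_zero_iff_dvd).2 ⟨15 * i, by ring⟩)
  ext y
  apply (algebraMap K C).injective
  rw [pow_commutes_of_commutes h, h1, AlgEquiv.one_apply, AlgEquiv.one_apply]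

/-- An automorphism whose restriction stabilises the place below `P` is a power of the Frobenius
automorphism at `P`, up to an automorphism over `K`. -/
theorem IsFrob.exists_pow_mul_eq (hC : CarlitzGen lam gam) (hφ : IsFrob lam gam a P.1 φ)
    (hM : ¬ P.1.valuation (tC C ^ 4 + tC C + 1) < 1) (hp : P.1.comap (algebraMap K C) = p.1)
    {g : K ≃ₐ[k2] K} (h : ∀ y, algebraMap K C (g y) = x (algebraMap K C y))
    (hg : conj p g = p) : ∃ (d : ℕ) (s : C ≃ₐ[K] C), x * s.restrictScalars k2 = φ ^ d := by
  have hQ : (conj P x).1.comap (algebraMap K C) = p.1 := by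
    ext y
    change x (algebraMap K C y) ∈ P.1 ↔ y ∈ p.1
    rw [← h, mem_iff_of_comap hp, ← mem_conj, hg]
  obtain ⟨s, hs⟩ := exists_conj_above hp hQ
  obtain ⟨d, hd⟩ := hφ.exists_eq_pow hC hM (g := x * s.restrictScalars k2) hs
  exact ⟨d, s, hd⟩

theorem IsFrob.restrict (hφ : IsFrob lam gam a P.1 φ) (hp : P.1.comap (algebraMap K C) = p.1)
    {g : K ≃ₐ[k2] K} (h : ∀ y, algebraMap K C (g y) = φ (algebraMap K C y)) :
    ∀ y ∈ p.1, p.1.valuation (g y - y ^ 2) < 1 := fun y hy ↦ by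
  have := hφ.frob _ ((mem_iff_of_comap hp y).2 hy)
  rwa [← h, ← map_pow, ← map_sub, valuation_lt_one_iff_of_comap hp] at this

theorem exists_algebraMap_eq {y : C} (h : ∀ s : C ≃ₐ[K] C, s y = y) :
    ∃ z, algebraMap K C z = y := by
  have : FiniteDimensional K C := FiniteDimensional.right k2 K C
  have : IsGalois K C := IsGalois.tower_top_of_isGalois k2 K C
  exact IntermediateField.mem_bot.1 ((IsGalois.mem_bot_iff_fixed y).2 h)

theorem exists_algebraMap_eq_of_acts (hC : CarlitzGen lam gam) {σ τ : C ≃ₐ[k2] C}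
    (hσ : Acts lam gam σ 1 0) (hτ : Acts lam gam τ 0 1) {z : K}
    (h1 : σ (algebraMap K C z) = algebraMap K C z) (h2 : τ (algebraMap K C z) = algebraMap K C z) :
    ∃ s, algebraMap k2 K s = z := by
  obtain ⟨s, hs⟩ := IntermediateField.mem_bot.1
    ((IsGalois.mem_bot_iff_fixed (F := k2) (algebraMap K C z)).2 fun g ↦ by
      obtain ⟨e, i, hg⟩ := hC.exists_acts g
      have hpow : ∀ (x : C ≃ₐ[k2] C) (n : ℕ), x (algebraMap K C z) = algebraMap K C z →
          (x ^ n) (algebraMap K C z) = algebraMap K C z := fun x n hx ↦ by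
        induction n with
        | zero => rfl
        | succ n ih => rw [pow_succ, AlgEquiv.mul_apply, hx, ih]
      have : g = σ ^ e * τ ^ i := hC.eq_of_acts hg ((hσ.pow e).mul (hτ.pow i))
        (by simp [Nat.ModEq]) (by simp [Nat.ModEq])
      rw [this, AlgEquiv.mul_apply, hpow _ _ h2, hpow _ _ h1])
  refine ⟨s, (algebraMap K C).injective ?_⟩
  rw [← IsScalarTower.algebraMap_apply, hs]

end Restriction
end CFF

namespace CFF

section Uniqueness

variable {K C : Type*} [Field K] [Algebra k2 K] [FiniteDimensional k2 K]
  [Algebra.IsSeparable k2 K] [Algebra (ZMod 2) K] [Field C] [Algebra k2 C] [Algebra K C]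
  [IsScalarTower k2 K C] [FiniteDimensional k2 C] [IsGalois k2 C] [Algebra (ZMod 2) C]
  [CharP C 2] [CharP K 2] {lam gam : C} {P : Place (ZMod 2) C} {φ g : C ≃ₐ[k2] C} {a e i : ℕ}

theorem IsFrob.apply_eq_sq (hφ : IsFrob lam gam a P.1 φ) {y : C} (hy : IsIntegral (ZMod 2) y) :
    φ y = y ^ 2 := by
  have h1 := hφ.frob y (mem_of_isIntegral P.2.2 hy)
  have hφy : IsIntegral (ZMod 2) (φ y) :=
    hy.map_of_comp_eq (RingHom.id _) (φ : C →+* C) (RingHom.ext_zmod _ _)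
  have : Algebra.IsSeparable k2 C := inferInstance
  exact sub_eq_zero.1 (eq_zero_of_isIntegral_of_valuation_lt_one (hφy.sub (hy.pow 2)) h1)

theorem IsFrob.pow_apply (hφ : IsFrob lam gam a P.1 φ) {y : C} (hy : IsIntegral (ZMod 2) y)
    (n : ℕ) : (φ ^ n) y = y ^ 2 ^ n := by
  induction n with
  | zero => simp
  | succ n ih => rw [pow_succ', AlgEquiv.mul_apply, ih, map_pow, hφ.apply_eq_sq hy, ← pow_mul,
      pow_succ']

/-- If every automorphism of `C` over `K` fixes `gam`, then `gam` comes from `K`. -/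
theorem exists_gamma_of_forall (hC : CarlitzGen lam gam)
    (h : ∀ (s : C ≃ₐ[K] C) (e i : ℕ), Acts lam gam (s.restrictScalars k2) e i → 5 ∣ i) :
    ∃ y : K, y ^ 5 + y ^ 2 + 1 = 0 := by
  obtain ⟨y, hy⟩ := exists_algebraMap_eq (K := K) (y := gam) fun s ↦ by
    obtain ⟨e, i, hs⟩ := hC.exists_acts (s.restrictScalars k2)
    have h1 : gam ^ 2 ^ i = gam ^ 2 ^ 0 :=
      (pow_two_pow_eq_iff hC.gam_eq).2 ((Nat.modEq_zero_iff_dvd).2 (h s e i hs))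
    have h2 := hs.2
    rw [h1, pow_zero, pow_one] at h2
    exact h2
  refine ⟨y, (algebraMap K C).injective ?_⟩
  rw [map_add, map_add, map_pow, map_pow, hy, map_one, map_zero, hC.gam_eq]

theorem eq_one_of_isIntegral (hC : CarlitzGen lam gam) (hg : ∀ y : K, y ^ 5 + y ^ 2 + 1 ≠ 0)
    {c : K} (hc : IsIntegral (ZMod 2) c) (h0 : c ≠ 0) : c = 1 := by
  by_contra h1
  obtain ⟨P, τ, -, hτ⟩ := exists_isFrob_infty hC
  obtain ⟨Q, φ, -, hφ⟩ := exists_isFrob_zero hC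
  set z := algebraMap K C c with hz
  have hzint : IsIntegral (ZMod 2) z :=
    hc.map_of_comp_eq (RingHom.id _) (algebraMap K C) (RingHom.ext_zmod _ _)
  have hτz := fun n ↦ hτ.pow_apply hzint n
  have hφz := fun n ↦ hφ.pow_apply hzint n
  have h5 : z ^ 2 ^ 5 = z := by
    rw [← hτz, show τ ^ 5 = 1 from hC.eq_of_acts (hτ.acts.pow 5) acts_one rfl rfl]; rfl
  obtain ⟨y, hy⟩ := exists_gamma_of_forall hC (K := K) fun s e i hs ↦ by
    by_contra hi
    have hsz : (s.restrictScalars k2) z = z := s.commutes c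
    have hmul : s.restrictScalars k2 = φ ^ e * τ ^ (4 * e + i) :=
      hC.eq_of_acts hs ((hφ.acts.pow e).mul (hτ.acts.pow (4 * e + i))) (by simp [Nat.ModEq])
        (by rw [Nat.ModEq]; omega)
    rw [hmul, AlgEquiv.mul_apply, hτz, map_pow, hφz, ← pow_mul, ← pow_add] at hsz
    have p1 : Function.IsPeriodicPt (frobenius C 2) 5 z := by
      rw [Function.IsPeriodicPt, Function.IsFixedPt, iterate_frobenius, h5]
    have p2 : Function.IsPeriodicPt (frobenius C 2) (e + (4 * e + i)) z := by
      rw [Function.IsPeriodicPt, Function.IsFixedPt, iterate_frobenius, hsz]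
    have p3 := p1.gcd p2
    have hgcd : Nat.gcd 5 (e + (4 * e + i)) = 1 :=
      (Nat.Prime.coprime_iff_not_dvd Nat.prime_five).2 (by omega)
    rw [hgcd, Function.IsPeriodicPt, Function.IsFixedPt, iterate_frobenius] at p3
    have : z * (z - 1) = 0 := by linear_combination p3
    rcases mul_eq_zero.1 this with h | h
    · exact h0 ((map_eq_zero _).1 h)
    · exact h1 ((algebraMap K C).injective (by rw [← hz, map_one]; exact sub_eq_zero.1 h))
  exact hg y hy

theorem exists_acts_of_infinity (hC : CarlitzGen lam gam) (h4 : genus (ZMod 2) K = 4)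
    (hh : classNumber (ZMod 2) K = 1) :
    ∃ (d : ℕ) (s : C ≃ₐ[K] C), Acts lam gam (s.restrictScalars k2) 14 d := by
  have hR := (genus_eq_four_iff.1 h4).1
  have hconst : ∀ c : K, IsIntegral (ZMod 2) c → c ≠ 0 → c = 1 := fun c ↦
    eq_one_of_isIntegral hC fun y hy ↦ genus_ne_four_of_gamma hy h4
  obtain ⟨P, τ, hP, hτ⟩ := exists_isFrob_infty hC
  obtain ⟨σ, hσ⟩ := hC.exists_acts_eq 1 0
  obtain ⟨p, hp⟩ := exists_place_below K P
  obtain ⟨g, hg⟩ := hC.exists_restrict (K := K) σ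
  obtain ⟨t, ht⟩ := hC.exists_restrict (K := K) τ
  have hpT : tC K ∉ p.1 := fun h ↦ hP (by
    rw [← algebraMap_tC (K := K)]
    exact (mem_iff_of_comap hp _).2 h)
  have hconj : conj p g = p := conj_eq_of_infinity hC hconst (fun a b ↦ hC.restrict_comm a b)
    (hτ.restrict hp ht) hh hR hpT hσ hg (hσ.restrict_pow_eq_one hC hg) fun x h1 h2 ↦
      exists_algebraMap_eq_of_acts hC hσ hτ.acts (by rw [← hg, h2]) (by rw [← ht, h1])
  obtain ⟨d, s, hs⟩ := hτ.exists_pow_mul_eq hC (fun h ↦ hP (tC_mem_of_valuation_lt_one h)) hp hg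
    hconj
  obtain ⟨e, i, hei⟩ := hC.exists_acts (s.restrictScalars k2)
  obtain ⟨h1, h2⟩ := hC.modEq_of_acts (hs ▸ hσ.mul hei) (hτ.acts.pow d)
  refine ⟨i, s, ?_, hei.2⟩
  rw [hei.1, hC.torsion.iterate_eq_iff hC.ne_zero]
  rw [Nat.ModEq] at h1 ⊢
  omega

/-- At a rational finite place with Frobenius automorphism `(a, 1)`, the stabiliser contains the
constant Frobenius. -/
theorem exists_acts_of_isFrob (hC : CarlitzGen lam gam) (h4 : genus (ZMod 2) K = 4)
    (hh : classNumber (ZMod 2) K = 1) (hφ : IsFrob lam gam a P.1 φ)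
    (hM : ¬ P.1.valuation (tC C ^ 4 + tC C + 1) < 1) :
    ∃ (d i : ℕ) (s : C ≃ₐ[K] C), Acts lam gam (s.restrictScalars k2) (d * a) i ∧
      1 + i ≡ d [MOD 5] := by
  have hR := (genus_eq_four_iff.1 h4).1
  have hconst : ∀ c : K, IsIntegral (ZMod 2) c → c ≠ 0 → c = 1 := fun c ↦
    eq_one_of_isIntegral hC fun y hy ↦ genus_ne_four_of_gamma hy h4
  obtain ⟨τ, hτ⟩ := hC.exists_acts_eq 0 1
  obtain ⟨p, hp⟩ := exists_place_below K P
  obtain ⟨g, hg⟩ := hC.exists_restrict (K := K) τ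
  obtain ⟨t, ht⟩ := hC.exists_restrict (K := K) φ
  have h3 : conj p (g ^ 3) = p := conj_pow_three_eq hconst (fun a b ↦ hC.restrict_comm a b)
    (hφ.restrict hp ht) hh hR (hτ.restrict_pow_eq_one hC hg)
  have hτ6 : (τ ^ 3) ^ 2 = τ := hC.eq_of_acts ((hτ.pow 3).pow 2) hτ rfl rfl
  obtain ⟨d, s, hs⟩ := hφ.exists_pow_mul_eq hC hM hp (x := (τ ^ 3) ^ 2)
    (pow_commutes_of_commutes (pow_commutes_of_commutes hg 3) 2) (conj_pow_eq h3 2)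
  rw [hτ6] at hs
  obtain ⟨e, i, hei⟩ := hC.exists_acts (s.restrictScalars k2)
  obtain ⟨h1, h2⟩ := hC.modEq_of_acts (hs ▸ hτ.mul hei) (hφ.acts.pow d)
  refine ⟨d, i, s, ⟨?_, hei.2⟩, by simpa using h2⟩
  rw [hei.1, hC.torsion.iterate_eq_iff hC.ne_zero]
  simpa using h1

theorem Acts.restrictScalars_pow {s : C ≃ₐ[K] C} (hs : Acts lam gam (s.restrictScalars k2) e i)
    (n : ℕ) : Acts lam gam ((s ^ n).restrictScalars k2) (n * e) (n * i) := by
  have : (s ^ n).restrictScalars k2 = (s.restrictScalars k2) ^ n := by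
    induction n with
    | zero => rfl
    | succ n ih => rw [pow_succ, pow_succ, ← ih]; rfl
  exact this ▸ hs.pow n

theorem finrank_eq_one_of_acts (hC : CarlitzGen lam gam) {s t : C ≃ₐ[K] C} {d i : ℕ}
    (hs : Acts lam gam (s.restrictScalars k2) 14 d) (ht : Acts lam gam (t.restrictScalars k2) 0 i)
    (hi : ¬ 5 ∣ i) : Module.finrank k2 K = 1 := by
  have hall : ∀ (g : C ≃ₐ[k2] C) (y : K), g (algebraMap K C y) = algebraMap K C y := fun g y ↦ by
    obtain ⟨e', i', hg⟩ := hC.exists_acts g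
    have h3 : i ^ 4 ≡ 1 [MOD 5] := by
      have : i % 5 = 1 ∨ i % 5 = 2 ∨ i % 5 = 3 ∨ i % 5 = 4 := by omega
      rw [Nat.ModEq, Nat.pow_mod]
      rcases this with h | h | h | h <;> rw [h]
    have h : g = (s.restrictScalars k2) ^ (14 * e') *
        (t.restrictScalars k2) ^ (i ^ 3 * (i' + e' * d)) := by
      refine hC.eq_of_acts hg ((hs.pow _).mul (ht.pow _)) ?_ ?_
      · rw [Nat.ModEq]; omega
      · have := h3.mul_right (i' + e' * d)
        rw [show i ^ 3 * (i' + e' * d) * i = i ^ 4 * (i' + e' * d) by ring]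
        refine Nat.ModEq.trans ?_ (this.symm.add_left _)
        rw [show 14 * e' * d + 1 * (i' + e' * d) = i' + 5 * (3 * (e' * d)) by ring, Nat.ModEq]
        omega
    have hfix : ∀ (u : C ≃ₐ[K] C) n, ((u.restrictScalars k2) ^ n) (algebraMap K C y) =
        algebraMap K C y := fun u n ↦ by
      induction n with
      | zero => rfl
      | succ n ih => rw [pow_succ, AlgEquiv.mul_apply, AlgEquiv.restrictScalars_apply, u.commutes,
          ih]
    rw [h, AlgEquiv.mul_apply, hfix, hfix]
  refine finrank_eq_one 1 one_ne_zero fun y ↦ ?_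
  obtain ⟨σ, hσ⟩ := hC.exists_acts_eq 1 0
  obtain ⟨τ, hτ⟩ := hC.exists_acts_eq 0 1
  obtain ⟨s, hs⟩ := exists_algebraMap_eq_of_acts hC hσ hτ (hall σ y) (hall τ y)
  exact ⟨s, by rw [← hs, Algebra.algebraMap_eq_smul_one]⟩

theorem exists_forall_acts_iff (hC : CarlitzGen lam gam) (h4 : genus (ZMod 2) K = 4)
    (hh : classNumber (ZMod 2) K = 1) : ∃ d, (d = 2 ∨ d = 3) ∧ ∀ (g : C ≃ₐ[k2] C) (e i : ℕ),
      Acts lam gam g e i →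
        ((∀ y : K, g (algebraMap K C y) = algebraMap K C y) ↔ 5 ∣ i + d * e) := by
  obtain ⟨d, s, hs⟩ := exists_acts_of_infinity (K := K) hC h4 hh
  have hrel : ∀ (t : C ≃ₐ[K] C) (e i : ℕ), Acts lam gam (t.restrictScalars k2) e i →
      5 ∣ i + d * e := fun t e i ht ↦ by
    by_contra hi
    have h1 : Acts lam gam ((t * s ^ e).restrictScalars k2) (e + e * 14) (i + e * d) :=
      ht.mul (hs.restrictScalars_pow e)
    refine genus_ne_four_of_finrank_eq_one
      (finrank_eq_one_of_acts hC hs (t := t * s ^ e) (i := i + d * e) ⟨?_, ?_⟩ hi) hh h4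
    · rw [h1.1, hC.torsion.iterate_eq_iff hC.ne_zero, Nat.ModEq]; omega
    · rw [h1.2, mul_comm]
  have hd0 : d % 5 ≠ 0 := fun h0 ↦ by
    obtain ⟨y, hy⟩ := exists_gamma_of_forall (K := K) hC fun t e i ht ↦ by
      have h1 := hrel t e i ht
      exact (Nat.dvd_add_left ((Nat.dvd_of_mod_eq_zero h0).mul_right e)).1 h1
    exact genus_ne_four_of_gamma hy h4
  have hd4 : d % 5 ≠ 4 := fun h0 ↦ by
    obtain ⟨P, φ, hv, hφ⟩ := exists_isFrob_zero hC
    obtain ⟨c, i, t, ht, hi⟩ := exists_acts_of_isFrob (K := K) hC h4 hh hφ (fun hM ↦ by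
      have ht : tC C ∈ P.1 := (P.1.valuation_le_one_iff _).1 hv.le
      have h1 : P.1.valuation (tC C ^ 4 + tC C) < 1 := by
        rw [show tC C ^ 4 + tC C = tC C * (tC C ^ 3 + 1) by ring, map_mul]
        exact mul_lt_one_of_lt_of_le hv
          ((P.1.valuation_le_one_iff _).2 (add_mem (pow_mem ht 3) (one_mem _)))
      have h2 := Valuation.map_sub_lt _ hM h1
      rw [add_sub_cancel_left, map_one] at h2
      exact lt_irrefl _ h2)
    have h1 := hrel t _ i ht
    rw [Nat.ModEq] at hi
    have h2 : d * (c * 1) % 5 = (4 * c) % 5 := by rw [mul_one, Nat.mul_mod, h0]; omega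
    omega
  have hd1 : d % 5 ≠ 1 := fun h0 ↦ by
    obtain ⟨P, φ, hv, hφ⟩ := exists_isFrob_one hC
    obtain ⟨c, i, t, ht, hi⟩ := exists_acts_of_isFrob (K := K) hC h4 hh hφ (fun hM ↦ by
      have two : (2 : C) = 0 := CharTwo.two_eq_zero
      have ht : tC C ∈ P.1 := by
        have := sub_mem ((P.1.valuation_le_one_iff _).1 hv.le) (one_mem P.1)
        rwa [add_sub_cancel_right] at this
      have h1 : P.1.valuation (tC C ^ 4 + tC C) < 1 := by
        rw [show tC C ^ 4 + tC C = (tC C + 1) * (tC C * (tC C ^ 2 + tC C + 1)) by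
          linear_combination (-tC C ^ 3 - tC C ^ 2) * two, map_mul]
        exact mul_lt_one_of_lt_of_le hv ((P.1.valuation_le_one_iff _).2
          (mul_mem ht (add_mem (add_mem (pow_mem ht 2) ht) (one_mem _))))
      have h2 := Valuation.map_sub_lt _ hM h1
      rw [add_sub_cancel_left, map_one] at h2
      exact lt_irrefl _ h2)
    have h1 := hrel t _ i ht
    rw [Nat.ModEq] at hi
    have h2 : d * (c * 4) % 5 = (4 * c) % 5 := by rw [Nat.mul_mod, h0]; omega
    omega
  have hd : d % 5 = 2 ∨ d % 5 = 3 := by omega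
  refine ⟨d % 5, hd, fun g e i hg ↦ ?_⟩
  have hmod : 5 ∣ i + d % 5 * e ↔ 5 ∣ i + d * e := by
    rw [Nat.dvd_iff_mod_eq_zero, Nat.dvd_iff_mod_eq_zero, Nat.add_mod, Nat.mod_mul_mod,
      ← Nat.add_mod]
  rw [hmod]
  constructor
  · intro h
    exact hrel (AlgEquiv.ofRingEquiv (f := g.toRingEquiv) h) e i hg
  · intro h y
    have : g = (s ^ (14 * e)).restrictScalars k2 :=
      hC.eq_of_acts hg (hs.restrictScalars_pow (14 * e)) (by rw [Nat.ModEq]; omega) (by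
        rw [Nat.ModEq, mul_assoc, mul_comm e d]; omega)
    rw [this]
    exact (s ^ (14 * e)).commutes y

end Uniqueness
end CFF

namespace CFF

section Translate

variable {R : Type*} [CommRing R] [CharP R 2] {t x : R}

theorem isTorsion_add_one : IsTorsion (t + 1) x ↔ IsTorsion t x := by
  have two : (2 : R) = 0 := CharTwo.two_eq_zero
  have e1 : (t + 1) ^ 4 + (t + 1) = t ^ 4 + t := by
    linear_combination (2 * t ^ 3 + 3 * t ^ 2 + 2 * t + 1) * two
  have e2 : (t + 1) ^ 4 + (t + 1) ^ 2 = t ^ 4 + t ^ 2 := by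
    linear_combination (2 * t ^ 3 + 3 * t ^ 2 + 3 * t + 1) * two
  have e3 : (t + 1) ^ 2 + (t + 1) + 1 = t ^ 2 + t + 1 := by
    linear_combination (t + 1) * two
  rw [isTorsion_iff, isTorsion_iff, e1, e2, e3]

theorem IsTorsion.iterate_add_one (h : IsTorsion t x) (e : ℕ) :
    (carlitzAct (t + 1))^[e] x = (carlitzAct t)^[4 * e] x := by
  induction e with
  | zero => rfl
  | succ e ih =>
    rw [Function.iterate_succ_apply', ih, mul_add, mul_one, add_comm (4 * e),
      Function.iterate_add_apply, h.iterate (4 * e), carlitzAct_apply, carlitzAct_apply]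
    ring

end Translate

section Twist

variable {C : Type*} [Field C] [Algebra k2 C] [FiniteDimensional k2 C] [IsGalois k2 C]
  [CharP C 2] {lam gam : C} {g : C ≃ₐ[k2] C} {e i : ℕ}

theorem Acts.apply_of_isTorsion (hC : CarlitzGen lam gam) (hg : Acts lam gam g e i) {x : C}
    (hx : IsTorsion (tC C) x) : g x = (carlitzAct (tC C))^[e] x := by
  rcases eq_or_ne x 0 with rfl | h0
  · rw [map_zero, Function.iterate_fixed (map_zero _)]
  · obtain ⟨n, -, rfl⟩ := hC.torsion.exists_iterate hC.ne_zero hx h0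
    rw [map_carlitzAct_aut, hg.1, ← Function.iterate_add_apply, ← Function.iterate_add_apply,
      add_comm]

theorem Acts.apply_of_gamma (hC : CarlitzGen lam gam) (hg : Acts lam gam g e i) {z : C}
    (hz : z ^ 5 + z ^ 2 + 1 = 0) : g z = z ^ 2 ^ i := by
  obtain ⟨j, rfl⟩ := exists_eq_gamma_pow hC.gam_eq hz
  rw [map_pow, hg.2, ← pow_mul, ← pow_mul, mul_comm]

/-- Conjugation by a lift of `T ↦ T + 1` multiplies the exponent of `T` by four. -/
theorem Acts.exists_conj (hC : CarlitzGen lam gam) (hg : Acts lam gam g e i) (Φ : C ≃+* C)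
    (ψ : k2 ≃+* k2) (hΦ : ∀ r, Φ (algebraMap k2 C r) = algebraMap k2 C (ψ r))
    (hT : Φ (tC C) = tC C + 1) :
    ∃ g' : C ≃ₐ[k2] C, (∀ x, g' (Φ x) = Φ (g x)) ∧ Acts lam gam g' (4 * e) i := by
  let g' : C ≃ₐ[k2] C := AlgEquiv.ofRingEquiv (f := (Φ.symm.trans g.toRingEquiv).trans Φ) fun r ↦ by
    have h1 : Φ.symm (algebraMap k2 C r) = algebraMap k2 C (ψ.symm r) := by
      rw [RingEquiv.symm_apply_eq, hΦ, RingEquiv.apply_symm_apply]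
    change Φ (g (Φ.symm (algebraMap k2 C r))) = _
    rw [h1, g.commutes, hΦ, RingEquiv.apply_symm_apply]
  have hg' : ∀ x, g' x = Φ (g (Φ.symm x)) := fun _ ↦ rfl
  refine ⟨g', fun x ↦ by rw [hg', RingEquiv.symm_apply_apply], ?_, ?_⟩
  · have hlam : IsTorsion (tC C) (Φ.symm lam) := by
      have h1 : Φ.symm (tC C) = tC C + 1 := by
        rw [RingEquiv.symm_apply_eq, map_add, hT, map_one, add_assoc, CharTwo.add_self_eq_zero,
          add_zero]
      have h2 := hC.torsion.map (Φ.symm : C →+* C)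
      rw [RingEquiv.coe_toRingHom, h1] at h2
      exact isTorsion_add_one.1 h2
    have h3 := map_carlitzAct_iterate (Φ : C →+* C) (tC C) (Φ.symm lam) e
    rw [RingEquiv.coe_toRingHom, hT, RingEquiv.apply_symm_apply] at h3
    rw [hg', hg.apply_of_isTorsion hC hlam, h3, hC.torsion.iterate_add_one]
  · rw [hg', hg.apply_of_gamma hC (z := Φ.symm gam) (by
      rw [← map_pow, ← map_pow, ← map_add, ← map_one Φ.symm, ← map_add, hC.gam_eq, map_zero]),
      map_pow, RingEquiv.apply_symm_apply]

end Twist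

section Transfer

variable {K K' C : Type*} [Field K] [Field K'] [Algebra k2 K] [Algebra k2 K'] [Field C]
  [Algebra k2 C] [Algebra K C] [Algebra K' C] [IsScalarTower k2 K C] [IsScalarTower k2 K' C]
  [FiniteDimensional k2 C] [IsGalois k2 C] [Algebra (ZMod 2) C] [CharP C 2]
  [Algebra (ZMod 2) K] [CharP K 2] [Algebra (ZMod 2) K'] [CharP K' 2] {lam gam : C} {d d' : ℕ}

theorem exists_algebraMap_eq_of_forall [FiniteDimensional k2 K] [Algebra.IsSeparable k2 K]
    (hC : CarlitzGen lam gam)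
    (hK : ∀ (g : C ≃ₐ[k2] C) (e i : ℕ), Acts lam gam g e i →
      ((∀ y : K, g (algebraMap K C y) = algebraMap K C y) ↔ 5 ∣ i + d * e)) {x : C}
    (hx : ∀ (g : C ≃ₐ[k2] C) (e i : ℕ), Acts lam gam g e i → 5 ∣ i + d * e → g x = x) :
    ∃ z, algebraMap K C z = x :=
  exists_algebraMap_eq fun s ↦ by
    obtain ⟨e, i, hs⟩ := hC.exists_acts (s.restrictScalars k2)
    exact hx _ e i hs ((hK _ e i hs).1 s.commutes)

theorem exists_algebraMap_eq_apply [FiniteDimensional k2 K'] [Algebra.IsSeparable k2 K']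
    (hC : CarlitzGen lam gam) (Φ : C ≃+* C) (ψ : k2 ≃+* k2)
    (hΦ : ∀ r, Φ (algebraMap k2 C r) = algebraMap k2 C (ψ r)) (hT : Φ (tC C) = tC C + 1)
    (hK : ∀ (g : C ≃ₐ[k2] C) (e i : ℕ), Acts lam gam g e i →
      ((∀ y : K, g (algebraMap K C y) = algebraMap K C y) ↔ 5 ∣ i + d * e))
    (hK' : ∀ (g : C ≃ₐ[k2] C) (e i : ℕ), Acts lam gam g e i →
      ((∀ y : K', g (algebraMap K' C y) = algebraMap K' C y) ↔ 5 ∣ i + d' * e))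
    (hd : 5 ∣ d + d') (y : K) : ∃ z : K', algebraMap K' C z = Φ (algebraMap K C y) := by
  refine exists_algebraMap_eq_of_forall hC hK' fun g' e i hg' hi ↦ ?_
  have hsymm : ∀ r, Φ.symm (algebraMap k2 C r) = algebraMap k2 C (ψ.symm r) := fun r ↦ by
    rw [RingEquiv.symm_apply_eq, hΦ, RingEquiv.apply_symm_apply]
  obtain ⟨g, hg, ha⟩ := hg'.exists_conj hC Φ.symm ψ.symm hsymm (by
    rw [RingEquiv.symm_apply_eq, map_add, hT, map_one, add_assoc, CharTwo.add_self_eq_zero,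
      add_zero])
  have h5 : 5 ∣ i + d * (4 * e) := by
    have e1 : i + d * (4 * e) + 5 * (d' * e) = i + d' * e + (d + d') * (4 * e) := by ring
    have := Nat.dvd_add hi (hd.mul_right (4 * e))
    rw [← e1] at this
    exact (Nat.dvd_add_left (Nat.dvd_mul_right 5 _)).1 this
  have h1 := (hK g _ i ha).2 h5 y
  have h2 := hg (Φ (algebraMap K C y))
  rw [RingEquiv.symm_apply_apply, h1] at h2
  exact Φ.symm_apply_eq.1 h2.symm

end Transfer
end CFF

namespace CFF

open Polynomial

section CarlitzPolynomial

variable {x : Omega2}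

theorem carlitzIter_eq (n : ℕ) :
    carlitzIter n = (carlitzAct (C RatFunc.X : k2[X]))^[n] X := by
  induction n with
  | zero => rfl
  | succ n ih =>
    rw [carlitzIter, Function.iterate_succ_apply', ← ih, carlitzT, carlitzAct_apply]
    simp

theorem carlitz_M0 : carlitz M0 = carlitzIter 4 + carlitzIter 1 + carlitzIter 0 := by
  have h0 : ∀ i, C (algebraMap (ZMod 2) k2 0) * carlitzIter i = 0 := fun i ↦ by
    rw [map_zero, C_0, zero_mul]
  have hadd : ∀ i (a b : ZMod 2), C (algebraMap (ZMod 2) k2 (a + b)) * carlitzIter i =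
      C (algebraMap (ZMod 2) k2 a) * carlitzIter i +
        C (algebraMap (ZMod 2) k2 b) * carlitzIter i := fun i a b ↦ by
    rw [map_add, C_add, add_mul]
  have hM : M0 = monomial 4 1 + monomial 1 1 + monomial 0 1 := by
    rw [M0, ← X_pow_eq_monomial, monomial_one_one_eq_X, monomial_zero_one]
  rw [carlitz, hM, sum_add_index _ _ _ h0 hadd, sum_add_index _ _ _ h0 hadd,
    sum_monomial_index _ _ (h0 _), sum_monomial_index _ _ (h0 _), sum_monomial_index _ _ (h0 _)]
  simp only [map_one, one_mul]

theorem carlitz_M0_eq : carlitz M0 = X ^ 16 + C (RatFunc.X ^ 4 + RatFunc.X + 1) *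
    (C (RatFunc.X ^ 4 + RatFunc.X) * X ^ 8 + C (RatFunc.X ^ 4 + RatFunc.X ^ 2) * X ^ 4 +
      C (RatFunc.X ^ 2 + RatFunc.X + 1) * X ^ 2 + X) := by
  have two : (2 : k2[X]) = 0 := CharTwo.two_eq_zero
  rw [carlitz_M0, carlitzIter_eq, carlitzIter_eq, carlitzIter_eq, carlitzAct_iterate_four,
    Function.iterate_one, Function.iterate_zero, id, carlitzAct_apply]
  simp only [map_add, map_pow, map_one]
  generalize (C RatFunc.X : k2[X]) = t
  linear_combination (-(X ^ 2 * t + X ^ 2 * t ^ 2 + X ^ 8 * t ^ 5)) * two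

theorem aeval_carlitz_M0 : aeval x (carlitz M0) = 0 ↔ IsTorsion (tC Omega2) x := by
  rw [isTorsion_iff, carlitz_M0_eq]
  simp only [map_add, map_mul, map_pow, map_one, aeval_C, aeval_X]
  rfl

theorem M0_ne_zero : (RatFunc.X ^ 4 + RatFunc.X + 1 : k2) ≠ 0 := by
  intro h
  exact irreducible_M0.ne_zero (evc_injective (K := k2) true
    (evc_M0.trans (h.trans (map_zero _).symm)))

theorem separable_carlitz_M0 : (carlitz M0).Separable := by
  have two : (2 : k2[X]) = 0 := CharTwo.two_eq_zero
  have hd : derivative (carlitz M0) = C (RatFunc.X ^ 4 + RatFunc.X + 1) := by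
    rw [carlitz_M0_eq]
    simp only [derivative_add, derivative_mul, derivative_X_pow, derivative_C, derivative_X]
    push_cast
    simp only [map_ofNat]
    linear_combination (8 * X ^ 15 + C (RatFunc.X ^ 4 + RatFunc.X + 1) *
      (X * C (RatFunc.X ^ 2 + RatFunc.X + 1) + 2 * X ^ 3 * C (RatFunc.X ^ 4 + RatFunc.X ^ 2) +
        4 * X ^ 7 * C (RatFunc.X ^ 4 + RatFunc.X))) * two
  refine ⟨0, C (RatFunc.X ^ 4 + RatFunc.X + 1)⁻¹, ?_⟩
  rw [hd, ← C_mul, inv_mul_cancel₀ M0_ne_zero]; simp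

theorem carlitz_M0_ne_zero : carlitz M0 ≠ 0 := separable_carlitz_M0.ne_zero

theorem mem_rootSet_carlitz : x ∈ (carlitz M0).rootSet Omega2 ↔ IsTorsion (tC Omega2) x := by
  rw [mem_rootSet, aeval_carlitz_M0, and_iff_right carlitz_M0_ne_zero]

theorem exists_isTorsion : ∃ x : Omega2, IsTorsion (tC Omega2) x ∧ x ≠ 0 := by
  have hcard : ((carlitz M0).rootSet Omega2).ncard = 16 := by
    rw [← Nat.card_coe_set_eq, Nat.card_eq_fintype_card, card_rootSet_eq_natDegree
      separable_carlitz_M0 (IsAlgClosed.splits _), carlitz_M0_eq]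
    compute_degree!
  obtain ⟨x, hx, h0⟩ := Set.exists_ne_of_one_lt_ncard
    (show 1 < ((carlitz M0).rootSet Omega2).ncard by rw [hcard]; norm_num) 0
  exact ⟨x, mem_rootSet_carlitz.1 hx, h0⟩

end CarlitzPolynomial

section Compositum

theorem exists_gamma : ∃ z : Omega2, z ^ 5 + z ^ 2 + 1 = 0 := by
  obtain ⟨z, hz⟩ := IsAlgClosed.exists_root (X ^ 5 + X ^ 2 + 1 : Omega2[X]) (by
    rw [show (X ^ 5 + X ^ 2 + 1 : Omega2[X]).degree = 5 by compute_degree!]; norm_num)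
  exact ⟨z, by simpa [IsRoot.def] using hz⟩

theorem pow_eq_self_of_gamma {R : Type*} [Field R] [CharP R 2] {z : R}
    (hz : z ^ 5 + z ^ 2 + 1 = 0) : z ^ 32 = z := by
  have := (pow_two_pow_eq_iff hz (m := 5) (n := 0)).2 rfl
  simpa using this

theorem exists_pow_eq_of_pow_eq_self {R : Type*} [Field R] [CharP R 2] {z x : R}
    (hz : z ^ 5 + z ^ 2 + 1 = 0) (hx : x ^ 32 = x) (h0 : x ≠ 0) : ∃ n : ℕ, z ^ n = x := by
  have hz0 : z ≠ 0 := by rintro rfl; norm_num at hz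
  have hz1 : z ≠ 1 := by
    rintro rfl
    have two : (2 : R) = 0 := CharTwo.two_eq_zero
    exact one_ne_zero (α := R) (by linear_combination hz - two)
  have key : ∀ {y : R}, y ^ 32 = y → y ≠ 0 → y ^ 31 = 1 := fun {y} hy hy0 ↦
    mul_right_cancel₀ hy0 (by rw [← pow_succ, hy, one_mul])
  have hprime : Fact (Nat.Prime 31) := ⟨by norm_num⟩
  have hord := orderOf_eq_prime (key (pow_eq_self_of_gamma hz) hz0) hz1
  have hprim : IsPrimitiveRoot z 31 := hord ▸ IsPrimitiveRoot.orderOf z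
  obtain ⟨n, -, hn⟩ := hprim.eq_pow_of_pow_eq_one (key hx h0)
  exact ⟨n, hn⟩

/-- The compositum of the cyclotomic function field and the constant field extension. -/
abbrev compositum : IntermediateField k2 Omega2 := cycloField M0 ⊔ constExt32

theorem constExt32_eq :
    constExt32 = IntermediateField.adjoin k2 ((X ^ 32 - X : k2[X]).rootSet Omega2) := by
  have hsep : (X ^ 32 - X : k2[X]).Separable := galois_poly_separable 2 32 (by norm_num)
  rw [constExt32]
  congr 1
  ext x
  rw [mem_rootSet, and_iff_right hsep.ne_zero]
  simp [sub_eq_zero]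

instance : FiniteDimensional k2 (cycloField M0) :=
  have : IsSplittingField k2 (cycloField M0) (carlitz M0) :=
    IntermediateField.adjoin_rootSet_isSplittingField (IsAlgClosed.splits _)
  IsSplittingField.finiteDimensional _ (carlitz M0)

instance : IsGalois k2 (cycloField M0) :=
  have : IsSplittingField k2 (cycloField M0) (carlitz M0) :=
    IntermediateField.adjoin_rootSet_isSplittingField (IsAlgClosed.splits _)
  IsGalois.of_separable_splitting_field separable_carlitz_M0

instance : FiniteDimensional k2 constExt32 := by
  have := IntermediateField.adjoin_rootSet_isSplittingField (K := k2) (L := Omega2)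
    (p := X ^ 32 - X) (IsAlgClosed.splits _)
  rw [constExt32_eq]
  exact IsSplittingField.finiteDimensional _ (X ^ 32 - X : k2[X])

instance : IsGalois k2 constExt32 := by
  have := IntermediateField.adjoin_rootSet_isSplittingField (K := k2) (L := Omega2)
    (p := X ^ 32 - X) (IsAlgClosed.splits _)
  rw [constExt32_eq]
  exact IsGalois.of_separable_splitting_field (p := (X ^ 32 - X : k2[X]))
    (galois_poly_separable 2 32 (by norm_num))

instance : FiniteDimensional k2 compositum := IntermediateField.finiteDimensional_sup _ _

instance : IsGalois k2 compositum := inferInstanceAs (IsGalois k2 ↑(cycloField M0 ⊔ constExt32))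

instance (K : IntermediateField k2 Omega2) : CharP K 2 := charP_of_injective_algebraMap' k2 2

theorem exists_adjoin_eq_compositum : ∃ x z : Omega2, IsTorsion (tC Omega2) x ∧ x ≠ 0 ∧
    z ^ 5 + z ^ 2 + 1 = 0 ∧ IntermediateField.adjoin k2 {x, z} = compositum := by
  obtain ⟨x, hx, h0⟩ := exists_isTorsion
  obtain ⟨z, hz⟩ := exists_gamma
  refine ⟨x, z, hx, h0, hz, le_antisymm ?_ (sup_le ?_ ?_)⟩
  · rw [IntermediateField.adjoin_le_iff]
    rintro y (rfl | rfl)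
    · exact (le_sup_left : cycloField M0 ≤ compositum)
        (IntermediateField.subset_adjoin _ _ (mem_rootSet_carlitz.2 hx))
    · exact (le_sup_right : constExt32 ≤ compositum)
        (IntermediateField.subset_adjoin _ _ (pow_eq_self_of_gamma hz))
  · rw [cycloField, IntermediateField.adjoin_le_iff]
    intro y hy
    set F := IntermediateField.adjoin k2 {x, z}
    have hxF : x ∈ F := IntermediateField.subset_adjoin _ _ (Or.inl rfl)
    rcases eq_or_ne y 0 with rfl | hy0
    · exact F.zero_mem
    obtain ⟨n, -, rfl⟩ := hx.exists_iterate h0 (mem_rootSet_carlitz.1 hy) hy0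
    clear hy hy0
    induction n with
    | zero => exact hxF
    | succ n ih =>
      rw [Function.iterate_succ_apply', carlitzAct_apply]
      exact F.add_mem (pow_mem ih 2) (F.mul_mem (F.algebraMap_mem _) ih)
  · rw [constExt32, IntermediateField.adjoin_le_iff]
    intro y hy
    set F := IntermediateField.adjoin k2 {x, z}
    rcases eq_or_ne y 0 with rfl | hy0
    · exact F.zero_mem
    obtain ⟨n, rfl⟩ := exists_pow_eq_of_pow_eq_self hz hy hy0
    exact pow_mem (show z ∈ F from IntermediateField.subset_adjoin _ _ (Or.inr rfl)) n

theorem exists_carlitzGen : ∃ lam gam : compositum, CarlitzGen lam gam := by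
  obtain ⟨x, z, hx, h0, hz, h⟩ := exists_adjoin_eq_compositum
  have hxm : x ∈ compositum := h ▸ IntermediateField.subset_adjoin _ _ (Or.inl rfl)
  have hzm : z ∈ compositum := h ▸ IntermediateField.subset_adjoin _ _ (Or.inr rfl)
  refine ⟨⟨x, hxm⟩, ⟨z, hzm⟩, ?_, fun h ↦ h0 (congrArg Subtype.val h), Subtype.ext hz, ?_⟩
  · have := isTorsion_iff.1 hx
    exact isTorsion_iff.2 (Subtype.ext this)
  · apply IntermediateField.lift_injective
    rw [IntermediateField.lift_adjoin, IntermediateField.lift_top, Set.image_pair]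
    exact h

end Compositum
end CFF

namespace CFF

section Existence

theorem CarlitzGen.orderOf_eq {C : Type*} [Field C] [Algebra k2 C] [FiniteDimensional k2 C]
    [IsGalois k2 C] [CharP C 2] {lam gam : C} (hC : CarlitzGen lam gam) {ρ : C ≃ₐ[k2] C}
    (hρ : Acts lam gam ρ 1 2) : orderOf ρ = 15 := by
  apply Nat.dvd_antisymm
  · exact orderOf_dvd_of_pow_eq_one (hC.eq_of_acts (hρ.pow 15) acts_one (by decide) (by decide))
  · have h := hρ.pow (orderOf ρ)
    rw [pow_orderOf_eq_one] at h
    have := (hC.modEq_of_acts h acts_one).1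
    rw [mul_one] at this
    exact (Nat.modEq_zero_iff_dvd).1 this

/-- The algebra structure of the compositum over one of its subfields. -/
abbrev algebraOfLE {K : IntermediateField k2 Omega2} (h : K ≤ compositum) :
    Algebra K compositum :=
  (IntermediateField.inclusion h).toAlgebra

theorem exists_genus_and_classNumber : ∃ K : IntermediateField k2 Omega2, K ≤ compositum ∧
    genus (ZMod 2) K = 4 ∧ classNumber (ZMod 2) K = 1 := by
  obtain ⟨lam, gam, hC⟩ := exists_carlitzGen
  obtain ⟨ρ, hρ⟩ := hC.exists_acts_eq 1 2
  set K₀ := IntermediateField.fixedField (Subgroup.zpowers ρ)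
  have hmem : ∀ y, y ∈ K₀ ↔ ρ y = y := fun y ↦ by
    rw [IntermediateField.mem_fixedField_iff]
    refine ⟨fun h ↦ h ρ (Subgroup.mem_zpowers ρ), fun h g hg ↦ ?_⟩
    obtain ⟨n, rfl⟩ := (mem_powers_iff_mem_zpowers.2 hg)
    change (ρ ^ n) y = y
    rw [AlgEquiv.coe_pow, Function.iterate_fixed h]
  have hle : IntermediateField.lift K₀ ≤ compositum := IntermediateField.lift_le K₀
  refine ⟨IntermediateField.lift K₀, hle, ?_⟩
  let _ := algebraOfLE hle
  have : IsScalarTower k2 (IntermediateField.lift K₀) compositum := .of_algebraMap_eq fun _ ↦ rfl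
  have h5 : Module.finrank k2 (IntermediateField.lift K₀) = 5 := by
    rw [← (IntermediateField.liftAlgEquiv K₀).toLinearEquiv.finrank_eq]
    have h1 := Module.finrank_mul_finrank k2 K₀ compositum
    rw [IntermediateField.finrank_fixedField_eq_card, Nat.card_zpowers, hC.orderOf_eq hρ,
      hC.finrank_eq] at h1
    omega
  have : FiniteDimensional k2 (IntermediateField.lift K₀) := .of_finrank_pos (by omega)
  have : Algebra.IsSeparable k2 (IntermediateField.lift K₀) :=
    .of_algHom _ compositum (IntermediateField.inclusion hle)
  have hK : FixedBy (IntermediateField.lift K₀) ρ := by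
    refine ⟨fun z ↦ (hmem _).1 ?_, fun y hy ↦ ?_, fun g ↦ ?_⟩
    · exact IntermediateField.mem_lift (F := compositum) _ |>.1 z.2
    · exact ⟨⟨y.1, (IntermediateField.mem_lift y).2 ((hmem y).2 hy)⟩, rfl⟩
    · have h1 : g.restrictScalars k2 ∈ K₀.fixingSubgroup := fun y ↦
        g.commutes ⟨y.1.1, (IntermediateField.mem_lift y.1).2 y.2⟩
      obtain ⟨n, hn⟩ := mem_powers_iff_mem_zpowers.2
        ((IntermediateField.fixingSubgroup_fixedField (Subgroup.zpowers ρ)).le h1)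
      exact ⟨n, hn.symm⟩
  exact genus_and_classNumber_of_fixedBy hC hK hρ h5

end Existence

section Uniqueness

/-- The automorphism `T ↦ T + 1` of `k2`. -/
def shift : k2 ≃+* k2 :=
  IsFractionRing.ringEquivOfRingEquiv (Polynomial.algEquivAevalXAddC (1 : ZMod 2)).toRingEquiv

theorem shift_coord : shift (coord true) = coord true + 1 := by
  have h : coord true = algebraMap (Polynomial (ZMod 2)) k2 Polynomial.X :=
    RatFunc.algebraMap_X.symm
  rw [h, shift, IsFractionRing.ringEquivOfRingEquiv_algebraMap]
  simp [Polynomial.algEquivAevalXAddC]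

theorem exists_shift_omega : ∃ Φ : Omega2 ≃+* Omega2,
    ∀ r, Φ (algebraMap k2 Omega2 r) = algebraMap k2 Omega2 (shift r) :=
  ⟨IsAlgClosure.equivOfEquiv Omega2 Omega2 shift, fun r ↦
    IsAlgClosure.equivOfEquiv_algebraMap Omega2 Omega2 shift r⟩

theorem mem_compositum_of_semilinear {Φ : Omega2 ≃+* Omega2} {ψ : k2 ≃+* k2}
    (hΦ : ∀ r, Φ (algebraMap k2 Omega2 r) = algebraMap k2 Omega2 (ψ r))
    (hT : Φ (tC Omega2) = tC Omega2 + 1) {y : Omega2} (hy : y ∈ compositum) :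
    Φ y ∈ compositum := by
  obtain ⟨x, z, hx, h0, hz, h⟩ := exists_adjoin_eq_compositum
  rw [← h] at hy
  induction hy using IntermediateField.adjoin_induction with
  | mem w hw =>
    rcases hw with rfl | rfl
    · have h1 := hx.map (Φ : Omega2 →+* Omega2)
      rw [RingEquiv.coe_toRingHom, hT] at h1
      exact (le_sup_left : cycloField M0 ≤ compositum) (IntermediateField.subset_adjoin _ _
        (mem_rootSet_carlitz.2 (isTorsion_add_one.1 h1)))
    · refine (le_sup_right : constExt32 ≤ compositum) (IntermediateField.subset_adjoin _ _ ?_)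
      change Φ _ ^ 32 = Φ _
      rw [← map_pow, pow_eq_self_of_gamma hz]
  | algebraMap r => rw [hΦ]; exact compositum.algebraMap_mem _
  | add a b _ _ ha hb => rw [map_add]; exact add_mem ha hb
  | inv a _ ha => rw [map_inv₀]; exact inv_mem ha
  | mul a b _ _ ha hb => rw [map_mul]; exact mul_mem ha hb

theorem exists_shift_compositum : ∃ Φ : compositum ≃+* compositum,
    (∀ r, Φ (algebraMap k2 compositum r) = algebraMap k2 compositum (shift r)) ∧
      Φ (tC compositum) = tC compositum + 1 := by
  obtain ⟨Φ, hΦ⟩ := exists_shift_omega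
  have hT : Φ (tC Omega2) = tC Omega2 + 1 := by rw [hΦ, shift_coord, map_add, map_one]
  have hΦ' : ∀ r, Φ.symm (algebraMap k2 Omega2 r) = algebraMap k2 Omega2 (shift.symm r) :=
    fun r ↦ by rw [RingEquiv.symm_apply_eq, hΦ, RingEquiv.apply_symm_apply]
  have hT' : Φ.symm (tC Omega2) = tC Omega2 + 1 := by
    rw [RingEquiv.symm_apply_eq, map_add, hT, map_one, add_assoc, CharTwo.add_self_eq_zero,
      add_zero]
  exact ⟨{
    toFun y := ⟨Φ y, mem_compositum_of_semilinear hΦ hT y.2⟩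
    invFun y := ⟨Φ.symm y, mem_compositum_of_semilinear hΦ' hT' y.2⟩
    left_inv y := Subtype.ext (Φ.symm_apply_apply y)
    right_inv y := Subtype.ext (Φ.apply_symm_apply y)
    map_mul' a b := Subtype.ext (map_mul Φ a.1 b.1)
    map_add' a b := Subtype.ext (map_add Φ a.1 b.1) },
    fun r ↦ Subtype.ext (hΦ r), Subtype.ext hT⟩

theorem exists_forall_acts_iff_of_le {lam gam : compositum} (hC : CarlitzGen lam gam)
    {K : IntermediateField k2 Omega2} (hK : K ≤ compositum) (h4 : genus (ZMod 2) K = 4)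
    (hh : classNumber (ZMod 2) K = 1) : ∃ d, (d = 2 ∨ d = 3) ∧
      ∀ (g : compositum ≃ₐ[k2] compositum) (e i : ℕ), Acts lam gam g e i →
        ((∀ y : K, g (IntermediateField.inclusion hK y) = IntermediateField.inclusion hK y) ↔
          5 ∣ i + d * e) := by
  let _ := algebraOfLE hK
  have : IsScalarTower k2 K compositum := .of_algebraMap_eq fun _ ↦ rfl
  have : FiniteDimensional k2 K :=
    .of_injective (IntermediateField.inclusion hK).toLinearMap (RingHom.injective _)
  have : Algebra.IsSeparable k2 K := .of_algHom _ compositum (IntermediateField.inclusion hK)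
  exact exists_forall_acts_iff hC h4 hh

theorem mem_of_forall_acts {lam gam : compositum} (hC : CarlitzGen lam gam)
    {K : IntermediateField k2 Omega2} (hK : K ≤ compositum) {d : ℕ}
    (hd : ∀ (g : compositum ≃ₐ[k2] compositum) (e i : ℕ), Acts lam gam g e i →
        ((∀ y : K, g (IntermediateField.inclusion hK y) = IntermediateField.inclusion hK y) ↔
          5 ∣ i + d * e)) {x : compositum}
    (hx : ∀ (g : compositum ≃ₐ[k2] compositum) (e i : ℕ), Acts lam gam g e i →
      5 ∣ i + d * e → g x = x) : (x : Omega2) ∈ K := by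
  let _ := algebraOfLE hK
  have : IsScalarTower k2 K compositum := .of_algebraMap_eq fun _ ↦ rfl
  have : FiniteDimensional k2 K :=
    .of_injective (IntermediateField.inclusion hK).toLinearMap (RingHom.injective _)
  have : Algebra.IsSeparable k2 K := .of_algHom _ compositum (IntermediateField.inclusion hK)
  obtain ⟨z, rfl⟩ := exists_algebraMap_eq_of_forall hC hd hx
  exact z.2

theorem le_of_forall_acts {lam gam : compositum} (hC : CarlitzGen lam gam)
    {K K' : IntermediateField k2 Omega2} (hK : K ≤ compositum) (hK' : K' ≤ compositum) {d : ℕ}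
    (hd : ∀ (g : compositum ≃ₐ[k2] compositum) (e i : ℕ), Acts lam gam g e i →
        ((∀ y : K, g (IntermediateField.inclusion hK y) = IntermediateField.inclusion hK y) ↔
          5 ∣ i + d * e))
    (hd' : ∀ (g : compositum ≃ₐ[k2] compositum) (e i : ℕ), Acts lam gam g e i →
        ((∀ y : K', g (IntermediateField.inclusion hK' y) = IntermediateField.inclusion hK' y) ↔
          5 ∣ i + d * e)) : K ≤ K' := fun y hy ↦
  mem_of_forall_acts hC hK' hd' (x := ⟨y, hK hy⟩) fun g e i hg hi ↦ (hd g e i hg).2 hi ⟨y, hy⟩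

theorem apply_mem_of_forall_acts {lam gam : compositum} (hC : CarlitzGen lam gam)
    {K K' : IntermediateField k2 Omega2} (hK : K ≤ compositum) (hK' : K' ≤ compositum) {d d' : ℕ}
    (hd : ∀ (g : compositum ≃ₐ[k2] compositum) (e i : ℕ), Acts lam gam g e i →
        ((∀ y : K, g (IntermediateField.inclusion hK y) = IntermediateField.inclusion hK y) ↔
          5 ∣ i + d * e))
    (hd' : ∀ (g : compositum ≃ₐ[k2] compositum) (e i : ℕ), Acts lam gam g e i →
        ((∀ y : K', g (IntermediateField.inclusion hK' y) = IntermediateField.inclusion hK' y) ↔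
          5 ∣ i + d' * e))
    (hdd : 5 ∣ d + d') {Φ : compositum ≃+* compositum} {ψ : k2 ≃+* k2}
    (hΦ : ∀ r, Φ (algebraMap k2 compositum r) = algebraMap k2 compositum (ψ r))
    (hT : Φ (tC compositum) = tC compositum + 1) {y : compositum} (hy : (y : Omega2) ∈ K) :
    (Φ y : Omega2) ∈ K' := by
  let _ := algebraOfLE hK
  let _ := algebraOfLE hK'
  have : IsScalarTower k2 K compositum := .of_algebraMap_eq fun _ ↦ rfl
  have : IsScalarTower k2 K' compositum := .of_algebraMap_eq fun _ ↦ rfl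
  have : FiniteDimensional k2 K' :=
    .of_injective (IntermediateField.inclusion hK').toLinearMap (RingHom.injective _)
  have : Algebra.IsSeparable k2 K' := .of_algHom _ compositum (IntermediateField.inclusion hK')
  obtain ⟨z, hz⟩ := exists_algebraMap_eq_apply hC Φ ψ hΦ hT hd hd' hdd ⟨y, hy⟩
  exact (congrArg Subtype.val hz) ▸ z.2

theorem nonempty_ringEquiv {K K' : IntermediateField k2 Omega2} (hK : K ≤ compositum)
    (h4 : genus (ZMod 2) K = 4) (hh : classNumber (ZMod 2) K = 1) (hK' : K' ≤ compositum)
    (h4' : genus (ZMod 2) K' = 4) (hh' : classNumber (ZMod 2) K' = 1) : Nonempty (K ≃+* K') := by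
  obtain ⟨lam, gam, hC⟩ := exists_carlitzGen
  obtain ⟨d, h, hd⟩ := exists_forall_acts_iff_of_le hC hK h4 hh
  obtain ⟨d', h', hd'⟩ := exists_forall_acts_iff_of_le hC hK' h4' hh'
  by_cases hdd : d = d'
  · subst hdd
    obtain rfl : K = K' :=
      le_antisymm (le_of_forall_acts hC hK hK' hd hd') (le_of_forall_acts hC hK' hK hd' hd)
    exact ⟨RingEquiv.refl _⟩
  obtain ⟨Φ, hΦ, hT⟩ := exists_shift_compositum
  have hΦ' : ∀ r, Φ.symm (algebraMap k2 compositum r) = algebraMap k2 compositum (shift.symm r) :=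
    fun r ↦ by rw [RingEquiv.symm_apply_eq, hΦ, RingEquiv.apply_symm_apply]
  have hT' : Φ.symm (tC compositum) = tC compositum + 1 := by
    rw [RingEquiv.symm_apply_eq, map_add, hT, map_one, add_assoc, CharTwo.add_self_eq_zero,
      add_zero]
  refine ⟨{
    toFun y := ⟨Φ ⟨y, hK y.2⟩,
      apply_mem_of_forall_acts hC hK hK' hd hd' (by omega) hΦ hT y.2⟩
    invFun y := ⟨Φ.symm ⟨y, hK' y.2⟩,
      apply_mem_of_forall_acts hC hK' hK hd' hd (by omega) hΦ' hT' y.2⟩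
    left_inv y := Subtype.ext (congrArg (Subtype.val : compositum → Omega2)
        (Φ.symm_apply_apply ⟨y, hK y.2⟩))
    right_inv y := Subtype.ext (congrArg (Subtype.val : compositum → Omega2)
        (Φ.apply_symm_apply ⟨y, hK' y.2⟩))
    map_mul' a b := Subtype.ext (congrArg (Subtype.val : compositum → Omega2)
        (map_mul Φ ⟨a, hK a.2⟩ ⟨b, hK b.2⟩))
    map_add' a b := Subtype.ext (congrArg (Subtype.val : compositum → Omega2)
        (map_add Φ ⟨a, hK a.2⟩ ⟨b, hK b.2⟩)) }⟩

end Uniqueness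
end CFF

open CFF in
/-- For `k = 𝔽₂(T)` and `M = T⁴+T+1`: up to isomorphism there is exactly one
field `K` with `k ⊆ K ⊆ k(Λ_M)·𝔽₃₂` of genus `4` and class number `1`. -/
theorem exists_unique_subfield_of_cyclotomic_compositum :
    (∃ K : IntermediateField k2 Omega2, K ≤ cycloField M0 ⊔ constExt32 ∧
      genus (ZMod 2) K = 4 ∧ classNumber (ZMod 2) K = 1) ∧
    (∀ K K' : IntermediateField k2 Omega2,
      K ≤ cycloField M0 ⊔ constExt32 →
      genus (ZMod 2) K = 4 → classNumber (ZMod 2) K = 1 →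
      K' ≤ cycloField M0 ⊔ constExt32 →
      genus (ZMod 2) K' = 4 → classNumber (ZMod 2) K' = 1 →
      Nonempty (K ≃+* K')) :=
  ⟨exists_genus_and_classNumber, fun _ _ ↦ nonempty_ringEquiv⟩
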